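/- Let Ω ⊂ ℝⁿ be a bounded open set and let p be a locally log-Hölder continuous variable exponent on Ω with p⁺ < ∞. Then B̃V^{p(·)}(Ω) = BV^{p(·)}(Ω), i.e., a function u belongs to the relaxation-defined mixed BV-Sobolev space B̃V^{p(·)}(Ω) if and only if it belongs to the space BV^{p(·)}(Ω) of Harjulehto–Hästö–Latvala. -/

import Mathlib

open MeasureTheory Filter Topology ENNReal Set

noncomputable section

/-- Euclidean space `ℝⁿ`. -/
abbrev Eu (n : ℕ) : Type := EuclideanSpace ℝ (Fin n)

/-- The modular `ρ_{p(·)}(u) = ∫_Ω |u|^{p(x)} dx`. -/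
def vModular {n : ℕ} (p : Eu n → ℝ) (Ω : Set (Eu n)) (u : Eu n → ℝ) : ℝ≥0∞ :=
  ∫⁻ x in Ω, ENNReal.ofReal (|u x| ^ p x)

/-- The gradient modular `∫_Ω |∇u|^{p(x)} dx` (for a.e. differentiable `u`,
`fderiv` is the gradient). -/
def gradModular {n : ℕ} (p : Eu n → ℝ) (Ω : Set (Eu n)) (u : Eu n → ℝ) : ℝ≥0∞ :=
  ∫⁻ x in Ω, ENNReal.ofReal (‖fderiv ℝ u x‖ ^ p x)

/-- Membership in the variable exponent Lebesgue space `L^{p(·)}(Ω)`. -/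
def MemLpVar {n : ℕ} (p : Eu n → ℝ) (Ω : Set (Eu n)) (u : Eu n → ℝ) : Prop :=
  Measurable u ∧ ∃ l : ℝ, 0 < l ∧ vModular p Ω (fun x => u x / l) < ⊤

/-- The Luxemburg norm on `L^{p(·)}(Ω)`. -/
def luxNorm {n : ℕ} (p : Eu n → ℝ) (Ω : Set (Eu n)) (u : Eu n → ℝ) : ℝ :=
  sInf {l : ℝ | 0 < l ∧ vModular p Ω (fun x => u x / l) ≤ 1}

/-- Convergence `v i → u` in `L^{p(·)}(Ω)` (Luxemburg norm convergence). -/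
def LpTendsto {n : ℕ} (p : Eu n → ℝ) (Ω : Set (Eu n)) (v : ℕ → Eu n → ℝ)
    (u : Eu n → ℝ) : Prop :=
  Tendsto (fun i => luxNorm p Ω (fun x => v i x - u x)) atTop (𝓝 0)

/-- `u` is locally Lipschitz on `Ω`. -/
def LocLipOn {n : ℕ} (Ω : Set (Eu n)) (u : Eu n → ℝ) : Prop :=
  ∀ x ∈ Ω, ∃ K : NNReal, ∃ t ∈ 𝓝[Ω] x, LipschitzOnWith K u t

/-- The relaxed mixed pseudo-modular `ρ̃_{BV^{p(·)}(Ω)}(u)`: the infimum of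
`liminf_i ∫_Ω |∇u_i|^{p(x)} dx` over all sequences of locally Lipschitz functions
in `L^{p(·)}(Ω)` converging to `u` in `L^{p(·)}(Ω)`. -/
def bvModular {n : ℕ} (p : Eu n → ℝ) (Ω : Set (Eu n)) (u : Eu n → ℝ) : ℝ≥0∞ :=
  ⨅ (v : ℕ → Eu n → ℝ)
    (_ : (∀ i, LocLipOn Ω (v i) ∧ MemLpVar p Ω (v i)) ∧ LpTendsto p Ω v u),
    Filter.liminf (fun i => gradModular p Ω (v i)) atTop

/-- Membership in the mixed space `B̃V^{p(·)}(Ω)`. -/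
def MemBVt {n : ℕ} (p : Eu n → ℝ) (Ω : Set (Eu n)) (u : Eu n → ℝ) : Prop :=
  MemLpVar p Ω u ∧ bvModular p Ω u < ⊤

/-- The norm `‖u‖_{B̃V^{p(·)}}`. -/
def bvNorm {n : ℕ} (p : Eu n → ℝ) (Ω : Set (Eu n)) (u : Eu n → ℝ) : ℝ :=
  luxNorm p Ω u + sInf {l : ℝ | 0 < l ∧ bvModular p Ω (fun x => u x / l) ≤ 1}

/-- The admissible class `Ã(E)` for the mixed capacity. -/
def admissibleBV {n : ℕ} (p : Eu n → ℝ) (Ω E : Set (Eu n)) : Set (Eu n → ℝ) :=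
  {u | MemBVt p Ω u ∧ (∀ x ∈ Ω, 0 ≤ u x ∧ u x ≤ 1) ∧
       ∃ U : Set (Eu n), IsOpen U ∧ E ⊆ U ∧ ∀ x ∈ U ∩ Ω, u x = 1}

/-- The mixed BV-Sobolev capacity `C̃_{BV^{p(·)}}(E)` (with `inf ∅ = ∞`). -/
def bvCapacity {n : ℕ} (p : Eu n → ℝ) (Ω E : Set (Eu n)) : ℝ≥0∞ :=
  ⨅ (u : Eu n → ℝ) (_ : u ∈ admissibleBV p Ω E), vModular p Ω u + bvModular p Ω u

/-- Divergence of a vector field. -/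
def divg {n : ℕ} (φ : Eu n → Eu n) (x : Eu n) : ℝ :=
  ∑ i, fderiv ℝ φ x (EuclideanSpace.single i 1) i

/-- Total variation `‖Du‖(U)` on an open set `U`, via the defining supremum over
`C¹` vector fields compactly supported in `U` with `|φ| ≤ 1`. -/
def totVarOpen {n : ℕ} (U : Set (Eu n)) (u : Eu n → ℝ) : ℝ≥0∞ :=
  ⨆ (φ : Eu n → Eu n)
    (_ : ContDiff ℝ 1 φ ∧ HasCompactSupport φ ∧ tsupport φ ⊆ U ∧ ∀ x, ‖φ x‖ ≤ 1),
    ENNReal.ofReal (∫ x in U, u x * divg φ x)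

/-- Total variation `‖Du‖(A)` of a set `A ⊆ Ω`, extended from open sets. -/
def totVarIn {n : ℕ} (Ω A : Set (Eu n)) (u : Eu n → ℝ) : ℝ≥0∞ :=
  ⨅ (U : Set (Eu n)) (_ : IsOpen U ∧ A ⊆ U ∧ U ⊆ Ω), totVarOpen U u

/-- `g` is the weak (distributional) gradient of `u` on `Ω`. -/
def IsWeakGrad {n : ℕ} (Ω : Set (Eu n)) (u : Eu n → ℝ) (g : Eu n → Eu n) : Prop :=
  ∀ φ : Eu n → ℝ, ContDiff ℝ 1 φ → HasCompactSupport φ → tsupport φ ⊆ Ω →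
    ∀ i : Fin n,
      (∫ x in Ω, u x * (fderiv ℝ φ x (EuclideanSpace.single i 1))) =
        - ∫ x in Ω, g x i * φ x

/-- The Harjulehto–Hästö–Latvala mixed pseudo-modular
`ρ_{BV^{p(·)}(F)}(u) = ‖Du‖(F ∩ Y) + ∫_{F∖Y} |∇u|^{p(x)} dx`, where `Y = {p = 1}`
and `g` is the weak gradient of `u` on the Sobolev part. -/
def hhlModular {n : ℕ} (p : Eu n → ℝ) (Ω F : Set (Eu n)) (u : Eu n → ℝ)
    (g : Eu n → Eu n) : ℝ≥0∞ :=
  totVarIn Ω (F ∩ {x | p x = 1}) u +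
    ∫⁻ x in F \ {x | p x = 1}, ENNReal.ofReal (‖g x‖ ^ p x)

/-- The HHL mixed pseudo-modular for (smooth) functions whose gradient is `fderiv`. -/
def hhlModularSmooth {n : ℕ} (p : Eu n → ℝ) (Ω F : Set (Eu n)) (v : Eu n → ℝ) : ℝ≥0∞ :=
  totVarIn Ω (F ∩ {x | p x = 1}) v +
    ∫⁻ x in F \ {x | p x = 1}, ENNReal.ofReal (‖fderiv ℝ v x‖ ^ p x)

/-- Membership in the HHL space `BV^{p(·)}(Ω)`: `u ∈ L^{p(·)}(Ω)` and
`inf{λ > 0 : ρ_{BV^{p(·)}(Ω)}(u/λ) ≤ 1} < ∞`. -/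
def MemBVp {n : ℕ} (p : Eu n → ℝ) (Ω : Set (Eu n)) (u : Eu n → ℝ) : Prop :=
  MemLpVar p Ω u ∧
    ∃ g : Eu n → Eu n, IsWeakGrad (Ω \ {x | p x = 1}) u g ∧
      ∃ l : ℝ, 0 < l ∧
        hhlModular p Ω Ω (fun x => u x / l) (fun x => l⁻¹ • g x) ≤ 1

/-- Mollification `u_δ = φ_δ ∗ u` (with `u` extended by zero outside `Ω`),
where `φ_δ(z) = δ^{-n} φ(z/δ)`. -/
def mollify {n : ℕ} (Ω : Set (Eu n)) (u : Eu n → ℝ) (φ : Eu n → ℝ) (δ : ℝ)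
    (x : Eu n) : ℝ :=
  ∫ y in Ω, (δ ^ n)⁻¹ * φ (δ⁻¹ • (x - y)) * u y

/-- `p` is (locally) log-Hölder continuous on `Ω` with constant `c`. -/
def LogHolderOn {n : ℕ} (c : ℝ) (Ω : Set (Eu n)) (p : Eu n → ℝ) : Prop :=
  ∀ x ∈ Ω, ∀ y ∈ Ω, |p x - p y| ≤ c / Real.log (Real.exp 1 + 1 / dist x y)

/-- `p` is globally log-Hölder continuous on `ℝⁿ` with constant `c`. -/
def LogHolderGlobal {n : ℕ} (c : ℝ) (p : Eu n → ℝ) : Prop :=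
  LogHolderOn c Set.univ p ∧
    ∃ pinf : ℝ, 1 ≤ pinf ∧ ∀ x, |p x - pinf| ≤ c / Real.log (Real.exp 1 + ‖x‖)

/-- The variable exponent Sobolev capacity `C_{p(·)}(E)`: infimum of
`∫ |u|^{p(x)} + |∇u|^{p(x)} dx` over `u ∈ W^{1,p(·)}(ℝⁿ)` with `u ≥ 1` on an
open set containing `E`. -/
def sobolevCapacity {n : ℕ} (p : Eu n → ℝ) (E : Set (Eu n)) : ℝ≥0∞ :=
  ⨅ (u : Eu n → ℝ) (g : Eu n → Eu n)
    (_ : MemLpVar p Set.univ u ∧ IsWeakGrad Set.univ u g ∧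
         MemLpVar p Set.univ (fun x => ‖g x‖) ∧
         ∃ U : Set (Eu n), IsOpen U ∧ E ⊆ U ∧ ∀ x ∈ U, 1 ≤ u x),
    vModular p Set.univ u + ∫⁻ x, ENNReal.ofReal (‖g x‖ ^ p x)

/-! ### Elementary inequalities -/

lemma le_one_add_rpow {t q : ℝ} (ht : 0 ≤ t) (hq : 1 ≤ q) : t ≤ 1 + t ^ q := by
  rcases le_total t 1 with h | h
  · have := Real.rpow_nonneg ht q; linarith
  · have := Real.rpow_le_rpow_of_exponent_le h hq
    rw [Real.rpow_one] at this; linarith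

lemma rpow_le_add {t q M : ℝ} (ht : 0 ≤ t) (hq : 1 ≤ q) (hM : q ≤ M) : t ^ q ≤ t + t ^ M := by
  rcases le_total t 1 with h | h
  · have h1 : t ^ q ≤ t := by
      rcases ht.eq_or_lt with h0 | h0
      · rw [← h0, Real.zero_rpow (by linarith)]
      · simpa using Real.rpow_le_rpow_of_exponent_ge h0 h hq
    have := Real.rpow_nonneg ht M; linarith
  · have := Real.rpow_le_rpow_of_exponent_le h hM
    linarith

lemma mul_rpow_le_max {a t q M : ℝ} (ha : 0 ≤ a) (ht : 0 ≤ t) (hq : 1 ≤ q) (hM : q ≤ M) :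
    (a * t) ^ q ≤ (max 1 a) ^ M * t ^ q := by
  rw [Real.mul_rpow ha ht]
  refine mul_le_mul_of_nonneg_right ?_ (Real.rpow_nonneg ht q)
  calc a ^ q ≤ (max 1 a) ^ q := Real.rpow_le_rpow ha (le_max_right _ _) (by linarith)
    _ ≤ (max 1 a) ^ M := Real.rpow_le_rpow_of_exponent_le (le_max_left _ _) hM

lemma mul_rpow_le_of_le_one {a t q : ℝ} (ha : 0 ≤ a) (ha1 : a ≤ 1) (ht : 0 ≤ t) (hq : 1 ≤ q) :
    (a * t) ^ q ≤ a * t ^ q := by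
  rw [Real.mul_rpow ha ht]
  refine mul_le_mul_of_nonneg_right ?_ (Real.rpow_nonneg ht q)
  rcases ha.eq_or_lt with h0 | h0
  · rw [← h0, Real.zero_rpow (by linarith)]
  · simpa using Real.rpow_le_rpow_of_exponent_ge h0 ha1 hq

lemma add_rpow_le_two {a b q M : ℝ} (ha : 0 ≤ a) (hb : 0 ≤ b) (hq : 1 ≤ q) (hM : q ≤ M) :
    (a + b) ^ q ≤ 2 ^ M * (a ^ q + b ^ q) := by
  have h1 : a + b ≤ 2 * max a b := by
    have := le_max_left a b; have := le_max_right a b; linarith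
  have hm : 0 ≤ max a b := le_max_of_le_left ha
  calc (a + b) ^ q ≤ (2 * max a b) ^ q := Real.rpow_le_rpow (by linarith) h1 (by linarith)
    _ ≤ (max 1 2) ^ M * (max a b) ^ q := mul_rpow_le_max (by norm_num) hm hq hM
    _ = 2 ^ M * (max a b) ^ q := by norm_num
    _ ≤ 2 ^ M * (a ^ q + b ^ q) := by
      refine mul_le_mul_of_nonneg_left ?_ (by positivity)
      have := Real.rpow_nonneg ha q
      have := Real.rpow_nonneg hb q
      rcases max_cases a b with h | h <;> rw [h.1] <;> linarith

/-- The modular written for a nonnegative-norm function. -/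
lemma lintegral_le_volume_add {n : ℕ} {p : Eu n → ℝ} {Ω : Set (Eu n)} (hΩ : MeasurableSet Ω)
    (hp1 : ∀ x ∈ Ω, 1 ≤ p x) (f : Eu n → ℝ) (hf : ∀ x, 0 ≤ f x) :
    ∫⁻ x in Ω, ENNReal.ofReal (f x) ≤ volume Ω + ∫⁻ x in Ω, ENNReal.ofReal (f x ^ p x) := by
  calc ∫⁻ x in Ω, ENNReal.ofReal (f x)
      ≤ ∫⁻ x in Ω, (1 + ENNReal.ofReal (f x ^ p x)) := by
        refine setLIntegral_mono' hΩ fun x hx => ?_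
        rw [← ENNReal.ofReal_one, ← ENNReal.ofReal_add zero_le_one (Real.rpow_nonneg (hf x) _)]
        exact ENNReal.ofReal_le_ofReal (le_one_add_rpow (hf x) (hp1 x hx))
    _ = volume Ω + ∫⁻ x in Ω, ENNReal.ofReal (f x ^ p x) := by
        rw [lintegral_add_left measurable_const]; simp

lemma lintegral_mul_rpow_le {n : ℕ} {p : Eu n → ℝ} {Ω : Set (Eu n)} (hΩ : MeasurableSet Ω)
    (hp1 : ∀ x ∈ Ω, 1 ≤ p x) {M : ℝ} (hM : ∀ x ∈ Ω, p x ≤ M) {a : ℝ} (ha : 0 ≤ a)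
    (f : Eu n → ℝ) (hf : ∀ x, 0 ≤ f x) :
    ∫⁻ x in Ω, ENNReal.ofReal ((a * f x) ^ p x) ≤
      ENNReal.ofReal ((max 1 a) ^ M) * ∫⁻ x in Ω, ENNReal.ofReal (f x ^ p x) := by
  rw [← lintegral_const_mul' _ _ ENNReal.ofReal_ne_top]
  refine setLIntegral_mono' hΩ fun x hx => ?_
  rw [← ENNReal.ofReal_mul (by positivity)]
  exact ENNReal.ofReal_le_ofReal (mul_rpow_le_max ha (hf x) (hp1 x hx) (hM x hx))

lemma lintegral_mul_rpow_le_small {n : ℕ} {p : Eu n → ℝ} {Ω : Set (Eu n)} (hΩ : MeasurableSet Ω)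
    (hp1 : ∀ x ∈ Ω, 1 ≤ p x) {a : ℝ} (ha : 0 ≤ a) (ha1 : a ≤ 1)
    (f : Eu n → ℝ) (hf : ∀ x, 0 ≤ f x) :
    ∫⁻ x in Ω, ENNReal.ofReal ((a * f x) ^ p x) ≤
      ENNReal.ofReal a * ∫⁻ x in Ω, ENNReal.ofReal (f x ^ p x) := by
  rw [← lintegral_const_mul' _ _ ENNReal.ofReal_ne_top]
  refine setLIntegral_mono' hΩ fun x hx => ?_
  rw [← ENNReal.ofReal_mul ha]
  exact ENNReal.ofReal_le_ofReal (mul_rpow_le_of_le_one ha ha1 (hf x) (hp1 x hx))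

lemma MemLpVar.modular_lt_top {n : ℕ} {p : Eu n → ℝ} {Ω : Set (Eu n)} (hΩ : MeasurableSet Ω)
    (hp1 : ∀ x ∈ Ω, 1 ≤ p x) {M : ℝ} (hM : ∀ x ∈ Ω, p x ≤ M) {u : Eu n → ℝ}
    (hu : MemLpVar p Ω u) : vModular p Ω u < ⊤ := by
  obtain ⟨_, l, hl, h⟩ := hu
  have h2 := lintegral_mul_rpow_le hΩ hp1 hM hl.le (fun x => |u x / l|) (fun x => abs_nonneg _)
  have h3 : ∀ x, l * |u x / l| = |u x| := fun x => by
    rw [abs_div, abs_of_pos hl]; field_simp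
  simp only [h3] at h2
  exact h2.trans_lt (ENNReal.mul_lt_top ENNReal.ofReal_lt_top h)

lemma memLpVar_of_modular {n : ℕ} {p : Eu n → ℝ} {Ω : Set (Eu n)} {u : Eu n → ℝ}
    (hu : Measurable u) (h : vModular p Ω u < ⊤) : MemLpVar p Ω u :=
  ⟨hu, 1, one_pos, by simpa using h⟩

lemma integrableOn_of_modular {n : ℕ} {p : Eu n → ℝ} {Ω : Set (Eu n)} (hΩ : MeasurableSet Ω)
    (hv : volume Ω < ⊤) (hp1 : ∀ x ∈ Ω, 1 ≤ p x) {u : Eu n → ℝ} (hu : Measurable u)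
    (h : vModular p Ω u < ⊤) : IntegrableOn u Ω := by
  refine ⟨hu.aestronglyMeasurable, ?_⟩
  have h1 := lintegral_le_volume_add hΩ hp1 (fun x => |u x|) (fun x => abs_nonneg _)
  rw [hasFiniteIntegral_iff_norm]
  simp only [Real.norm_eq_abs]
  exact h1.trans_lt (ENNReal.add_lt_top.2 ⟨hv, h⟩)

lemma vModular_sub_lt_top {n : ℕ} {p : Eu n → ℝ} {Ω : Set (Eu n)} (hΩ : MeasurableSet Ω)
    (hpm : Measurable p)
    (hp1 : ∀ x ∈ Ω, 1 ≤ p x) {M : ℝ} (hM : ∀ x ∈ Ω, p x ≤ M) {u v : Eu n → ℝ}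
    (hum : Measurable u)
    (hu : vModular p Ω u < ⊤) (hv : vModular p Ω v < ⊤) :
    vModular p Ω (fun x => u x - v x) < ⊤ := by
  have : vModular p Ω (fun x => u x - v x) ≤
      ENNReal.ofReal (2 ^ M) * (vModular p Ω u + vModular p Ω v) := by
    unfold vModular
    rw [← lintegral_add_left (by fun_prop), ← lintegral_const_mul' _ _ ENNReal.ofReal_ne_top]
    refine setLIntegral_mono' hΩ fun x hx => ?_
    rw [← ENNReal.ofReal_add (by positivity) (by positivity), ← ENNReal.ofReal_mul (by positivity)]
    refine ENNReal.ofReal_le_ofReal (le_trans ?_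
      (add_rpow_le_two (abs_nonneg _) (abs_nonneg _) (hp1 x hx) (hM x hx)))
    exact Real.rpow_le_rpow (abs_nonneg _) (abs_sub _ _) (by linarith [hp1 x hx])
  exact this.trans_lt (ENNReal.mul_lt_top ENNReal.ofReal_lt_top (ENNReal.add_lt_top.2 ⟨hu, hv⟩))

/-- If the Luxemburg norm is `< ε`, the `L¹` norm is at most `ε (|Ω|+1)`. -/
lemma l1_le_of_luxNorm_lt {n : ℕ} {p : Eu n → ℝ} {Ω : Set (Eu n)} (hΩ : MeasurableSet Ω)
    (hp1 : ∀ x ∈ Ω, 1 ≤ p x) {w : Eu n → ℝ}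
    (hw : vModular p Ω w < ⊤) {ε : ℝ} (h : luxNorm p Ω w < ε) :
    ∫⁻ x in Ω, ENNReal.ofReal |w x| ≤ ENNReal.ofReal ε * (volume Ω + 1) := by
  have hne : {l : ℝ | 0 < l ∧ vModular p Ω (fun x => w x / l) ≤ 1}.Nonempty := by
    set A := (vModular p Ω w).toReal
    have hA0 : 0 ≤ A := ENNReal.toReal_nonneg
    refine ⟨A + 1, by linarith, ?_⟩
    have h2 := lintegral_mul_rpow_le_small hΩ hp1 (a := (A+1)⁻¹) (by positivity)
      (inv_le_one_of_one_le₀ (by linarith)) (fun x => |w x|) (fun x => abs_nonneg _)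
    have h3 : ∀ x, |w x / (A+1)| = (A+1)⁻¹ * |w x| := fun x => by
      rw [abs_div, abs_of_pos (by linarith : 0 < A + 1)]; ring
    unfold vModular
    simp only [h3]
    refine h2.trans ?_
    change ENNReal.ofReal _ * vModular p Ω w ≤ 1
    rw [← ENNReal.ofReal_toReal hw.ne, ← ENNReal.ofReal_mul (by positivity), ← ENNReal.ofReal_one]
    apply ENNReal.ofReal_le_ofReal
    rw [inv_mul_le_iff₀ (by linarith)]
    change A ≤ _
    linarith
  obtain ⟨l, ⟨hl0, hl⟩, hlε⟩ := exists_lt_of_csInf_lt hne h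
  have h1 := lintegral_le_volume_add hΩ hp1 (fun x => |w x / l|) (fun x => abs_nonneg _)
  calc ∫⁻ x in Ω, ENNReal.ofReal |w x|
      = ENNReal.ofReal l * ∫⁻ x in Ω, ENNReal.ofReal |w x / l| := by
        rw [← lintegral_const_mul' _ _ ENNReal.ofReal_ne_top]
        congr 1; ext x
        rw [← ENNReal.ofReal_mul hl0.le, abs_div, abs_of_pos hl0]
        congr 1; field_simp
    _ ≤ ENNReal.ofReal ε * (volume Ω + 1) := by
        gcongr
        exact h1.trans (by gcongr; exact hl)

lemma luxNorm_nonneg {n : ℕ} (p : Eu n → ℝ) (Ω : Set (Eu n)) (w : Eu n → ℝ) :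
    0 ≤ luxNorm p Ω w := Real.sInf_nonneg fun _ h => h.1.le

/-- Modular convergence implies norm convergence. -/
lemma lpTendsto_of_modular {n : ℕ} {p : Eu n → ℝ} {Ω : Set (Eu n)} (hΩ : MeasurableSet Ω)
    (hp1 : ∀ x ∈ Ω, 1 ≤ p x) {M : ℝ} (hM : ∀ x ∈ Ω, p x ≤ M) {v : ℕ → Eu n → ℝ} {u : Eu n → ℝ}
    (h : Tendsto (fun i => vModular p Ω (fun x => v i x - u x)) atTop (𝓝 0)) :
    LpTendsto p Ω v u := by
  unfold LpTendsto
  rw [Metric.tendsto_atTop]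
  intro ε hε
  have hl : 0 < ε / 2 := by linarith
  have hC : 0 < ENNReal.ofReal (((max 1 (ε/2)⁻¹) ^ M)⁻¹) := by
    apply ENNReal.ofReal_pos.2; positivity
  obtain ⟨N, hN⟩ := (eventually_atTop.1 (h.eventually (ge_mem_nhds hC)))
  refine ⟨N, fun i hi => ?_⟩
  rw [Real.dist_eq, sub_zero, abs_of_nonneg (luxNorm_nonneg _ _ _)]
  refine lt_of_le_of_lt (b := ε / 2) ?_ (by linarith)
  refine csInf_le ⟨0, fun _ h => h.1.le⟩ ⟨hl, ?_⟩
  have h2 := lintegral_mul_rpow_le hΩ hp1 hM (a := (ε/2)⁻¹) (by positivity)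
    (fun x => |v i x - u x|) (fun x => abs_nonneg _)
  have h3 : ∀ x, |(v i x - u x) / (ε/2)| = (ε/2)⁻¹ * |v i x - u x| := fun x => by
    rw [abs_div, abs_of_pos hl]; ring
  unfold vModular
  simp only [h3]
  refine h2.trans ?_
  calc _ ≤ ENNReal.ofReal ((max 1 (ε/2)⁻¹) ^ M) * ENNReal.ofReal (((max 1 (ε/2)⁻¹) ^ M)⁻¹) := by
        gcongr; exact hN i hi
    _ = 1 := by
        rw [← ENNReal.ofReal_mul (by positivity), mul_inv_cancel₀ (by positivity),
          ENNReal.ofReal_one]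

/-! ### Test functions and integration by parts -/

lemma fderiv_tsupport_subset' {n : ℕ} {φ : Eu n → ℝ} {Ω : Set (Eu n)}
    (h : tsupport φ ⊆ Ω) (v : Eu n) {x : Eu n} (hx : x ∉ Ω) : fderiv ℝ φ x v = 0 := by
  have : x ∉ tsupport (fderiv ℝ φ) := fun hh => hx (h (tsupport_fderiv_subset ℝ hh))
  rw [image_eq_zero_of_notMem_tsupport this]; rfl

/-- Integration by parts for locally Lipschitz functions. -/
lemma locLip_isWeakGrad {n : ℕ} {Ω : Set (Eu n)} (hΩ : IsOpen Ω) {v : Eu n → ℝ}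
    (hv : LocLipOn Ω v) : IsWeakGrad Ω v (fun x => gradient v x) := by
  intro φ hφ hφc hφs i
  set e : Eu n := EuclideanSpace.single i 1 with he
  obtain ⟨K, hK, hK1, hK2⟩ := exists_compact_between hφc hΩ hφs
  have hloc : LocallyLipschitzOn K v := by
    intro x hx
    obtain ⟨C, t, ht, hL⟩ := hv x (hK2 hx)
    exact ⟨C, t, nhdsWithin_mono x hK2 ht, hL⟩
  obtain ⟨C, hC⟩ := hloc.exists_lipschitzOnWith_of_compact hK
  obtain ⟨w, hw, hwv⟩ := hC.extend_real
  obtain ⟨D, hD⟩ := ContDiff.lipschitzWith_of_hasCompactSupport hφc hφ one_ne_zero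
  have hmain := hw.integral_lineDeriv_mul_eq (μ := volume) hD hφc e
  have hdiff : ∀ x, DifferentiableAt ℝ φ x := fun x => (hφ.differentiable one_ne_zero) x
  have heq : ∀ x ∈ tsupport φ, w =ᶠ[𝓝 x] v := fun x hx => by
    filter_upwards [isOpen_interior.mem_nhds (hK1 hx)] with y hy
    exact (hwv (interior_subset hy)).symm
  have h1 : ∫ x in Ω, v x * fderiv ℝ φ x e = ∫ x, v x * fderiv ℝ φ x e := by
    refine setIntegral_eq_integral_of_forall_compl_eq_zero fun x hx => ?_
    rw [fderiv_tsupport_subset' hφs e hx, mul_zero]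
  have h2 : ∫ x in Ω, (gradient v x) i * φ x = ∫ x, (gradient v x) i * φ x := by
    refine setIntegral_eq_integral_of_forall_compl_eq_zero fun x hx => ?_
    rw [image_eq_zero_of_notMem_tsupport (fun hh => hx (hφs hh)), mul_zero]
  rw [h1, h2]
  have h3 : ∫ x, lineDeriv ℝ w x e * φ x = ∫ x, (gradient v x) i * φ x := by
    refine integral_congr_ae ?_
    filter_upwards [hw.ae_differentiableAt (μ := volume)] with x hx
    by_cases hxs : x ∈ tsupport φ
    · have e1 : fderiv ℝ w x = fderiv ℝ v x := (heq x hxs).fderiv_eq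
      have e2 : (gradient v x) i = inner ℝ (gradient v x) e := by
        rw [he, EuclideanSpace.inner_single_right]; simp
      simp only [e2, inner_gradient_left, hx.lineDeriv_eq_fderiv, e1]
    · simp only [image_eq_zero_of_notMem_tsupport hxs, mul_zero]
  have h4 : ∫ x, lineDeriv ℝ φ x (-e) * w x = - ∫ x, v x * fderiv ℝ φ x e := by
    rw [← integral_neg]
    congr 1; ext x
    rw [(hdiff x).lineDeriv_eq_fderiv, map_neg]
    by_cases hxs : x ∈ tsupport φ
    · rw [(heq x hxs).eq_of_nhds]; ring
    · have : fderiv ℝ φ x e = 0 := fderiv_tsupport_subset' (Ω := tsupport φ) le_rfl e hxs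
      rw [this]; simp
  rw [h3, h4] at hmain
  rw [hmain, neg_neg]

lemma norm_gradient_eq {n : ℕ} (v : Eu n → ℝ) (x : Eu n) :
    ‖gradient v x‖ = ‖fderiv ℝ v x‖ := by
  simp [gradient]

lemma measurable_gradient {n : ℕ} (v : Eu n → ℝ) : Measurable (fun x => gradient v x) := by
  have : Measurable (fderiv ℝ v) := measurable_fderiv ℝ v
  exact ((InnerProductSpace.toDual ℝ (Eu n)).symm.continuous.measurable).comp this

/-! ### Convex extraction of an a.e. convergent sequence -/

lemma unit_gap {F : Type*} [NormedAddCommGroup F] [InnerProductSpace ℝ F] (A B : F)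
    (hA : 1 ≤ ‖A‖) (hB : 1 ≤ ‖B‖) :
    ‖‖A‖⁻¹ • A - ‖B‖⁻¹ • B‖ ^ 2 ≤ 8 * ((‖A‖ + ‖B‖) / 2 - ‖(1/2 : ℝ) • (A + B)‖) := by
  set s := ‖A‖ with hs
  set t := ‖B‖ with ht
  set c := inner ℝ A B with hc
  have hcs : c ≤ s * t := real_inner_le_norm A B
  have h1 : ‖A + B‖ ^ 2 = s ^ 2 + 2 * c + t ^ 2 := norm_add_sq_real A B
  have h2 : ‖s⁻¹ • A - t⁻¹ • B‖ ^ 2 = 2 * (s * t - c) / (s * t) := by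
    rw [norm_sub_sq_real, norm_smul, norm_smul, real_inner_smul_left, real_inner_smul_right,
      norm_inv, norm_inv, ← hs, ← ht, ← hc, Real.norm_of_nonneg (by linarith),
      Real.norm_of_nonneg (by linarith)]
    field_simp
    ring
  have h3 : ‖(1/2 : ℝ) • (A + B)‖ = ‖A + B‖ / 2 := by
    rw [norm_smul]; norm_num; ring
  rw [h2, h3]
  set r := ‖A + B‖
  have hr0 : 0 ≤ r := norm_nonneg _
  have hr : r ≤ s + t := norm_add_le _ _
  have h4 : (s + t - r) * (s + t + r) = 2 * (s * t - c) := by nlinarith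
  rw [div_le_iff₀ (by positivity)]
  have h5 : (s + t - r) * (s + t + r) ≤ (s + t - r) * (4 * (s * t)) := by
    apply mul_le_mul_of_nonneg_left _ (by linarith)
    nlinarith [mul_nonneg (sub_nonneg.2 hA) (sub_nonneg.2 hB)]
  nlinarith

/-- The lift `a ↦ (1, a)`. -/
def liftOne {n : ℕ} (a : Eu n) : WithLp 2 (ℝ × Eu n) := WithLp.toLp 2 ((1 : ℝ), a)

lemma norm_liftOne {n : ℕ} (a : Eu n) : ‖liftOne a‖ = Real.sqrt (1 + ‖a‖ ^ 2) := by
  simp [liftOne, WithLp.prod_norm_eq_of_L2]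

lemma one_le_norm_liftOne {n : ℕ} (a : Eu n) : 1 ≤ ‖liftOne a‖ := by
  rw [norm_liftOne]; exact Real.one_le_sqrt.2 (by nlinarith [sq_nonneg ‖a‖])

lemma norm_liftOne_le {n : ℕ} (a : Eu n) : ‖liftOne a‖ ≤ 1 + ‖a‖ := by
  rw [norm_liftOne]
  exact Real.sqrt_le_iff.2 ⟨by positivity, by nlinarith [norm_nonneg a]⟩

lemma continuous_liftOne {n : ℕ} : Continuous (liftOne (n := n)) := by
  unfold liftOne; fun_prop

lemma liftOne_mid {n : ℕ} (a b : Eu n) :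
    liftOne ((1/2 : ℝ) • (a + b)) = (1/2 : ℝ) • (liftOne a + liftOne b) := by
  unfold liftOne
  rw [← WithLp.toLp_add, ← WithLp.toLp_smul]
  congr 1
  ext <;> simp <;> ring

lemma conv_extract {n : ℕ} {μ : Measure (Eu n)} [IsFiniteMeasure μ]
    (C : ℕ → Set (Eu n → Eu n)) (hanti : Antitone C) (hne : ∀ m, (C m).Nonempty)
    (B : ℝ) (hintg : ∀ m, ∀ G ∈ C m, Integrable G μ ∧ ∫ x, ‖G x‖ ∂μ ≤ B)
    (hmeas : ∀ m, ∀ G ∈ C m, Measurable G)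
    (hmid : ∀ m, ∀ G ∈ C m, ∀ G' ∈ C m, (fun x => (1/2 : ℝ) • (G x + G' x)) ∈ C m) :
    ∃ (G : ℕ → Eu n → Eu n) (g : Eu n → Eu n), (∀ m, G m ∈ C m) ∧ Measurable g ∧
      ∀ᵐ x ∂μ, Tendsto (fun m => G m x) atTop (𝓝 (g x)) := by
  set J : (Eu n → Eu n) → ℝ := fun G => ∫ x, ‖liftOne (G x)‖ ∂μ with hJ
  have hli : ∀ G : Eu n → Eu n, Integrable G μ → Integrable (fun x => ‖liftOne (G x)‖) μ := by
    intro G hG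
    refine Integrable.mono' (g := fun x => 1 + ‖G x‖) ((integrable_const _).add hG.norm)
      (continuous_liftOne.norm.comp_aestronglyMeasurable hG.1) ?_
    filter_upwards with x
    rw [norm_norm]; exact norm_liftOne_le _
  have hJ0 : ∀ G, 0 ≤ J G := fun G => integral_nonneg fun x => norm_nonneg _
  have hJB : ∀ m, ∀ G ∈ C m, J G ≤ μ.real univ + B := by
    intro m G hG
    obtain ⟨h1, h2⟩ := hintg m G hG
    calc J G ≤ ∫ x, (1 + ‖G x‖) ∂μ :=
          integral_mono (hli G h1) ((integrable_const _).add h1.norm) fun x => norm_liftOne_le _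
      _ = μ.real univ + ∫ x, ‖G x‖ ∂μ := by
          rw [integral_add (integrable_const _) h1.norm]; simp
      _ ≤ _ := by gcongr
  set α : ℕ → ℝ := fun m => sInf (J '' C m) with hα
  have hbdd : ∀ m, BddBelow (J '' C m) := fun m => ⟨0, by rintro _ ⟨G, _, rfl⟩; exact hJ0 G⟩
  have hαle : ∀ m, ∀ G ∈ C m, α m ≤ J G := fun m G hG => csInf_le (hbdd m) ⟨G, hG, rfl⟩
  have hαmono : Monotone α := fun a b hab =>
    csInf_le_csInf (hbdd a) ((hne b).image J) (image_mono (hanti hab))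
  have hαb : BddAbove (range α) := ⟨μ.real univ + B, by
    rintro _ ⟨m, rfl⟩
    obtain ⟨G, hG⟩ := hne m
    exact (hαle m G hG).trans (hJB m G hG)⟩
  set A := ⨆ m, α m
  have hAle : ∀ m, α m ≤ A := fun m => le_ciSup hαb m
  set ε : ℕ → ℝ := fun N => (1/4 : ℝ) ^ N / 32 with hε
  have hε0 : ∀ N, 0 < ε N := fun N => by positivity
  have hεanti : ∀ {N a}, N ≤ a → ε a ≤ ε N := fun {N a} h => by
    simp only [hε]
    gcongr ?_ / 32
    exact pow_le_pow_of_le_one (by norm_num) (by norm_num) h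
  have hchoose : ∀ N, ∃ k, N ≤ k ∧ A - ε N ≤ α k ∧ ∃ G ∈ C k, J G ≤ A + ε N := by
    intro N
    obtain ⟨k, hk⟩ := exists_lt_of_lt_ciSup (show A - ε N < ⨆ m, α m by linarith [hε0 N])
    refine ⟨max N k, le_max_left _ _, hk.le.trans (hαmono (le_max_right _ _)), ?_⟩
    obtain ⟨_, ⟨G, hG, rfl⟩, hlt⟩ := exists_lt_of_csInf_lt ((hne (max N k)).image J)
      (show α (max N k) < α (max N k) + ε N by linarith [hε0 N])
    exact ⟨G, hG, hlt.le.trans (by linarith [hAle (max N k)])⟩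
  choose k hkN hkα G hGC hGJ using hchoose
  have hGi : ∀ N, Integrable (G N) μ := fun N => (hintg _ _ (hGC N)).1
  set e : ℕ → Eu n → WithLp 2 (ℝ × Eu n) :=
    fun N x => ‖liftOne (G N x)‖⁻¹ • liftOne (G N x) with he
  have hcont : Continuous (fun a : Eu n => ‖liftOne a‖⁻¹ • liftOne a) := by
    refine (continuous_liftOne.norm.inv₀ fun a => ?_).smul continuous_liftOne
    linarith [one_le_norm_liftOne a]
  have hem : ∀ N, AEStronglyMeasurable (e N) μ := fun N =>
    hcont.comp_aestronglyMeasurable (hGi N).1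
  have hgap : ∀ N a b, N ≤ a → N ≤ b →
      ∫⁻ x, ENNReal.ofReal (‖e a x - e b x‖ ^ 2) ∂μ ≤ ENNReal.ofReal (16 * ε N) := by
    intro N a b ha hb
    set mid : Eu n → Eu n := fun x => (1/2 : ℝ) • (G a x + G b x) with hmiddef
    have hmidC : mid ∈ C (min (k a) (k b)) :=
      hmid _ _ (hanti (min_le_left _ _) (hGC a)) _ (hanti (min_le_right _ _) (hGC b))
    have hmidJ : A - ε N ≤ J mid := by
      refine le_trans ?_ (hαle _ _ hmidC)
      rcases min_choice (k a) (k b) with h | h <;> rw [h]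
      · linarith [hkα a, hεanti ha]
      · linarith [hkα b, hεanti hb]
    have hmi : Integrable mid μ := (hintg _ _ hmidC).1
    have hgi : Integrable (fun x => 8 * ((‖liftOne (G a x)‖ + ‖liftOne (G b x)‖) / 2
        - ‖liftOne (mid x)‖)) μ :=
      ((((hli _ (hGi a)).add (hli _ (hGi b))).div_const 2).sub (hli _ hmi)).const_mul 8
    have hpt : ∀ x, ‖e a x - e b x‖ ^ 2 ≤ 8 * ((‖liftOne (G a x)‖ + ‖liftOne (G b x)‖) / 2
        - ‖liftOne (mid x)‖) := by
      intro x
      simp only [hmiddef, liftOne_mid]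
      exact unit_gap _ _ (one_le_norm_liftOne _) (one_le_norm_liftOne _)
    calc _ ≤ ∫⁻ x, ENNReal.ofReal (8 * ((‖liftOne (G a x)‖ + ‖liftOne (G b x)‖) / 2
        - ‖liftOne (mid x)‖)) ∂μ := lintegral_mono fun x => ENNReal.ofReal_le_ofReal (hpt x)
      _ = ENNReal.ofReal (∫ x, 8 * ((‖liftOne (G a x)‖ + ‖liftOne (G b x)‖) / 2
        - ‖liftOne (mid x)‖) ∂μ) := by
          rw [ofReal_integral_eq_lintegral_ofReal hgi]
          filter_upwards with x
          exact (sq_nonneg _).trans (hpt x)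
      _ ≤ _ := by
          apply ENNReal.ofReal_le_ofReal
          have hs : Integrable (fun x => (‖liftOne (G a x)‖ + ‖liftOne (G b x)‖) / 2) μ :=
            ((hli _ (hGi a)).add (hli _ (hGi b))).div_const 2
          rw [integral_const_mul, integral_sub hs (hli _ hmi), integral_div,
            integral_add (hli _ (hGi a)) (hli _ (hGi b))]
          change 8 * ((J (G a) + J (G b)) / 2 - J mid) ≤ _
          linarith [hGJ a, hGJ b, hεanti ha, hεanti hb]
  have hconv : ∀ᵐ x ∂μ, ∃ l, Tendsto (fun N => e N x) atTop (𝓝 l) := by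
    refine Lp.ae_tendsto_of_cauchy_eLpNorm (p := 2) hem (by norm_num)
      (B := fun N => (1/2 : ℝ≥0∞) ^ N) ?_ ?_
    · rw [ENNReal.tsum_geometric]
      simp
    · intro N a b ha hb
      rw [eLpNorm_eq_lintegral_rpow_enorm_toReal (by norm_num) (by norm_num)]
      have h1 : ∫⁻ x, ‖(e a - e b) x‖ₑ ^ (2 : ℝ≥0∞).toReal ∂μ
          ≤ ENNReal.ofReal (16 * ε N) := by
        refine le_trans (le_of_eq ?_) (hgap N a b ha hb)
        congr 1; ext x
        simp only [ENNReal.toReal_ofNat, Pi.sub_apply]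
        rw [← ofReal_norm, ENNReal.ofReal_pow (norm_nonneg _)]
        norm_num
      have h2 : (1/2 : ℝ≥0∞) ^ N = (ENNReal.ofReal ((1/4 : ℝ) ^ N)) ^ (1 / (2 : ℝ≥0∞).toReal) := by
        rw [ENNReal.ofReal_rpow_of_nonneg (by positivity) (by norm_num)]
        have : ((1/4 : ℝ) ^ N) ^ (1 / (2 : ℝ≥0∞).toReal) = (1/2 : ℝ) ^ N := by
          rw [ENNReal.toReal_ofNat, ← Real.sqrt_eq_rpow,
            show (1/4 : ℝ) ^ N = ((1/2 : ℝ) ^ N) ^ 2 by rw [← pow_mul, mul_comm, pow_mul]; norm_num]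
          exact Real.sqrt_sq (by positivity)
        rw [this, ENNReal.ofReal_pow (by norm_num)]
        congr 1
        rw [ENNReal.ofReal_div_of_pos (by norm_num)]; norm_num
      rw [h2]
      apply ENNReal.rpow_lt_rpow _ (by norm_num)
      refine h1.trans_lt ((ENNReal.ofReal_lt_ofReal_iff (by positivity)).2 ?_)
      simp only [hε]
      have : (0:ℝ) < (1/4) ^ N := by positivity
      linarith
  have hfatou : ∀ᵐ x ∂μ, liminf (fun N => ‖G N x‖ₑ) atTop < ⊤ := by
    have hm : Measurable (fun x => liminf (fun N => ‖G N x‖ₑ) atTop) :=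
      Measurable.liminf fun N => (hmeas _ _ (hGC N)).enorm
    refine ae_lt_top hm ?_
    have h1 := lintegral_liminf_le' (μ := μ) (u := atTop) (f := fun N x => ‖G N x‖ₑ)
      (fun N => (hGi N).1.enorm)
    refine ne_top_of_le_ne_top (b := ENNReal.ofReal B) ENNReal.ofReal_ne_top (h1.trans ?_)
    refine liminf_le_of_le (by isBoundedDefault) fun b hb => ?_
    obtain ⟨N, hN⟩ := hb.exists
    refine hN.trans ?_
    rw [← ofReal_integral_norm_eq_lintegral_enorm (hGi N)]
    exact ENNReal.ofReal_le_ofReal (hintg _ _ (hGC N)).2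
  have hlim : ∀ᵐ x ∂μ, ∃ l, Tendsto (fun N => G N x) atTop (𝓝 l) := by
    filter_upwards [hconv, hfatou] with x ⟨l, hl⟩ hx
    have hfst : Tendsto (fun N => ‖liftOne (G N x)‖⁻¹) atTop (𝓝 l.fst) := by
      have h1 : Continuous (fun z : WithLp 2 (ℝ × Eu n) => z.fst) := by fun_prop
      have := (h1.tendsto l).comp hl
      refine this.congr fun N => ?_
      simp [he, liftOne]
    have hsnd : Tendsto (fun N => ‖liftOne (G N x)‖⁻¹ • G N x) atTop (𝓝 l.snd) := by
      have h1 : Continuous (fun z : WithLp 2 (ℝ × Eu n) => z.snd) := by fun_prop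
      have := (h1.tendsto l).comp hl
      refine this.congr fun N => ?_
      simp [he, liftOne]
    have hpos : ∀ N, 0 < ‖liftOne (G N x)‖ := fun N => by linarith [one_le_norm_liftOne (G N x)]
    have hne0 : l.fst ≠ 0 := by
      intro h0
      rw [h0] at hfst
      have h2 : Tendsto (fun N => ‖liftOne (G N x)‖) atTop atTop := by
        have h3 : Tendsto (fun N => ‖liftOne (G N x)‖⁻¹) atTop (𝓝[>] 0) :=
          tendsto_nhdsWithin_iff.2 ⟨hfst, Eventually.of_forall fun N => inv_pos.2 (hpos N)⟩
        exact h3.inv_tendsto_nhdsGT_zero.congr fun N => by simp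
      have h3 : Tendsto (fun N => ‖G N x‖) atTop atTop := by
        have h4 : Tendsto (fun N => ‖liftOne (G N x)‖ - 1) atTop atTop :=
          tendsto_atTop_add_const_right _ _ h2
        exact tendsto_atTop_mono (fun N => by linarith [norm_liftOne_le (G N x)]) h4
      have h5 : Tendsto (fun N => ‖G N x‖ₑ) atTop (𝓝 ⊤) := by
        have := ENNReal.tendsto_ofReal_atTop.comp h3
        refine this.congr fun N => ?_
        simp
      rw [h5.liminf_eq] at hx
      exact lt_irrefl _ hx
    refine ⟨l.fst⁻¹ • l.snd, ?_⟩
    refine ((hfst.inv₀ hne0).smul hsnd).congr fun N => ?_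
    rw [smul_smul, inv_inv, mul_inv_cancel₀ (hpos N).ne', one_smul]
  obtain ⟨g, hg, hgl⟩ := measurable_limit_of_tendsto_metrizable_ae
    (fun N => (hGi N).1.aemeasurable) hlim
  exact ⟨G, g, fun m => hanti (hkN m) (hGC m), hg, hgl⟩

/-! ### Continuity of the exponent -/

lemma LogHolderOn.continuousOn {n : ℕ} {c : ℝ} (hc : 0 < c) {Ω : Set (Eu n)} {p : Eu n → ℝ}
    (h : LogHolderOn c Ω p) : ContinuousOn p Ω := by
  rw [Metric.continuousOn_iff]
  intro x hx ε hε
  refine ⟨Real.exp (-(c / ε)), Real.exp_pos _, fun y hy hd => ?_⟩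
  rcases (dist_nonneg (x := y) (y := x)).eq_or_lt with h0 | h0
  · rw [dist_eq_zero.1 h0.symm, dist_self]; exact hε
  rw [Real.dist_eq]
  refine (h y hy x hx).trans_lt ?_
  have h1 : c / ε < Real.log (Real.exp 1 + 1 / dist y x) := by
    rw [Real.lt_log_iff_exp_lt (by positivity)]
    have : Real.exp (c / ε) < 1 / dist y x := by
      rw [lt_div_iff₀ h0]
      calc Real.exp (c/ε) * dist y x < Real.exp (c/ε) * Real.exp (-(c/ε)) := by gcongr
        _ = 1 := by rw [← Real.exp_add]; simp
    linarith [Real.exp_pos 1]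
  have h2 : 0 < c / ε := by positivity
  rw [div_lt_iff₀ (h2.trans h1)]
  rw [div_lt_iff₀ hε] at h1
  linarith

lemma isOpen_diff_one {n : ℕ} {Ω : Set (Eu n)} {p : Eu n → ℝ} (hΩ : IsOpen Ω)
    (hc : ContinuousOn p Ω) : IsOpen (Ω \ {x | p x = 1}) := by
  have : Ω \ {x | p x = 1} = Ω ∩ p ⁻¹' {1}ᶜ := by ext x; simp
  rw [this]
  exact hc.isOpen_inter_preimage hΩ isOpen_compl_singleton

/-! ### Products with test functions -/

lemma integrableOn_mul_test {n : ℕ} {S : Set (Eu n)} {w ψ : Eu n → ℝ} (hw : IntegrableOn w S)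
    (hψ : Continuous ψ) (hψc : HasCompactSupport ψ) : IntegrableOn (fun x => w x * ψ x) S := by
  obtain ⟨c, hc⟩ := hψ.bounded_above_of_compact_support hψc
  exact Integrable.mul_bdd hw hψ.aestronglyMeasurable (Eventually.of_forall hc)

lemma tendsto_integral_mul_test {n : ℕ} {S : Set (Eu n)} {w : Eu n → ℝ} {v : ℕ → Eu n → ℝ}
    {ψ : Eu n → ℝ} (hw : IntegrableOn w S) (hv : ∀ m, IntegrableOn (v m) S)
    (hψ : Continuous ψ) (hψc : HasCompactSupport ψ)
    (h : Tendsto (fun m => ∫⁻ x in S, ENNReal.ofReal |v m x - w x|) atTop (𝓝 0)) :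
    Tendsto (fun m => ∫ x in S, v m x * ψ x) atTop (𝓝 (∫ x in S, w x * ψ x)) := by
  obtain ⟨c, hc⟩ := hψ.bounded_above_of_compact_support hψc
  refine tendsto_integral_of_L1 _ (integrableOn_mul_test hw hψ hψc).1
    (Eventually.of_forall fun m => integrableOn_mul_test (hv m) hψ hψc) ?_
  have h2 : Tendsto (fun m => ENNReal.ofReal c * ∫⁻ x in S, ENNReal.ofReal |v m x - w x|) atTop
      (𝓝 0) := by
    simpa using ENNReal.Tendsto.const_mul h (Or.inr ENNReal.ofReal_ne_top)
  refine tendsto_of_tendsto_of_tendsto_of_le_of_le tendsto_const_nhds h2 (fun _ => zero_le) ?_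
  intro m
  simp only
  rw [← lintegral_const_mul' _ _ ENNReal.ofReal_ne_top]
  refine lintegral_mono fun x => ?_
  rw [← sub_mul, enorm_mul, mul_comm, ← ofReal_norm, ← ofReal_norm, Real.norm_eq_abs (v m x - w x)]
  gcongr
  exact hc x

lemma continuous_partial {n : ℕ} {φ : Eu n → ℝ} (hφ : ContDiff ℝ 1 φ) (e : Eu n) :
    Continuous (fun x => fderiv ℝ φ x e) :=
  (hφ.continuous_fderiv one_ne_zero).clm_apply continuous_const

lemma hasCompactSupport_partial {n : ℕ} {φ : Eu n → ℝ} (hφ : HasCompactSupport φ) (e : Eu n) :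
    HasCompactSupport (fun x => fderiv ℝ φ x e) := hφ.fderiv_apply ℝ e

lemma contDiff_comp_i {n : ℕ} {φ : Eu n → Eu n} (hφ : ContDiff ℝ 1 φ) (i : Fin n) :
    ContDiff ℝ 1 (fun x => φ x i) := by fun_prop

lemma tsupport_comp_i {n : ℕ} (φ : Eu n → Eu n) (i : Fin n) :
    tsupport (fun x => φ x i) ⊆ tsupport φ := by
  apply closure_mono
  intro x hx h
  apply hx
  simp only [h]; rfl

lemma hasCompactSupport_comp_i {n : ℕ} {φ : Eu n → Eu n} (hφ : HasCompactSupport φ) (i : Fin n) :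
    HasCompactSupport (fun x => φ x i) :=
  IsCompact.of_isClosed_subset hφ (isClosed_tsupport _) (tsupport_comp_i φ i)

lemma fderiv_comp_i {n : ℕ} {φ : Eu n → Eu n} {x : Eu n} (hφ : DifferentiableAt ℝ φ x) (i : Fin n)
    (e : Eu n) : fderiv ℝ (fun x => φ x i) x e = fderiv ℝ φ x e i := by
  have h1 : HasFDerivAt (fun x => φ x i)
      ((EuclideanSpace.proj (𝕜 := ℝ) i : Eu n →L[ℝ] ℝ).comp (fderiv ℝ φ x)) x :=
    ((EuclideanSpace.proj (𝕜 := ℝ) i : Eu n →L[ℝ] ℝ).hasFDerivAt).comp x hφ.hasFDerivAt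
  rw [h1.fderiv]; rfl

lemma integrableOn_coord {n : ℕ} {S : Set (Eu n)} {G : Eu n → Eu n} (h : IntegrableOn G S)
    (i : Fin n) : IntegrableOn (fun x => G x i) S := by
  have := (EuclideanSpace.proj (𝕜 := ℝ) i : Eu n →L[ℝ] ℝ).integrable_comp h
  exact this

/-- The weak gradient identity in divergence form. -/
lemma weakGrad_div {n : ℕ} {S : Set (Eu n)} {w : Eu n → ℝ} {G : Eu n → Eu n}
    (hw : IntegrableOn w S) (hG : IntegrableOn G S) (h : IsWeakGrad S w G) {φ : Eu n → Eu n}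
    (hφ : ContDiff ℝ 1 φ) (hφc : HasCompactSupport φ) (hφs : tsupport φ ⊆ S) :
    ∫ x in S, w x * divg φ x = - ∫ x in S, inner ℝ (G x) (φ x) := by
  have h1 : ∀ x, w x * divg φ x =
      ∑ i, w x * fderiv ℝ (fun x => φ x i) x (EuclideanSpace.single i 1) := fun x => by
    unfold divg
    rw [Finset.mul_sum]
    refine Finset.sum_congr rfl fun i _ => ?_
    rw [fderiv_comp_i (hφ.differentiable one_ne_zero x)]
  have h2 : ∀ x, inner ℝ (G x) (φ x) = ∑ i, G x i * φ x i := fun x => by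
    rw [PiLp.inner_apply]
    refine Finset.sum_congr rfl fun i _ => ?_
    simp [mul_comm]
  simp only [h1, h2]
  rw [integral_finsetSum, integral_finsetSum, ← Finset.sum_neg_distrib]
  · refine Finset.sum_congr rfl fun i _ => ?_
    exact h _ (contDiff_comp_i hφ i) (hasCompactSupport_comp_i hφc i)
      ((tsupport_comp_i φ i).trans hφs) i
  · intro i _
    exact integrableOn_mul_test (integrableOn_coord hG i) (contDiff_comp_i hφ i).continuous
      (hasCompactSupport_comp_i hφc i)
  · intro i _
    exact integrableOn_mul_test hw (continuous_partial (contDiff_comp_i hφ i) _)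
      (hasCompactSupport_partial (hasCompactSupport_comp_i hφc i) _)

lemma continuous_divg {n : ℕ} {φ : Eu n → Eu n} (hφ : ContDiff ℝ 1 φ) : Continuous (divg φ) := by
  have h := hφ.continuous_fderiv one_ne_zero
  unfold divg
  fun_prop

lemma hasCompactSupport_divg {n : ℕ} {φ : Eu n → Eu n} (hφ : HasCompactSupport φ) :
    HasCompactSupport (divg φ) := by
  refine HasCompactSupport.intro (K := tsupport φ) hφ fun x hx => ?_
  have : fderiv ℝ φ x = 0 :=
    image_eq_zero_of_notMem_tsupport fun hh => hx (tsupport_fderiv_subset ℝ hh)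
  simp [divg, this]

lemma divg_eq_zero {n : ℕ} {φ : Eu n → Eu n} {x : Eu n} (hx : x ∉ tsupport φ) : divg φ x = 0 := by
  have : fderiv ℝ φ x = 0 :=
    image_eq_zero_of_notMem_tsupport fun hh => hx (tsupport_fderiv_subset ℝ hh)
  simp [divg, this]

/-- Vitali type convergence. -/
lemma vitali_p {n : ℕ} {p : Eu n → ℝ} {K : Set (Eu n)} (hK : MeasurableSet K)
    (hKv : volume K < ⊤) {q : ℝ} (hq : 1 < q) (hpq : ∀ x ∈ K, q ≤ p x)
    (h : ℕ → Eu n → ℝ) (hm : ∀ m, Measurable (h m)) (h0 : ∀ m x, 0 ≤ h m x)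
    {A : ℝ≥0∞} (hA : A < ⊤) (hb : ∀ m, ∫⁻ x in K, ENNReal.ofReal (h m x ^ p x) ≤ A)
    (hl : ∀ᵐ x ∂volume.restrict K, Tendsto (fun m => h m x) atTop (𝓝 0)) :
    Tendsto (fun m => ∫⁻ x in K, ENNReal.ofReal (h m x)) atTop (𝓝 0) := by
  rw [ENNReal.tendsto_nhds_zero]
  intro ε hε
  have hhalf : 0 < ε / 2 := ENNReal.half_pos hε.ne'
  obtain ⟨N, hN1, hN⟩ : ∃ N : ℝ, 1 ≤ N ∧ ENNReal.ofReal (N ^ (-(q-1))) * A ≤ ε / 2 := by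
    have h1 : Tendsto (fun N : ℝ => ENNReal.ofReal (N ^ (-(q-1))) * A) atTop (𝓝 0) := by
      have := ENNReal.Tendsto.mul_const (b := A)
        (ENNReal.tendsto_ofReal (tendsto_rpow_neg_atTop (show 0 < q - 1 by linarith)))
        (Or.inr hA.ne)
      simpa using this
    obtain ⟨N, hN⟩ := ((h1.eventually (ge_mem_nhds hhalf)).and (eventually_ge_atTop 1)).exists
    exact ⟨N, hN.2, hN.1⟩
  have h2 : Tendsto (fun m => ∫⁻ x in K, ENNReal.ofReal (min (h m x) N)) atTop (𝓝 0) := by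
    have := tendsto_lintegral_of_dominated_convergence (μ := volume.restrict K)
      (F := fun m x => ENNReal.ofReal (min (h m x) N)) (f := fun _ => 0)
      (fun _ => ENNReal.ofReal N) (fun m => by have := hm m; fun_prop)
      (fun m => Eventually.of_forall fun x => ENNReal.ofReal_le_ofReal (min_le_right _ _))
      (by simp [ENNReal.mul_eq_top, hKv.ne]) ?_
    · simpa using this
    · filter_upwards [hl] with x hx
      have h3 : Tendsto (fun m => min (h m x) N) atTop (𝓝 (min 0 N)) :=
        hx.min tendsto_const_nhds
      rw [min_eq_left (by linarith)] at h3
      simpa using ENNReal.tendsto_ofReal h3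
  filter_upwards [h2.eventually (ge_mem_nhds hhalf)] with m hm2
  calc ∫⁻ x in K, ENNReal.ofReal (h m x)
      ≤ ∫⁻ x in K, (ENNReal.ofReal (min (h m x) N) +
          ENNReal.ofReal (N ^ (-(q-1))) * ENNReal.ofReal (h m x ^ p x)) := by
        refine setLIntegral_mono' hK fun x hx => ?_
        rw [← ENNReal.ofReal_mul (by positivity), ← ENNReal.ofReal_add
          (le_min (h0 m x) (by linarith)) (mul_nonneg (by positivity) (Real.rpow_nonneg (h0 m x) _))]
        apply ENNReal.ofReal_le_ofReal
        rcases le_total (h m x) N with hh | hh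
        · rw [min_eq_left hh]
          have : 0 ≤ N ^ (-(q-1)) * h m x ^ p x :=
            mul_nonneg (by positivity) (Real.rpow_nonneg (h0 m x) _)
          linarith
        · have hx0 : 0 < h m x := by linarith
          have h5 : h m x ≤ N ^ (-(q-1)) * h m x ^ p x := by
            calc h m x = (h m x) ^ (-(p x - 1)) * h m x ^ p x := by
                  rw [← Real.rpow_add hx0]; simp
              _ ≤ N ^ (-(q-1)) * h m x ^ p x := by
                  gcongr
                  calc (h m x) ^ (-(p x - 1)) ≤ N ^ (-(p x - 1)) :=
                        Real.rpow_le_rpow_of_nonpos (by linarith) hh (by linarith [hpq x hx])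
                    _ ≤ N ^ (-(q-1)) :=
                        Real.rpow_le_rpow_of_exponent_le hN1 (by linarith [hpq x hx])
          have : 0 ≤ min (h m x) N := le_min (h0 m x) (by linarith)
          linarith
    _ = (∫⁻ x in K, ENNReal.ofReal (min (h m x) N)) +
          ENNReal.ofReal (N ^ (-(q-1))) * ∫⁻ x in K, ENNReal.ofReal (h m x ^ p x) := by
        rw [lintegral_add_left (by have := hm m; fun_prop),
          lintegral_const_mul' _ _ ENNReal.ofReal_ne_top]
    _ ≤ ε / 2 + ε / 2 := by
        refine add_le_add hm2 (le_trans ?_ hN)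
        gcongr
        exact hb m
    _ = ε := ENNReal.add_halves ε

/-! ### Forward direction -/

lemma integrableOn_of_l1_close {n : ℕ} {S : Set (Eu n)} {u w : Eu n → ℝ} (hu : IntegrableOn u S)
    (hw : Measurable w) (hum : Measurable u)
    (h : ∫⁻ x in S, ENNReal.ofReal |w x - u x| < ⊤) : IntegrableOn w S := by
  have h1 : IntegrableOn (fun x => w x - u x) S := by
    refine ⟨(hw.sub hum).aestronglyMeasurable, ?_⟩
    rw [hasFiniteIntegral_iff_norm]
    exact h
  have := h1.add hu
  refine this.congr (Eventually.of_forall fun x => ?_)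
  simp

lemma integrableOn_of_modularG {n : ℕ} {p : Eu n → ℝ} {Ω : Set (Eu n)} (hΩ : MeasurableSet Ω)
    (hv : volume Ω < ⊤) (hp1 : ∀ x ∈ Ω, 1 ≤ p x) {G : Eu n → Eu n} (hG : Measurable G)
    {A : ℝ≥0∞} (hA : A < ⊤)
    (h : ∫⁻ x in Ω, ENNReal.ofReal (‖G x‖ ^ p x) ≤ A) :
    IntegrableOn G Ω ∧ ∫ x in Ω, ‖G x‖ ≤ (volume Ω + A).toReal := by
  have h1 := lintegral_le_volume_add hΩ hp1 (fun x => ‖G x‖) (fun x => norm_nonneg _)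
  have h2 : ∫⁻ x in Ω, ENNReal.ofReal ‖G x‖ ≤ volume Ω + A := h1.trans (by gcongr)
  have h3 : volume Ω + A < ⊤ := ENNReal.add_lt_top.2 ⟨hv, hA⟩
  refine ⟨⟨hG.aestronglyMeasurable, ?_⟩, ?_⟩
  · rw [hasFiniteIntegral_iff_norm]
    exact h2.trans_lt h3
  · rw [integral_eq_lintegral_of_nonneg_ae (Eventually.of_forall fun x => norm_nonneg _)
      hG.norm.aestronglyMeasurable]
    exact ENNReal.toReal_mono h3.ne h2

/-- The classes to which the convex extraction applies. -/
def fwdClass {n : ℕ} (p : Eu n → ℝ) (Ω : Set (Eu n)) (u : Eu n → ℝ) (A : ℝ≥0∞) (m : ℕ) :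
    Set (Eu n → Eu n) :=
  {G | Measurable G ∧ ∫⁻ x in Ω, ENNReal.ofReal (‖G x‖ ^ p x) ≤ A ∧
    ∃ w : Eu n → ℝ, Measurable w ∧
      ∫⁻ x in Ω, ENNReal.ofReal |w x - u x| ≤ ENNReal.ofReal (1 / ((m : ℝ) + 1)) ∧
      IsWeakGrad Ω w G}

lemma fwd_mid {n : ℕ} {p : Eu n → ℝ} {Ω : Set (Eu n)} (hΩ : MeasurableSet Ω)
    (hpm : Measurable p)
    (hv : volume Ω < ⊤) (hp1 : ∀ x ∈ Ω, 1 ≤ p x) {u : Eu n → ℝ} (hum : Measurable u)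
    (hu : IntegrableOn u Ω) {A : ℝ≥0∞} (hA : A < ⊤) (m : ℕ) {G G' : Eu n → Eu n}
    (hG : G ∈ fwdClass p Ω u A m) (hG' : G' ∈ fwdClass p Ω u A m) :
    (fun x => (1/2:ℝ) • (G x + G' x)) ∈ fwdClass p Ω u A m := by
  obtain ⟨h1, h2, w, hw, h3, h4⟩ := hG
  obtain ⟨h1', h2', w', hw', h3', h4'⟩ := hG'
  have iw : IntegrableOn w Ω := integrableOn_of_l1_close hu hw hum (h3.trans_lt ofReal_lt_top)
  have iw' : IntegrableOn w' Ω := integrableOn_of_l1_close hu hw' hum (h3'.trans_lt ofReal_lt_top)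
  have iG := (integrableOn_of_modularG hΩ hv hp1 h1 hA h2).1
  have iG' := (integrableOn_of_modularG hΩ hv hp1 h1' hA h2').1
  have hh : ∀ B : ℝ≥0∞, ENNReal.ofReal (1/2) * (B + B) = B := fun B => by
    rw [ENNReal.ofReal_div_of_pos (by norm_num)]
    simp [← two_mul]
    rw [← mul_assoc, ENNReal.inv_mul_cancel (by norm_num) (by norm_num), one_mul]
  refine ⟨by fun_prop, ?_, fun x => (1/2:ℝ) * (w x + w' x), by fun_prop, ?_, ?_⟩
  · calc ∫⁻ x in Ω, ENNReal.ofReal (‖(1/2:ℝ) • (G x + G' x)‖ ^ p x)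
        ≤ ∫⁻ x in Ω, ENNReal.ofReal (1/2) * (ENNReal.ofReal (‖G x‖ ^ p x) +
            ENNReal.ofReal (‖G' x‖ ^ p x)) := by
          refine setLIntegral_mono' hΩ fun x hx => ?_
          rw [← ENNReal.ofReal_add (by positivity) (by positivity),
            ← ENNReal.ofReal_mul (by norm_num)]
          apply ENNReal.ofReal_le_ofReal
          have hc := (convexOn_rpow (hp1 x hx)).2 (mem_Ici.2 (norm_nonneg (G x)))
            (mem_Ici.2 (norm_nonneg (G' x))) (by norm_num : (0:ℝ) ≤ 1/2)
            (by norm_num : (0:ℝ) ≤ 1/2) (by norm_num)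
          simp only [smul_eq_mul] at hc
          have h6 : ‖(1/2:ℝ) • (G x + G' x)‖ ≤ 1/2 * ‖G x‖ + 1/2 * ‖G' x‖ := by
            rw [norm_smul, Real.norm_eq_abs, abs_of_pos (by norm_num)]
            have := norm_add_le (G x) (G' x)
            linarith
          calc ‖(1/2:ℝ) • (G x + G' x)‖ ^ p x ≤ (1/2 * ‖G x‖ + 1/2 * ‖G' x‖) ^ p x :=
                Real.rpow_le_rpow (norm_nonneg _) h6 (by linarith [hp1 x hx])
            _ ≤ _ := hc
            _ = _ := by ring
      _ = ENNReal.ofReal (1/2) * ((∫⁻ x in Ω, ENNReal.ofReal (‖G x‖ ^ p x)) +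
            ∫⁻ x in Ω, ENNReal.ofReal (‖G' x‖ ^ p x)) := by
          rw [lintegral_const_mul' _ _ ENNReal.ofReal_ne_top, lintegral_add_left (by fun_prop)]
      _ ≤ ENNReal.ofReal (1/2) * (A + A) := by gcongr
      _ = A := hh A
  · calc ∫⁻ x in Ω, ENNReal.ofReal |(1/2:ℝ) * (w x + w' x) - u x|
        ≤ ∫⁻ x in Ω, ENNReal.ofReal (1/2) * (ENNReal.ofReal |w x - u x| +
            ENNReal.ofReal |w' x - u x|) := by
          refine lintegral_mono fun x => ?_
          rw [← ENNReal.ofReal_add (by positivity) (by positivity),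
            ← ENNReal.ofReal_mul (by norm_num)]
          apply ENNReal.ofReal_le_ofReal
          have := abs_add_le (w x - u x) (w' x - u x)
          have h7 : (1/2:ℝ) * (w x + w' x) - u x = (1/2) * ((w x - u x) + (w' x - u x)) := by ring
          rw [h7, abs_mul, abs_of_pos (by norm_num : (0:ℝ) < 1/2)]
          linarith
      _ = ENNReal.ofReal (1/2) * ((∫⁻ x in Ω, ENNReal.ofReal |w x - u x|) +
            ∫⁻ x in Ω, ENNReal.ofReal |w' x - u x|) := by
          rw [lintegral_const_mul' _ _ ENNReal.ofReal_ne_top, lintegral_add_left (by fun_prop)]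
      _ ≤ ENNReal.ofReal (1/2) * (ENNReal.ofReal (1 / ((m : ℝ) + 1)) +
            ENNReal.ofReal (1 / ((m : ℝ) + 1))) := by gcongr
      _ = _ := hh _
  · intro φ hφ hφc hφs i
    have e1 := h4 φ hφ hφc hφs i
    have e2 := h4' φ hφ hφc hφs i
    have i1 := integrableOn_mul_test iw (continuous_partial hφ (EuclideanSpace.single i 1))
      (hasCompactSupport_partial hφc _)
    have i2 := integrableOn_mul_test iw' (continuous_partial hφ (EuclideanSpace.single i 1))
      (hasCompactSupport_partial hφc _)
    have i3 := integrableOn_mul_test (integrableOn_coord iG i) hφ.continuous hφc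
    have i4 := integrableOn_mul_test (integrableOn_coord iG' i) hφ.continuous hφc
    have l1 : ∀ x, (1/2:ℝ) * (w x + w' x) * (fderiv ℝ φ x (EuclideanSpace.single i 1)) =
      (1/2:ℝ) * (w x * (fderiv ℝ φ x (EuclideanSpace.single i 1)) +
        w' x * (fderiv ℝ φ x (EuclideanSpace.single i 1))) := fun x => by ring
    have l2 : ∀ x, ((1/2:ℝ) • (G x + G' x)) i * φ x = (1/2:ℝ) * (G x i * φ x + G' x i * φ x) :=
      fun x => by simp; ring
    simp only [l1, l2]
    rw [integral_const_mul, integral_const_mul, integral_add i1 i2, integral_add i3 i4, e1, e2]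
    ring

/-- Data extracted from membership in the relaxed space. -/
lemma fwd_extract {n : ℕ} {p : Eu n → ℝ} {Ω : Set (Eu n)} (hΩ : IsOpen Ω)
    (hpm : Measurable p) (hv : volume Ω < ⊤)
    (hp1 : ∀ x ∈ Ω, 1 ≤ p x) {M : ℝ} (hM : ∀ x ∈ Ω, p x ≤ M) {u : Eu n → ℝ}
    (h : MemBVt p Ω u) : ∃ A : ℝ≥0∞, A < ⊤ ∧ ∃ (G : ℕ → Eu n → Eu n) (g : Eu n → Eu n),
      (∀ m, G m ∈ fwdClass p Ω u A m) ∧ Measurable g ∧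
      ∀ᵐ x ∂(volume.restrict Ω), Tendsto (fun m => G m x) atTop (𝓝 (g x)) := by
  obtain ⟨hu, hb⟩ := h
  have hΩm := hΩ.measurableSet
  have humod := hu.modular_lt_top hΩm hp1 hM
  have hui := integrableOn_of_modular hΩm hv hp1 hu.1 humod
  unfold bvModular at hb
  simp only [iInf_lt_iff] at hb
  obtain ⟨v, ⟨hvl, hvt⟩, hlim⟩ := hb
  obtain ⟨A, hA1, hA⟩ := exists_between hlim
  have hfreq := frequently_lt_of_liminf_lt (by isBoundedDefault) hA1
  refine ⟨A, hA, ?_⟩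
  have : IsFiniteMeasure (volume.restrict Ω) := ⟨by simpa using hv⟩
  refine conv_extract (μ := volume.restrict Ω) (fwdClass p Ω u A) ?_ ?_ (volume Ω + A).toReal ?_ ?_ ?_
  · intro m k hmk G hG
    obtain ⟨h1, h2, w, hw, h3, h4⟩ := hG
    refine ⟨h1, h2, w, hw, h3.trans ?_, h4⟩
    apply ENNReal.ofReal_le_ofReal
    have : (m:ℝ) ≤ k := by exact_mod_cast hmk
    exact one_div_le_one_div_of_le (by positivity) (by linarith)
  · intro m
    set V := (volume Ω + 1).toReal
    have hV1 : volume Ω + 1 < ⊤ := ENNReal.add_lt_top.2 ⟨hv, by simp⟩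
    set ε : ℝ := (1 / ((m:ℝ) + 1)) / (V + 1)
    have hV0 : 0 ≤ V := ENNReal.toReal_nonneg
    have hε : 0 < ε := by positivity
    obtain ⟨i, hi1, hi2⟩ := (hfreq.and_eventually (hvt.eventually (gt_mem_nhds hε))).exists
    refine ⟨fun x => gradient (v i) x, measurable_gradient _, ?_, v i, (hvl i).2.1, ?_,
      locLip_isWeakGrad hΩ (hvl i).1⟩
    · simp only [norm_gradient_eq]
      exact hi1.le
    · have := l1_le_of_luxNorm_lt hΩm hp1 (vModular_sub_lt_top hΩm hpm hp1 hM (hvl i).2.1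
        ((hvl i).2.modular_lt_top hΩm hp1 hM) humod) hi2
      refine this.trans ?_
      rw [← ENNReal.ofReal_toReal hV1.ne, ← ENNReal.ofReal_mul hε.le]
      apply ENNReal.ofReal_le_ofReal
      change ε * V ≤ _
      have : ε * (V + 1) = 1 / ((m:ℝ) + 1) := by simp only [ε]; field_simp
      nlinarith
  · intro m G hG
    exact integrableOn_of_modularG hΩm hv hp1 hG.1 hA hG.2.1
  · intro m G hG
    exact hG.1
  · intro m G hG G' hG'
    exact fwd_mid hΩm hpm hv hp1 hu.1 hui hA m hG hG'

lemma totVarOpen_le_of_approx {n : ℕ} {Ω : Set (Eu n)} {u : Eu n → ℝ}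
    {w : ℕ → Eu n → ℝ} {G : ℕ → Eu n → Eu n} {B : ℝ}
    (hu : IntegrableOn u Ω) (hw : ∀ m, IntegrableOn (w m) Ω) (hG : ∀ m, IntegrableOn (G m) Ω)
    (hGB : ∀ m, ∫ x in Ω, ‖G m x‖ ≤ B) (hwg : ∀ m, IsWeakGrad Ω (w m) (G m))
    (h : Tendsto (fun m => ∫⁻ x in Ω, ENNReal.ofReal |w m x - u x|) atTop (𝓝 0)) :
    totVarOpen Ω u ≤ ENNReal.ofReal B := by
  refine iSup₂_le fun φ hφ => ENNReal.ofReal_le_ofReal ?_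
  obtain ⟨h1, h2, h3, h4⟩ := hφ
  refine le_of_tendsto (tendsto_integral_mul_test hu hw (continuous_divg h1)
    (hasCompactSupport_divg h2) h) (Eventually.of_forall fun m => ?_)
  rw [weakGrad_div (hw m) (hG m) (hwg m) h1 h2 h3]
  refine le_trans ?_ (hGB m)
  refine (neg_le_abs _).trans ?_
  rw [← Real.norm_eq_abs]
  refine (norm_integral_le_integral_norm _).trans ?_
  refine integral_mono_of_nonneg (Eventually.of_forall fun x => norm_nonneg _) (hG m).norm
    (Eventually.of_forall fun x => ?_)
  refine (norm_inner_le_norm _ _).trans ?_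
  nlinarith [h4 x, norm_nonneg (G m x)]

lemma setIntegral_eq_of_support {n : ℕ} {S T : Set (Eu n)} (hT : MeasurableSet T) (hST : S ⊆ T) {f : Eu n → ℝ}
    (h : ∀ x, x ∉ S → f x = 0) : ∫ x in T, f x = ∫ x in S, f x := 
  setIntegral_eq_of_subset_of_forall_sdiff_eq_zero hT hST fun x hx => h x hx.2

lemma abs_coord_le {n : ℕ} (v : Eu n) (i : Fin n) : |v i| ≤ ‖v‖ := by
  rw [← Real.norm_eq_abs]; exact PiLp.norm_apply_le v i

theorem fwd_main {n : ℕ} {p : Eu n → ℝ} {Ω : Set (Eu n)} (hΩ : IsOpen Ω)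
    (hpm : Measurable p) (hv : volume Ω < ⊤)
    (hp1 : ∀ x ∈ Ω, 1 ≤ p x) {M : ℝ} (hM : ∀ x ∈ Ω, p x ≤ M) (hpc : ContinuousOn p Ω)
    {u : Eu n → ℝ}
    (h : MemBVt p Ω u) : MemBVp p Ω u := by
  obtain ⟨A, hA, G, g, hG, hgm, hlim⟩ := fwd_extract hΩ hpm hv hp1 hM h
  have hu := h.1
  have hΩm := hΩ.measurableSet
  have humod := hu.modular_lt_top hΩm hp1 hM
  have hui := integrableOn_of_modular hΩm hv hp1 hu.1 humod
  choose hGm hGA w hwm hwu hwg using hG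
  have hwi : ∀ m, IntegrableOn (w m) Ω := fun m =>
    integrableOn_of_l1_close hui (hwm m) hu.1 ((hwu m).trans_lt ofReal_lt_top)
  have hGi := fun m => integrableOn_of_modularG hΩm hv hp1 (hGm m) hA (hGA m)
  have hL1 : Tendsto (fun m => ∫⁻ x in Ω, ENNReal.ofReal |w m x - u x|) atTop (𝓝 0) := by
    have h0 : Tendsto (fun m : ℕ => ENNReal.ofReal (1 / ((m : ℝ) + 1))) atTop (𝓝 0) := by
      simpa using ENNReal.tendsto_ofReal (tendsto_one_div_add_atTop_nhds_zero_nat (𝕜 := ℝ))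
    exact tendsto_of_tendsto_of_tendsto_of_le_of_le tendsto_const_nhds h0 (fun _ => zero_le) hwu
  have hTV := totVarOpen_le_of_approx hui hwi (fun m => (hGi m).1) (fun m => (hGi m).2) hwg hL1
  have hgA : ∫⁻ x in Ω, ENNReal.ofReal (‖g x‖ ^ p x) ≤ A := by
    calc ∫⁻ x in Ω, ENNReal.ofReal (‖g x‖ ^ p x)
        ≤ ∫⁻ x in Ω, liminf (fun m => ENNReal.ofReal (‖G m x‖ ^ p x)) atTop := by
          refine lintegral_mono_ae ?_
          filter_upwards [hlim, ae_restrict_mem hΩm] with x hx hxΩ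
          have : Tendsto (fun m => ENNReal.ofReal (‖G m x‖ ^ p x)) atTop
              (𝓝 (ENNReal.ofReal (‖g x‖ ^ p x))) :=
            ENNReal.tendsto_ofReal (hx.norm.rpow_const (Or.inr (by linarith [hp1 x hxΩ])))
          rw [this.liminf_eq]
      _ ≤ liminf (fun m => ∫⁻ x in Ω, ENNReal.ofReal (‖G m x‖ ^ p x)) atTop :=
          lintegral_liminf_le fun m => by have := hGm m; fun_prop
      _ ≤ A := by
          refine (liminf_le_liminf (Eventually.of_forall hGA)).trans ?_
          simp
  have hgi := (integrableOn_of_modularG hΩm hv hp1 hgm hA hgA).1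
  set Y : Set (Eu n) := {x | p x = 1} with hY
  refine ⟨hu, g, ?_, ?_⟩
  · intro φ hφ hφc hφs i
    set e : Eu n := EuclideanSpace.single i 1
    have hs : Ω \ Y ⊆ Ω := sdiff_subset
    have r1 : ∀ f : Eu n → ℝ, (∀ x, x ∉ tsupport φ → f x = 0) →
        ∫ x in Ω \ Y, f x = ∫ x in Ω, f x := fun f hf => by
      refine (setIntegral_eq_of_support hΩm hs fun x hx => hf x fun hh => hx (hφs hh)).symm
    have r2 : ∀ f : Eu n → ℝ, (∀ x, x ∉ tsupport φ → f x = 0) →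
        ∫ x in Ω, f x = ∫ x in tsupport φ, f x := fun f hf =>
      setIntegral_eq_of_support hΩm (hφs.trans hs) hf
    have z1 : ∀ f : Eu n → ℝ, ∀ x, x ∉ tsupport φ → f x * φ x = 0 := fun f x hx => by
      rw [image_eq_zero_of_notMem_tsupport hx, mul_zero]
    have z2 : ∀ f : Eu n → ℝ, ∀ x, x ∉ tsupport φ → f x * fderiv ℝ φ x e = 0 := fun f x hx => by
      rw [fderiv_tsupport_subset' subset_rfl e hx, mul_zero]
    rw [r1 _ (z2 u), r1 _ (z1 (fun x => g x i))]
    have t1 := tendsto_integral_mul_test hui hwi (continuous_partial hφ e)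
      (hasCompactSupport_partial hφc e) hL1
    set K := tsupport φ with hK
    have hKΩ : K ⊆ Ω := hφs.trans hs
    have hKm : MeasurableSet K := (isClosed_tsupport φ).measurableSet
    obtain ⟨q, hq, hpq⟩ := IsCompact.exists_forall_le' hφc (hpc.mono hKΩ) (a := 1) (fun x hx =>
      lt_of_le_of_ne (hp1 x (hKΩ hx)) fun hh => (hφs hx).2 hh.symm)
    have hvit := vitali_p hKm ((measure_mono hKΩ).trans_lt hv) hq hpq
      (fun m x => ‖G m x - g x‖) (fun m => ((hGm m).sub hgm).norm) (fun m x => norm_nonneg _)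
      (A := ENNReal.ofReal (2 ^ M) * (A + A))
      (ENNReal.mul_lt_top ENNReal.ofReal_lt_top (ENNReal.add_lt_top.2 ⟨hA, hA⟩)) (fun m => by
        refine (lintegral_mono_set hKΩ).trans ?_
        calc ∫⁻ x in Ω, ENNReal.ofReal (‖G m x - g x‖ ^ p x)
            ≤ ∫⁻ x in Ω, ENNReal.ofReal (2 ^ M) * (ENNReal.ofReal (‖G m x‖ ^ p x) +
              ENNReal.ofReal (‖g x‖ ^ p x)) := by
              refine setLIntegral_mono' hΩm fun x hx => ?_
              rw [← ENNReal.ofReal_add (by positivity) (by positivity),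
                ← ENNReal.ofReal_mul (by positivity)]
              refine ENNReal.ofReal_le_ofReal (le_trans ?_
                (add_rpow_le_two (norm_nonneg _) (norm_nonneg _) (hp1 x hx) (hM x hx)))
              exact Real.rpow_le_rpow (norm_nonneg _) (norm_sub_le _ _) (by linarith [hp1 x hx])
          _ = ENNReal.ofReal (2 ^ M) * ((∫⁻ x in Ω, ENNReal.ofReal (‖G m x‖ ^ p x)) +
              ∫⁻ x in Ω, ENNReal.ofReal (‖g x‖ ^ p x)) := by
              rw [lintegral_const_mul' _ _ ENNReal.ofReal_ne_top,
                lintegral_add_left (by have := hGm m; fun_prop)]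
          _ ≤ _ := by gcongr; exact hGA m)
      (by
        filter_upwards [ae_restrict_of_ae_restrict_of_subset hKΩ hlim] with x hx
        exact tendsto_iff_norm_sub_tendsto_zero.1 hx)
    have t2 := tendsto_integral_mul_test (S := K) (v := fun m x => G m x i) (w := fun x => g x i)
      ((integrableOn_coord hgi i).mono_set hKΩ)
      (fun m => (integrableOn_coord (hGi m).1 i).mono_set hKΩ) hφ.continuous hφc
      (by
        refine tendsto_of_tendsto_of_tendsto_of_le_of_le tendsto_const_nhds hvit
          (fun _ => zero_le) fun m => ?_
        refine lintegral_mono fun x => ENNReal.ofReal_le_ofReal ?_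
        exact abs_coord_le (G m x - g x) i)
    rw [r2 _ (z1 (fun x => g x i))]
    refine tendsto_nhds_unique t1 ?_
    refine t2.neg.congr fun m => ?_
    rw [← r2 _ (z1 (fun x => G m x i))]
    exact (hwg m φ hφ hφc hKΩ i).symm
  · set B := (volume Ω + A).toReal
    have hB0 : 0 ≤ B := ENNReal.toReal_nonneg
    set l : ℝ := B + A.toReal + 1 with hl
    have hA0 : 0 ≤ A.toReal := ENNReal.toReal_nonneg
    have hl0 : 0 < l := by positivity
    refine ⟨l, hl0, ?_⟩
    have p1 : totVarIn Ω (Ω ∩ Y) (fun x => u x / l) ≤ ENNReal.ofReal (B / l) := by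
      refine (iInf₂_le Ω ⟨hΩ, inter_subset_left, subset_rfl⟩).trans ?_
      refine iSup₂_le fun φ hφ => ENNReal.ofReal_le_ofReal ?_
      have h5 : ENNReal.ofReal (∫ x in Ω, u x * divg φ x) ≤ ENNReal.ofReal B :=
        le_trans (le_iSup₂ (f := fun (φ : Eu n → Eu n) (_ : ContDiff ℝ 1 φ ∧ HasCompactSupport φ ∧
          tsupport φ ⊆ Ω ∧ ∀ x, ‖φ x‖ ≤ 1) => ENNReal.ofReal (∫ x in Ω, u x * divg φ x)) φ hφ) hTV
      rw [ENNReal.ofReal_le_ofReal_iff hB0] at h5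
      have h6 : ∀ x, u x / l * divg φ x = l⁻¹ * (u x * divg φ x) := fun x => by ring
      simp only [h6]
      rw [integral_const_mul, div_eq_inv_mul]
      gcongr
    have p2 : ∫⁻ x in Ω \ Y, ENNReal.ofReal (‖l⁻¹ • g x‖ ^ p x) ≤ ENNReal.ofReal (A.toReal / l) := by
      refine (lintegral_mono_set sdiff_subset).trans ?_
      have h7 := lintegral_mul_rpow_le_small hΩm hp1 (a := l⁻¹) (by positivity)
        (inv_le_one_of_one_le₀ (by linarith)) (fun x => ‖g x‖) (fun x => norm_nonneg _)
      have h8 : ∀ x, ‖l⁻¹ • g x‖ = l⁻¹ * ‖g x‖ := fun x => by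
        rw [norm_smul, Real.norm_eq_abs, abs_of_pos (by positivity)]
      simp only [h8]
      refine h7.trans ?_
      rw [div_eq_inv_mul, ENNReal.ofReal_mul (by positivity), ENNReal.ofReal_toReal hA.ne]
      gcongr
    unfold hhlModular
    refine (add_le_add p1 p2).trans ?_
    rw [← ENNReal.ofReal_add (by positivity) (by positivity), ← add_div, ← ENNReal.ofReal_one]
    apply ENNReal.ofReal_le_ofReal
    rw [div_le_one hl0]; linarith

/-! ### Cleaning the weak gradient -/

lemma clean_comp {n : ℕ} {S : Set (Eu n)} (hS : IsOpen S) {u : Eu n → ℝ} (hu : IntegrableOn u S)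
    {γ : Eu n → ℝ} (e : Eu n)
    (h : ∀ φ : Eu n → ℝ, ContDiff ℝ 1 φ → HasCompactSupport φ → tsupport φ ⊆ S →
      (∫ x in S, u x * (fderiv ℝ φ x e)) = - ∫ x in S, γ x * φ x) :
    ∃ γ' : Eu n → ℝ, Measurable γ' ∧ (∀ x, x ∉ S → γ' x = 0) ∧
      (∀ᵐ x ∂volume.restrict S, |γ' x| ≤ |γ x|) ∧
      ∀ φ : Eu n → ℝ, ContDiff ℝ 1 φ → HasCompactSupport φ → tsupport φ ⊆ S →
      (∫ x in S, u x * (fderiv ℝ φ x e)) = - ∫ x in S, γ' x * φ x := by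
  by_cases hA : ∀ φ : Eu n → ℝ, ContDiff ℝ 1 φ → HasCompactSupport φ → tsupport φ ⊆ S →
      IntegrableOn (fun x => γ x * φ x) S
  · have hloc : LocallyIntegrableOn γ S := by
      intro x hx
      obtain ⟨f, hf1, hf2, hf3, hf4, hf5⟩ :=
        exists_contDiff_tsupport_subset (n := 1) (hS.mem_nhds hx)
      have hintg := hA f hf3 hf2 hf1
      refine ⟨{y | 1/2 < f y} ∩ S, ?_, ?_⟩
      · refine inter_mem (mem_nhdsWithin_of_mem_nhds ?_) self_mem_nhdsWithin
        exact (isOpen_lt continuous_const hf3.continuous).mem_nhds (by simp [hf5]; norm_num)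
      have hb : IntegrableOn (fun x => (γ x * f x) * (max (f x) (1/2))⁻¹) S := by
        have hc : Continuous fun x => (max (f x) (1/2))⁻¹ := by
          have := hf3.continuous
          refine Continuous.inv₀ (by fun_prop) fun x => ?_
          have := le_max_right (f x) (1/2)
          linarith
        refine Integrable.mul_bdd (c := 2) hintg hc.aestronglyMeasurable (Eventually.of_forall fun x => ?_)
        have := le_max_right (f x) (1/2)
        rw [norm_inv, Real.norm_eq_abs, abs_of_pos (by linarith)]
        rw [inv_le_comm₀ (by linarith) (by norm_num)]
        linarith
      refine (hb.mono_set inter_subset_right).congr_fun (fun x hx => ?_)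
        ((isOpen_lt continuous_const hf3.continuous).inter hS).measurableSet
      have hx1 : 1/2 < f x := hx.1
      simp only
      rw [max_eq_left hx1.le, mul_assoc, mul_inv_cancel₀ (by linarith), mul_one]
    have hae : AEStronglyMeasurable γ (volume.restrict S) := hloc.aestronglyMeasurable
    refine ⟨S.indicator (hae.mk γ), hae.stronglyMeasurable_mk.measurable.indicator hS.measurableSet,
      fun x hx => indicator_of_notMem hx _, ?_, ?_⟩
    · filter_upwards [hae.ae_eq_mk, ae_restrict_mem hS.measurableSet] with x hx hxS
      rw [indicator_of_mem hxS, ← hx]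
    · intro φ h1 h2 h3
      rw [h φ h1 h2 h3]
      congr 1
      refine integral_congr_ae ?_
      filter_upwards [hae.ae_eq_mk, ae_restrict_mem hS.measurableSet] with x hx hxS
      rw [indicator_of_mem hxS, ← hx]
  · push Not at hA
    obtain ⟨φ₀, h1, h2, h3, h4⟩ := hA
    have hz : ∀ φ : Eu n → ℝ, ContDiff ℝ 1 φ → HasCompactSupport φ → tsupport φ ⊆ S →
        ¬ IntegrableOn (fun x => γ x * φ x) S → (∫ x in S, u x * (fderiv ℝ φ x e)) = 0 := by
      intro φ k1 k2 k3 k4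
      rw [h φ k1 k2 k3, integral_undef k4, neg_zero]
    refine ⟨fun _ => 0, measurable_const, fun _ _ => rfl, Eventually.of_forall fun x => by simp, ?_⟩
    intro φ k1 k2 k3
    simp only [zero_mul, integral_zero, neg_zero]
    by_cases k4 : IntegrableOn (fun x => γ x * φ x) S
    · have hs := hz (fun x => φ x + φ₀ x) (k1.add h1) (k2.add h2)
        ((tsupport_add φ φ₀).trans (union_subset k3 h3)) (fun hh => by
          apply h4
          refine (hh.sub k4).congr (Eventually.of_forall fun x => ?_)
          simp only [Pi.sub_apply]; ring)
      have h0 := hz φ₀ h1 h2 h3 h4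
      have hd : ∀ x, fderiv ℝ (fun x => φ x + φ₀ x) x e = fderiv ℝ φ x e + fderiv ℝ φ₀ x e :=
        fun x => by
          rw [fderiv_fun_add (k1.differentiable one_ne_zero x) (h1.differentiable one_ne_zero x)]; rfl
      simp only [hd, mul_add] at hs
      rw [integral_add (integrableOn_mul_test hu (continuous_partial k1 e)
        (hasCompactSupport_partial k2 e)) (integrableOn_mul_test hu (continuous_partial h1 e)
        (hasCompactSupport_partial h2 e)), h0, add_zero] at hs
      exact hs
    · exact hz φ k1 k2 k3 k4

lemma clean_grad {n : ℕ} {S : Set (Eu n)} (hS : IsOpen S) {u : Eu n → ℝ} (hu : IntegrableOn u S)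
    {g : Eu n → Eu n} (h : IsWeakGrad S u g) :
    ∃ g' : Eu n → Eu n, Measurable g' ∧ (∀ x, x ∉ S → g' x = 0) ∧ IsWeakGrad S u g' ∧
      ∀ᵐ x ∂volume.restrict S, ‖g' x‖ ≤ ‖g x‖ := by
  have := fun i : Fin n => clean_comp hS hu (γ := fun x => g x i) (EuclideanSpace.single i 1)
    (fun φ h1 h2 h3 => h φ h1 h2 h3 i)
  choose γ c1 c2 c3 c4 using this
  refine ⟨fun x => WithLp.toLp 2 (fun i => γ i x), ?_, ?_, ?_, ?_⟩
  · fun_prop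
  · intro x hx
    ext i
    simp [c2 i x hx]
  · intro φ h1 h2 h3 i
    simpa using c4 i φ h1 h2 h3
  · filter_upwards [ae_all_iff.2 c3] with x hx
    rw [EuclideanSpace.norm_eq, EuclideanSpace.norm_eq]
    apply Real.sqrt_le_sqrt
    refine Finset.sum_le_sum fun i _ => ?_
    simp only [Real.norm_eq_abs]
    exact pow_le_pow_left₀ (abs_nonneg _) (hx i) 2

section
open scoped Manifold ContDiff

/-! ### Finiteness of the total variation -/

lemma le_totVarOpen {n : ℕ} {U : Set (Eu n)} {u : Eu n → ℝ} (hT : totVarOpen U u < ⊤)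
    {φ : Eu n → Eu n} (h1 : ContDiff ℝ 1 φ) (h2 : HasCompactSupport φ) (h3 : tsupport φ ⊆ U)
    (h4 : ∀ x, ‖φ x‖ ≤ 1) : ∫ x in U, u x * divg φ x ≤ (totVarOpen U u).toReal := by
  have h5 : ENNReal.ofReal (∫ x in U, u x * divg φ x) ≤ totVarOpen U u :=
    le_iSup₂ (f := fun (φ : Eu n → Eu n) (_ : ContDiff ℝ 1 φ ∧ HasCompactSupport φ ∧
      tsupport φ ⊆ U ∧ ∀ x, ‖φ x‖ ≤ 1) => ENNReal.ofReal (∫ x in U, u x * divg φ x)) φ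
      ⟨h1, h2, h3, h4⟩
  exact (ENNReal.ofReal_le_iff_le_toReal hT.ne).1 h5

lemma divg_smul_const {n : ℕ} {φ : Eu n → Eu n} (h : ContDiff ℝ 1 φ) (a : ℝ) (x : Eu n) :
    divg (fun x => a • φ x) x = a * divg φ x := by
  unfold divg
  rw [Finset.mul_sum]
  refine Finset.sum_congr rfl fun i _ => ?_
  rw [fderiv_fun_const_smul (h.differentiable one_ne_zero x)]
  simp

lemma divg_add {n : ℕ} {φ ψ : Eu n → Eu n} (h : ContDiff ℝ 1 φ) (h' : ContDiff ℝ 1 ψ) (x : Eu n) :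
    divg (fun x => φ x + ψ x) x = divg φ x + divg ψ x := by
  unfold divg
  rw [← Finset.sum_add_distrib]
  refine Finset.sum_congr rfl fun i _ => ?_
  rw [fderiv_fun_add (h.differentiable one_ne_zero x) (h'.differentiable one_ne_zero x)]
  simp

lemma le_totVarOpen_mul {n : ℕ} {U : Set (Eu n)} {u : Eu n → ℝ} (hT : totVarOpen U u < ⊤)
    {φ : Eu n → Eu n} (h1 : ContDiff ℝ 1 φ) (h2 : HasCompactSupport φ) (h3 : tsupport φ ⊆ U)
    {b : ℝ} (hb : 0 < b)
    (h4 : ∀ x, ‖φ x‖ ≤ b) : ∫ x in U, u x * divg φ x ≤ b * (totVarOpen U u).toReal := by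
  have := le_totVarOpen hT (φ := fun x => b⁻¹ • φ x) (h1.const_smul b⁻¹)
    (h2.smul_left (f := fun _ => b⁻¹))
    ((tsupport_smul_subset_right (fun _ => b⁻¹) φ).trans h3)
    (fun x => by
      rw [norm_smul, norm_inv, Real.norm_eq_abs, abs_of_pos hb, inv_mul_le_iff₀ hb]
      simpa using h4 x)
  simp only [divg_smul_const h1] at this
  have e : ∀ x, u x * (b⁻¹ * divg φ x) = b⁻¹ * (u x * divg φ x) := fun x => by ring
  simp only [e] at this
  rwa [integral_const_mul, inv_mul_le_iff₀ hb] at this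

lemma exists_cutoff {n : ℕ} {C U : Set (Eu n)} (hC : IsCompact C) (hU : IsOpen U) (hCU : C ⊆ U) :
    ∃ η : Eu n → ℝ, ContDiff ℝ 1 η ∧ HasCompactSupport η ∧ tsupport η ⊆ U ∧
      (∀ x, 0 ≤ η x ∧ η x ≤ 1) ∧ ∀ᶠ x in 𝓝ˢ C, η x = 1 := by
  obtain ⟨K, hK, hK1, hK2⟩ := exists_compact_between hC hU hCU
  obtain ⟨f, h1, h2, h3⟩ := exists_contMDiffMap_one_nhds_of_subset_interior (n := 1) 𝓘(ℝ, Eu n)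
    hC.isClosed hK1
  have hts : tsupport f ⊆ K := closure_minimal (fun x hx => by
    by_contra hh; exact hx (h2 x hh)) hK.isClosed
  refine ⟨f, f.contMDiff.contDiff, ?_, hts.trans hK2, fun x => h3 x, h1⟩
  exact hK.of_isClosed_subset (isClosed_tsupport _) hts

lemma totVar_finite {n : ℕ} {Ω U V : Set (Eu n)} (hΩm : MeasurableSet Ω) (hU : IsOpen U)
    (hV : IsOpen V) (hUΩ : U ⊆ Ω) (hVΩ : V ⊆ Ω) (hUV : Ω \ V ⊆ U) {u : Eu n → ℝ}
    (hu : IntegrableOn u Ω)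
    (hT : totVarOpen U u < ⊤) {g : Eu n → Eu n} (hg : IntegrableOn g V) (hw : IsWeakGrad V u g) :
    totVarOpen Ω u < ⊤ := by
  refine lt_of_le_of_lt (b := ENNReal.ofReal ((totVarOpen U u).toReal + ∫ x in V, ‖g x‖)) ?_
    ofReal_lt_top
  refine iSup₂_le fun φ hφ => ENNReal.ofReal_le_ofReal ?_
  obtain ⟨h1, h2, h3, h4⟩ := hφ
  have hC : IsCompact (tsupport φ \ V) := h2.diff hV
  obtain ⟨η, e1, e2, e3, e4, e5⟩ := exists_cutoff hC hU (fun x hx => hUV ⟨h3 hx.1, hx.2⟩)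
  set φ1 : Eu n → Eu n := fun x => η x • φ x with hφ1
  set φ2 : Eu n → Eu n := fun x => (1 - η x) • φ x with hφ2
  have c1 : ContDiff ℝ 1 φ1 := e1.smul h1
  have c2 : ContDiff ℝ 1 φ2 := (contDiff_const.sub e1).smul h1
  have s1 : HasCompactSupport φ1 := h2.smul_left (f := η)
  have s2 : HasCompactSupport φ2 := h2.smul_left (f := fun x => 1 - η x)
  have t1 : tsupport φ1 ⊆ U := (tsupport_smul_subset_left η φ).trans e3
  have t2 : tsupport φ2 ⊆ V := by
    intro x hx
    by_contra hxV
    have hx1 : x ∈ tsupport φ := tsupport_smul_subset_right (fun x => 1 - η x) φ hx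
    have : ∀ᶠ y in 𝓝 x, η y = 1 := (eventually_nhdsSet_iff_forall.1 e5) x ⟨hx1, hxV⟩
    have h0 : φ2 =ᶠ[𝓝 x] 0 := by
      filter_upwards [this] with y hy
      simp [hφ2, hy]
    exact (notMem_tsupport_iff_eventuallyEq.2 h0) hx
  have hsum : ∀ x, divg φ x = divg φ1 x + divg φ2 x := fun x => by
    rw [← divg_add c1 c2]
    congr 1
    ext1 x
    simp only [hφ1, hφ2, ← add_smul]
    simp
  simp only [hsum, mul_add]
  rw [integral_add (integrableOn_mul_test hu (continuous_divg c1) (hasCompactSupport_divg s1))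
    (integrableOn_mul_test hu (continuous_divg c2) (hasCompactSupport_divg s2))]
  refine add_le_add ?_ ?_
  · rw [setIntegral_eq_of_support hΩm hUΩ fun x hx => by
      rw [divg_eq_zero fun hh => hx (t1 hh), mul_zero]]
    refine le_totVarOpen hT c1 s1 t1 fun x => ?_
    rw [hφ1, norm_smul, Real.norm_eq_abs, abs_of_nonneg (e4 x).1]
    exact mul_le_one₀ (e4 x).2 (norm_nonneg _) (h4 x)
  · rw [setIntegral_eq_of_support hΩm hVΩ fun x hx => by
      rw [divg_eq_zero fun hh => hx (t2 hh), mul_zero]]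
    rw [weakGrad_div (hu.mono_set hVΩ) hg hw c2 s2 t2]
    refine (neg_le_abs _).trans ?_
    rw [← Real.norm_eq_abs]
    refine (norm_integral_le_integral_norm _).trans ?_
    refine integral_mono_of_nonneg (Eventually.of_forall fun x => norm_nonneg _) hg.norm
      (Eventually.of_forall fun x => ?_)
    refine (norm_inner_le_norm _ _).trans ?_
    have : ‖φ2 x‖ ≤ 1 := by
      rw [hφ2, norm_smul, Real.norm_eq_abs, abs_of_nonneg (by linarith [(e4 x).2])]
      exact mul_le_one₀ (by linarith [(e4 x).1]) (norm_nonneg _) (h4 x)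
    nlinarith [norm_nonneg (g x)]
end

lemma rev_data {n : ℕ} {p : Eu n → ℝ} {Ω : Set (Eu n)} (hΩ : IsOpen Ω) (hv : volume Ω < ⊤)
    (hp1 : ∀ x ∈ Ω, 1 ≤ p x) {M : ℝ} (hM : ∀ x ∈ Ω, p x ≤ M) (hpc : ContinuousOn p Ω)
    {u : Eu n → ℝ} (h : MemBVp p Ω u) :
    IntegrableOn u Ω ∧ totVarOpen Ω u < ⊤ ∧
    ∃ g : Eu n → Eu n, Measurable g ∧ (∀ x, x ∉ Ω \ {x | p x = 1} → g x = 0) ∧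
      IsWeakGrad (Ω \ {x | p x = 1}) u g ∧ IntegrableOn g (Ω \ {x | p x = 1}) ∧
      ∫⁻ x in Ω \ {x | p x = 1}, ENNReal.ofReal (‖g x‖ ^ p x) < ⊤ := by
  obtain ⟨hu, g₀, hg₀, l, hl, hmod⟩ := h
  have hΩm := hΩ.measurableSet
  have humod := hu.modular_lt_top hΩm hp1 hM
  have hui := integrableOn_of_modular hΩm hv hp1 hu.1 humod
  have hVo := isOpen_diff_one hΩ hpc
  have hVΩ : Ω \ {x | p x = 1} ⊆ Ω := sdiff_subset
  have hp1' : ∀ x ∈ Ω \ {x | p x = 1}, 1 ≤ p x := fun x hx => hp1 x hx.1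
  have hM' : ∀ x ∈ Ω \ {x | p x = 1}, p x ≤ M := fun x hx => hM x hx.1
  have hvV : volume (Ω \ {x | p x = 1}) < ⊤ := (measure_mono hVΩ).trans_lt hv
  obtain ⟨g, g1, g2, g3, g4⟩ := clean_grad hVo (hui.mono_set hVΩ) hg₀
  have hgl : ∫⁻ x in Ω \ {x | p x = 1}, ENNReal.ofReal (‖g x‖ ^ p x) < ⊤ := by
    have h2 := lintegral_mul_rpow_le hVo.measurableSet hp1' hM' hl.le (fun x => ‖l⁻¹ • g x‖)
      (fun x => norm_nonneg _)
    have h3 : ∀ x, l * ‖l⁻¹ • g x‖ = ‖g x‖ := fun x => by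
      rw [norm_smul, norm_inv, Real.norm_eq_abs, abs_of_pos hl]; field_simp
    simp only [h3] at h2
    refine h2.trans_lt (ENNReal.mul_lt_top ENNReal.ofReal_lt_top ?_)
    refine lt_of_le_of_lt (lintegral_mono_ae ?_) ((le_add_self.trans hmod).trans_lt one_lt_top)
    filter_upwards [g4, ae_restrict_mem hVo.measurableSet] with x hx hxV
    refine ENNReal.ofReal_le_ofReal (Real.rpow_le_rpow (norm_nonneg _) ?_
      (by linarith [hp1' x hxV]))
    rw [norm_smul, norm_smul]
    gcongr
  have hgi := (integrableOn_of_modularG hVo.measurableSet hvV hp1' g1 hgl le_rfl).1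
  refine ⟨hui, ?_, g, g1, g2, g3, hgi, hgl⟩
  have hin : totVarIn Ω (Ω ∩ {x | p x = 1}) (fun x => u x / l) < ⊤ :=
    (le_self_add.trans hmod).trans_lt one_lt_top
  unfold totVarIn at hin
  simp only [iInf_lt_iff] at hin
  obtain ⟨U, ⟨hU, hYU, hUΩ⟩, hT⟩ := hin
  refine totVar_finite hΩm hU hVo hUΩ hVΩ (fun x hx => hYU ⟨hx.1, ?_⟩) hui ?_ hgi g3
  · by_contra hh
    exact hx.2 ⟨hx.1, hh⟩
  · refine lt_of_le_of_lt (b := ENNReal.ofReal (l * (totVarOpen U fun x => u x / l).toReal)) ?_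
      ofReal_lt_top
    refine iSup₂_le fun φ hφ => ENNReal.ofReal_le_ofReal ?_
    have := le_totVarOpen hT hφ.1 hφ.2.1 hφ.2.2.1 hφ.2.2.2
    have e : ∀ x, u x / l * divg φ x = l⁻¹ * (u x * divg φ x) := fun x => by ring
    simp only [e] at this
    rwa [integral_const_mul, inv_mul_le_iff₀ hl] at this

/-! ### The variable scale mollifier -/

/-- A standard mollifier. -/
structure Moll {n : ℕ} (φ : Eu n → ℝ) (B : ℝ) : Prop where
  c1 : ContDiff ℝ 1 φ
  nonneg : ∀ z, 0 ≤ φ z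
  supp : ∀ z, φ z ≠ 0 → ‖z‖ < 1
  int : ∫ z, φ z = 1
  bd : ∀ z, φ z ≤ B
  dbd : ∀ z, ‖fderiv ℝ φ z‖ ≤ B

/-- A variable scale function on the domain. -/
structure Scale {n : ℕ} (Ω : Set (Eu n)) (δ : Eu n → ℝ) : Prop where
  c1 : ContDiff ℝ 1 δ
  pos : ∀ x ∈ Ω, 0 < δ x
  zero : ∀ x, x ∉ Ω → δ x = 0
  le_one : ∀ x, δ x ≤ 1
  dbd : ∀ x, ‖fderiv ℝ δ x‖ ≤ 1 / 2

/-- The kernel. -/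
def vker {n : ℕ} (δ φ : Eu n → ℝ) (x y : Eu n) : ℝ :=
  ((δ x)⁻¹) ^ n * φ ((δ x)⁻¹ • (x - y))

lemma exists_moll (n : ℕ) : ∃ (φ : Eu n → ℝ) (B : ℝ), Moll φ B := by
  let f : ContDiffBump (0 : Eu n) := ⟨1/2, 1, by norm_num, by norm_num⟩
  set φ := f.normed volume with hφ
  have hc : ContDiff ℝ 1 φ := f.contDiff_normed (n := 1)
  have hcs : HasCompactSupport φ := f.hasCompactSupport_normed
  obtain ⟨B1, hB1⟩ := hc.continuous.bounded_above_of_compact_support hcs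
  obtain ⟨B2, hB2⟩ := (hc.continuous_fderiv one_ne_zero).bounded_above_of_compact_support
    (hcs.fderiv ℝ)
  refine ⟨φ, max B1 B2, hc, fun z => f.nonneg_normed z, ?_, f.integral_normed, ?_, ?_⟩
  · intro z hz
    have : z ∈ Function.support φ := hz
    rw [hφ, f.support_normed_eq] at this
    simpa [f] using this
  · intro z
    exact (le_abs_self _).trans ((hB1 z).trans (le_max_left _ _))
  · intro z
    exact (hB2 z).trans (le_max_right _ _)

lemma exists_scale {n : ℕ} {Ω : Set (Eu n)} (hΩ : IsOpen Ω) (hb : Bornology.IsBounded Ω) {ε : ℝ}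
    (hε : 0 < ε) : ∃ δ : Eu n → ℝ, Scale Ω δ ∧ ∀ x, δ x ≤ ε := by
  obtain ⟨f, h1, h2, h3⟩ := hΩ.exists_contDiff_support_eq (n := 1)
  have hcs : HasCompactSupport f := by
    unfold HasCompactSupport tsupport
    rw [h1]
    exact hb.isCompact_closure
  obtain ⟨B, hB⟩ := (h2.continuous_fderiv one_ne_zero).bounded_above_of_compact_support
    (hcs.fderiv ℝ)
  have hB0 : 0 ≤ B := (norm_nonneg _).trans (hB 0)
  set a : ℝ := min (min 1 ε) (1 / (2 * (B + 1))) with ha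
  have ha0 : 0 < a := by positivity
  have ha1 : a ≤ 1 := (min_le_left _ _).trans (min_le_left _ _)
  have haε : a ≤ ε := (min_le_left _ _).trans (min_le_right _ _)
  have haB : a ≤ 1 / (2 * (B + 1)) := min_le_right _ _
  have f01 : ∀ x, 0 ≤ f x ∧ f x ≤ 1 := fun x => h3 (mem_range_self x)
  refine ⟨fun x => a * f x, ⟨contDiff_const.mul h2, ?_, ?_, ?_, ?_⟩, ?_⟩
  · intro x hx
    have : f x ≠ 0 := by rw [← h1] at hx; exact hx
    exact mul_pos ha0 (lt_of_le_of_ne (f01 x).1 this.symm)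
  · intro x hx
    have : f x = 0 := by rw [← h1] at hx; simpa using hx
    simp [this]
  · intro x; nlinarith [f01 x]
  · intro x
    rw [fderiv_const_mul (h2.differentiable one_ne_zero x), norm_smul, Real.norm_eq_abs,
      abs_of_pos ha0]
    calc a * ‖fderiv ℝ f x‖ ≤ 1 / (2 * (B + 1)) * (B + 1) := by
          gcongr; linarith [hB x]
      _ = 1 / 2 := by field_simp
  · intro x; nlinarith [f01 x]

section
variable {n : ℕ} {Ω : Set (Eu n)} {δ φ : Eu n → ℝ} {B : ℝ}

lemma Moll.B_nonneg (hφ : Moll φ B) : 0 ≤ B := (norm_nonneg _).trans (hφ.dbd 0)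

lemma Moll.tsupport_subset (hφ : Moll φ B) : tsupport φ ⊆ Metric.closedBall 0 1 := by
  refine closure_minimal (fun z hz => ?_) Metric.isClosed_closedBall
  simpa using (hφ.supp z hz).le

lemma Moll.hasCompactSupport (hφ : Moll φ B) : HasCompactSupport φ :=
  (isCompact_closedBall _ _).of_isClosed_subset (isClosed_tsupport _) hφ.tsupport_subset

lemma Moll.fderiv_supp (hφ : Moll φ B) {z : Eu n} (hz : fderiv ℝ φ z ≠ 0) : ‖z‖ ≤ 1 := by
  by_contra hh
  apply hz
  apply image_eq_zero_of_notMem_tsupport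
  intro h
  apply hh
  simpa using hφ.tsupport_subset (tsupport_fderiv_subset ℝ h)

lemma Scale.nonneg (hδ : Scale Ω δ) (x : Eu n) : 0 ≤ δ x := by
  by_cases h : x ∈ Ω
  · exact (hδ.pos x h).le
  · rw [hδ.zero x h]

lemma Scale.lip (hδ : Scale Ω δ) (x y : Eu n) : |δ x - δ y| ≤ 1 / 2 * ‖x - y‖ := by
  have := lipschitzWith_of_nnnorm_fderiv_le (C := 1/2) (hδ.c1.differentiable one_ne_zero)
    (fun x => by
      have := hδ.dbd x
      rw [← NNReal.coe_le_coe]; simpa using this)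
  have h := this.dist_le_mul x y
  rw [Real.dist_eq, dist_eq_norm] at h
  simpa using h

lemma Scale.mem_of_pos (hδ : Scale Ω δ) {x : Eu n} (h : 0 < δ x) : x ∈ Ω := by
  by_contra hh
  rw [hδ.zero x hh] at h
  exact lt_irrefl _ h

lemma Scale.half_le (hδ : Scale Ω δ) {x y : Eu n} (h : ‖x - y‖ ≤ δ x) : δ x / 2 ≤ δ y := by
  have := abs_le.1 (hδ.lip x y)
  linarith [this.2]

lemma Scale.le_of (hδ : Scale Ω δ) {x y : Eu n} (h : ‖x - y‖ ≤ δ x) : δ y ≤ 3 / 2 * δ x := by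
  have := abs_le.1 (hδ.lip x y)
  linarith [this.1]

lemma Scale.ball_subset (hδ : Scale Ω δ) {x : Eu n} (hx : x ∈ Ω) :
    Metric.closedBall x (δ x) ⊆ Ω := by
  intro y hy
  rw [Metric.mem_closedBall, dist_comm, dist_eq_norm] at hy
  apply hδ.mem_of_pos
  linarith [hδ.half_le hy, hδ.pos x hx]

lemma norm_smul_inv {a : ℝ} (ha : 0 < a) (v : Eu n) : ‖a⁻¹ • v‖ = ‖v‖ / a := by
  rw [norm_smul, norm_inv, Real.norm_eq_abs, abs_of_pos ha]; ring

lemma vker_nonneg (hδ : Scale Ω δ) (hφ : Moll φ B) (x y : Eu n) : 0 ≤ vker δ φ x y :=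
  mul_nonneg (pow_nonneg (inv_nonneg.2 (hδ.nonneg x)) _) (hφ.nonneg _)

lemma vker_supp (hδ : Scale Ω δ) (hφ : Moll φ B) {x y : Eu n} (hx : x ∈ Ω)
    (h : vker δ φ x y ≠ 0) : ‖x - y‖ < δ x := by
  have := hφ.supp _ (right_ne_zero_of_mul h)
  rwa [norm_smul_inv (hδ.pos x hx), div_lt_one (hδ.pos x hx)] at this

lemma vker_le (hδ : Scale Ω δ) (hφ : Moll φ B) (x y : Eu n) :
    vker δ φ x y ≤ B * ((δ x)⁻¹) ^ n := by
  unfold vker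
  rw [mul_comm B]
  exact mul_le_mul_of_nonneg_left (hφ.bd _) (pow_nonneg (inv_nonneg.2 (hδ.nonneg x)) _)

lemma continuous_ker_right (hφ : Moll φ B) (x : Eu n) : Continuous (vker δ φ x) := by
  have := hφ.c1.continuous
  unfold vker
  fun_prop

lemma measurable_ker (hδ : Scale Ω δ) (hφ : Moll φ B) :
    Measurable (Function.uncurry (vker δ φ)) := by
  have h1 := hφ.c1.continuous.measurable
  have h2 := hδ.c1.continuous.measurable
  unfold vker Function.uncurry
  fun_prop

lemma vker_hasCompactSupport (hδ : Scale Ω δ) (hφ : Moll φ B) {x : Eu n} (hx : x ∈ Ω) :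
    HasCompactSupport (vker δ φ x) := by
  refine HasCompactSupport.intro (isCompact_closedBall x (δ x)) fun y hy => ?_
  by_contra hh
  apply hy
  rw [Metric.mem_closedBall, dist_comm, dist_eq_norm]
  exact (vker_supp hδ hφ hx hh).le

lemma integral_ker (hδ : Scale Ω δ) (hφ : Moll φ B) {x : Eu n} (hx : x ∈ Ω) :
    ∫ y, vker δ φ x y = 1 := by
  unfold vker
  rw [integral_const_mul, integral_sub_left_eq_self (fun y => φ ((δ x)⁻¹ • y)) volume x,
    Measure.integral_comp_inv_smul, hφ.int]
  have := hδ.pos x hx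
  simp only [finrank_euclideanSpace, Fintype.card_fin, smul_eq_mul, mul_one]
  rw [abs_of_pos (by positivity), ← mul_pow, inv_mul_cancel₀ this.ne', one_pow]

lemma lintegral_ker (hδ : Scale Ω δ) (hφ : Moll φ B) {x : Eu n} (hx : x ∈ Ω) :
    ∫⁻ y, ENNReal.ofReal (vker δ φ x y) = 1 := by
  rw [← ofReal_integral_eq_lintegral_ofReal, integral_ker hδ hφ hx, ENNReal.ofReal_one]
  · exact (continuous_ker_right hφ x).integrable_of_hasCompactSupport
      (vker_hasCompactSupport hδ hφ hx)
  · exact Eventually.of_forall fun y => vker_nonneg hδ hφ x y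

/-- The uniform constant for integration of the kernel in the first variable. -/
def kerC (n : ℕ) (B : ℝ) : ℝ≥0∞ := ENNReal.ofReal (B * 3 ^ n) * volume (Metric.ball (0 : Eu n) 1)

lemma kerC_lt_top (n : ℕ) (B : ℝ) : kerC n B < ⊤ :=
  ENNReal.mul_lt_top ENNReal.ofReal_lt_top measure_ball_lt_top

lemma lintegral_ker_left (hΩ : MeasurableSet Ω) (hδ : Scale Ω δ) (hφ : Moll φ B) (y : Eu n) :
    ∫⁻ x in Ω, ENNReal.ofReal (vker δ φ x y) ≤ kerC n B := by
  by_cases hy : y ∈ Ω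
  · have hy0 := hδ.pos y hy
    have hB := hφ.B_nonneg
    calc ∫⁻ x in Ω, ENNReal.ofReal (vker δ φ x y)
        ≤ ∫⁻ x in Ω, (Metric.closedBall y (2 * δ y)).indicator
            (fun _ => ENNReal.ofReal (B * (3 / 2 * (δ y)⁻¹) ^ n)) x := by
          refine setLIntegral_mono' hΩ fun x hx => ?_
          by_cases h0 : vker δ φ x y = 0
          · simp [h0]
          have hs := (vker_supp hδ hφ hx h0).le
          have h1 := hδ.half_le hs
          have h2 := hδ.le_of hs
          have hx0 := hδ.pos x hx
          rw [indicator_of_mem (by rw [Metric.mem_closedBall, dist_eq_norm]; linarith)]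
          refine ENNReal.ofReal_le_ofReal ((vker_le hδ hφ x y).trans ?_)
          gcongr
          rw [inv_le_iff_one_le_mul₀ hx0]
          field_simp
          linarith
      _ ≤ ∫⁻ x, (Metric.closedBall y (2 * δ y)).indicator
            (fun _ => ENNReal.ofReal (B * (3 / 2 * (δ y)⁻¹) ^ n)) x := setLIntegral_le_lintegral _ _
      _ = kerC n B := by
          rw [lintegral_indicator_const Metric.isClosed_closedBall.measurableSet,
            Measure.addHaar_closedBall _ _ (by positivity), ← mul_assoc,
            ← ENNReal.ofReal_mul (by positivity), kerC]
          congr 2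
          simp only [finrank_euclideanSpace, Fintype.card_fin]
          rw [mul_assoc, ← mul_pow]
          congr 2
          field_simp
  · have : ∫⁻ x in Ω, ENNReal.ofReal (vker δ φ x y) = ∫⁻ x in Ω, 0 := by
      refine setLIntegral_congr_fun hΩ fun x hx => ?_
      by_cases h0 : vker δ φ x y = 0
      · simp [h0]
      exact absurd (hδ.ball_subset hx (by
        rw [Metric.mem_closedBall, dist_comm, dist_eq_norm]
        exact (vker_supp hδ hφ hx h0).le)) hy
    rw [this]; simp

end

section
variable {n : ℕ} {Ω : Set (Eu n)} {δ φ : Eu n → ℝ} {B : ℝ}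

/-- The rescaled variable. -/
def zz (δ : Eu n → ℝ) (x y : Eu n) : Eu n := (δ x)⁻¹ • (x - y)

/-- Derivative of the kernel in the first variable. -/
def kDL (δ φ : Eu n → ℝ) (x y : Eu n) : Eu n →L[ℝ] ℝ :=
  ((δ x)⁻¹) ^ (n + 1) • (fderiv ℝ φ (zz δ x y) -
    (fderiv ℝ φ (zz δ x y) (zz δ x y) + n * φ (zz δ x y)) • fderiv ℝ δ x)

/-- The direction field. -/
def wdir (δ : Eu n → ℝ) (x e y : Eu n) : Eu n := e - (fderiv ℝ δ x e) • zz δ x y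

/-- The vector field whose divergence gives the derivative of the kernel. -/
def Fld (δ φ : Eu n → ℝ) (x e y : Eu n) : Eu n := vker δ φ x y • wdir δ x e y

/-- Its derivative. -/
def FldD (δ φ : Eu n → ℝ) (x e y : Eu n) : Eu n →L[ℝ] Eu n :=
  ((δ x)⁻¹) ^ (n + 1) • ((φ (zz δ x y) * fderiv ℝ δ x e) • ContinuousLinearMap.id ℝ (Eu n) -
    ContinuousLinearMap.smulRightL ℝ (Eu n) (Eu n) (fderiv ℝ φ (zz δ x y)) (wdir δ x e y))

lemma hasFDerivAt_vker (hδ : Scale Ω δ) (hφ : Moll φ B) {x : Eu n} (hx : x ∈ Ω) (y : Eu n) :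
    HasFDerivAt (fun x => vker δ φ x y) (kDL δ φ x y) x := by
  have h0 := hδ.pos x hx
  have d1 : HasFDerivAt δ (fderiv ℝ δ x) x := (hδ.c1.differentiable one_ne_zero x).hasFDerivAt
  have d2 : HasFDerivAt (fun x => (δ x)⁻¹) ((-((δ x) ^ 2)⁻¹) • fderiv ℝ δ x) x :=
    (hasDerivAt_inv h0.ne').comp_hasFDerivAt x d1
  have d3 : HasFDerivAt (fun x => ((δ x)⁻¹) ^ n)
      (((n : ℝ) * ((δ x)⁻¹) ^ (n - 1)) • ((-((δ x) ^ 2)⁻¹) • fderiv ℝ δ x)) x :=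
    (hasDerivAt_pow n ((δ x)⁻¹)).comp_hasFDerivAt x d2
  have d4 : HasFDerivAt (fun x => (δ x)⁻¹ • (x - y)) _ x :=
    d2.smul ((hasFDerivAt_id x).sub_const y)
  have d5 : HasFDerivAt (fun x => φ ((δ x)⁻¹ • (x - y))) _ x :=
    ((hφ.c1.differentiable one_ne_zero ((δ x)⁻¹ • (x - y))).hasFDerivAt).comp x d4
  have d6 := d3.mul d5
  refine d6.congr_fderiv ?_
  ext e
  simp only [kDL, zz, ContinuousLinearMap.add_apply, ContinuousLinearMap.smul_apply,
    ContinuousLinearMap.sub_apply, ContinuousLinearMap.comp_apply, smul_eq_mul,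
    ContinuousLinearMap.smulRight_apply, map_add, map_smul, ContinuousLinearMap.coe_id', id_eq,
    ContinuousLinearMap.id_apply]
  simp only [← inv_pow]
  generalize (δ x)⁻¹ = s
  rcases n with _ | k
  · simp; ring
  · simp only [Nat.add_sub_cancel]
    push_cast
    ring

lemma hasFDerivAt_Fld (hφ : Moll φ B) (x e y : Eu n) :
    HasFDerivAt (Fld δ φ x e) (FldD δ φ x e y) y := by
  have d4 : HasFDerivAt (fun y => zz δ x y) ((δ x)⁻¹ • (-ContinuousLinearMap.id ℝ (Eu n))) y :=
    ((hasFDerivAt_id y).const_sub x).const_smul (δ x)⁻¹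
  have d5 : HasFDerivAt (fun y => φ (zz δ x y)) _ y :=
    ((hφ.c1.differentiable one_ne_zero (zz δ x y)).hasFDerivAt).comp y d4
  have d6 : HasFDerivAt (fun y => vker δ φ x y) _ y := d5.const_mul (((δ x)⁻¹) ^ n)
  have d7 : HasFDerivAt (fun y => wdir δ x e y) _ y := (d4.const_smul (fderiv ℝ δ x e)).const_sub e
  have d8 := d6.smul d7
  refine d8.congr_fderiv ?_
  ext1 h
  simp only [FldD, ContinuousLinearMap.add_apply, ContinuousLinearMap.smul_apply,
    ContinuousLinearMap.sub_apply, ContinuousLinearMap.comp_apply, smul_eq_mul,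
    ContinuousLinearMap.smulRight_apply, map_add, map_smul, ContinuousLinearMap.coe_id', id_eq,
    ContinuousLinearMap.id_apply, ContinuousLinearMap.neg_apply, map_neg, vker,
    ContinuousLinearMap.smulRightL_apply_apply]
  simp only [zz]
  module

lemma clm_eq_sum (L : Eu n →L[ℝ] ℝ) (w : Eu n) :
    ∑ i, L (EuclideanSpace.single i 1) * w i = L w := by
  have h := (EuclideanSpace.basisFun (Fin n) ℝ).sum_repr w
  conv_rhs => rw [← h]
  simp [map_sum, mul_comm]

lemma divg_Fld (hφ : Moll φ B) (x e y : Eu n) :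
    divg (Fld δ φ x e) y = - kDL δ φ x y e := by
  unfold divg
  rw [(hasFDerivAt_Fld hφ x e y).fderiv]
  have h1 := clm_eq_sum (fderiv ℝ φ (zz δ x y)) (wdir δ x e y)
  simp only [FldD, ContinuousLinearMap.smul_apply, ContinuousLinearMap.sub_apply, PiLp.smul_apply,
    PiLp.sub_apply, ContinuousLinearMap.smulRightL_apply_apply, ContinuousLinearMap.id_apply,
    ContinuousLinearMap.smulRight_apply, smul_eq_mul]
  rw [← Finset.mul_sum, Finset.sum_sub_distrib, h1]
  simp only [EuclideanSpace.single_apply, if_true, mul_one, Finset.sum_const, Finset.card_univ,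
    Fintype.card_fin, kDL, wdir, ContinuousLinearMap.smul_apply, ContinuousLinearMap.sub_apply,
    map_sub, map_smul, smul_eq_mul, nsmul_eq_mul]
  ring

lemma fderiv_apply_wdir_le (hδ : Scale Ω δ) (hφ : Moll φ B) (x e y h : Eu n) :
    |fderiv ℝ φ (zz δ x y) h| * ‖wdir δ x e y‖ ≤ B * ‖h‖ * (3 / 2 * ‖e‖) := by
  by_cases hz : fderiv ℝ φ (zz δ x y) = 0
  · rw [hz]; simp
    have := hφ.B_nonneg; positivity
  have h1 := hφ.fderiv_supp hz
  have h2 : |fderiv ℝ φ (zz δ x y) h| ≤ B * ‖h‖ :=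
    ((fderiv ℝ φ (zz δ x y)).le_opNorm h).trans (by gcongr; exact hφ.dbd _)
  have h3 : |fderiv ℝ δ x e| ≤ 1/2 * ‖e‖ :=
    ((fderiv ℝ δ x).le_opNorm e).trans (by gcongr; exact hδ.dbd _)
  have h4 : ‖wdir δ x e y‖ ≤ 3 / 2 * ‖e‖ := by
    refine (norm_sub_le _ _).trans ?_
    rw [norm_smul, Real.norm_eq_abs]
    nlinarith [norm_nonneg (zz δ x y), abs_nonneg (fderiv ℝ δ x e)]
  have := hφ.B_nonneg
  gcongr

lemma norm_Fld_le (hδ : Scale Ω δ) (hφ : Moll φ B) {x : Eu n} (hx : x ∈ Ω) (e y : Eu n) :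
    ‖Fld δ φ x e y‖ ≤ 3 / 2 * ‖e‖ * vker δ φ x y := by
  by_cases h0 : vker δ φ x y = 0
  · simp [Fld, h0]
  have h1 : ‖zz δ x y‖ < 1 := hφ.supp _ (right_ne_zero_of_mul h0)
  have h3 : |fderiv ℝ δ x e| ≤ 1/2 * ‖e‖ :=
    ((fderiv ℝ δ x).le_opNorm e).trans (by gcongr; exact hδ.dbd _)
  have h4 : ‖wdir δ x e y‖ ≤ 3 / 2 * ‖e‖ := by
    refine (norm_sub_le _ _).trans ?_
    rw [norm_smul, Real.norm_eq_abs]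
    nlinarith [norm_nonneg (zz δ x y), abs_nonneg (fderiv ℝ δ x e)]
  rw [Fld, norm_smul, Real.norm_eq_abs, abs_of_nonneg (vker_nonneg hδ hφ x y), mul_comm]
  gcongr
  exact vker_nonneg hδ hφ x y

lemma norm_kDL_le (hδ : Scale Ω δ) (hφ : Moll φ B) (x y : Eu n) :
    ‖kDL δ φ x y‖ ≤ ((δ x)⁻¹) ^ (n + 1) * (B * (3 / 2 + n / 2)) := by
  have hs : 0 ≤ (δ x)⁻¹ := inv_nonneg.2 (hδ.nonneg x)
  have hB := hφ.B_nonneg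
  unfold kDL
  rw [norm_smul, norm_pow, Real.norm_eq_abs, abs_of_nonneg hs]
  gcongr
  refine (norm_sub_le _ _).trans ?_
  rw [norm_smul, Real.norm_eq_abs]
  have h1 : |fderiv ℝ φ (zz δ x y) (zz δ x y)| ≤ B := by
    by_cases hz : fderiv ℝ φ (zz δ x y) = 0
    · rw [hz]; simpa using hB
    refine ((fderiv ℝ φ (zz δ x y)).le_opNorm _).trans ?_
    have := hφ.fderiv_supp hz
    have := hφ.dbd (zz δ x y)
    nlinarith [norm_nonneg (zz δ x y), norm_nonneg (fderiv ℝ φ (zz δ x y))]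
  have h2 : |(n:ℝ) * φ (zz δ x y)| ≤ n * B := by
    rw [abs_of_nonneg (mul_nonneg (Nat.cast_nonneg n) (hφ.nonneg _))]
    gcongr; exact hφ.bd _
  have h3 := abs_add_le (fderiv ℝ φ (zz δ x y) (zz δ x y)) ((n:ℝ) * φ (zz δ x y))
  have h5 : |fderiv ℝ φ (zz δ x y) (zz δ x y) + (n:ℝ) * φ (zz δ x y)| * ‖fderiv ℝ δ x‖ ≤
      (B + n * B) * (1/2) := by
    gcongr
    · linarith
    · exact hδ.dbd x
  have := hφ.dbd (zz δ x y)
  linarith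

lemma norm_FldD_le (hδ : Scale Ω δ) (hφ : Moll φ B) (x e y : Eu n) :
    ‖FldD δ φ x e y‖ ≤ ((δ x)⁻¹) ^ (n + 1) * (2 * B * ‖e‖) := by
  have hs : 0 ≤ (δ x)⁻¹ := inv_nonneg.2 (hδ.nonneg x)
  have hB := hφ.B_nonneg
  unfold FldD
  rw [norm_smul, norm_pow, Real.norm_eq_abs, abs_of_nonneg hs]
  gcongr
  refine ContinuousLinearMap.opNorm_le_bound _ (by positivity) fun h => ?_
  have h3 : |fderiv ℝ δ x e| ≤ 1/2 * ‖e‖ :=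
    ((fderiv ℝ δ x).le_opNorm e).trans (by gcongr; exact hδ.dbd _)
  have h1 := fderiv_apply_wdir_le hδ hφ x e y h
  simp only [ContinuousLinearMap.smul_apply, ContinuousLinearMap.sub_apply,
    ContinuousLinearMap.smulRightL_apply_apply, ContinuousLinearMap.id_apply,
    ContinuousLinearMap.smulRight_apply]
  refine (norm_sub_le _ _).trans ?_
  rw [norm_smul, norm_smul, Real.norm_eq_abs, Real.norm_eq_abs, abs_mul,
    abs_of_nonneg (hφ.nonneg _)]
  have h6 : φ (zz δ x y) * |fderiv ℝ δ x e| * ‖h‖ ≤ B * (1/2 * ‖e‖) * ‖h‖ := by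
    gcongr
    exact hφ.bd _
  nlinarith

end

section
variable {n : ℕ} {Ω : Set (Eu n)} {δ φ : Eu n → ℝ} {B : ℝ} {u : Eu n → ℝ}

/-- The variable scale mollification. -/
def Sm (Ω : Set (Eu n)) (δ φ u : Eu n → ℝ) (x : Eu n) : ℝ := ∫ y in Ω, vker δ φ x y * u y

lemma continuous_zz (x : Eu n) : Continuous (zz δ x) := by
  unfold zz; fun_prop

lemma continuous_kDL (hφ : Moll φ B) (x : Eu n) : Continuous (kDL δ φ x) := by
  have h1 := (hφ.c1.continuous_fderiv one_ne_zero).comp (continuous_zz (δ := δ) x)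
  have h2 := hφ.c1.continuous.comp (continuous_zz (δ := δ) x)
  have h3 := continuous_zz (δ := δ) x
  simp only [Function.comp_def] at h1 h2
  have h5 := h1.clm_apply h3
  have h6 : Continuous fun y => fderiv ℝ φ (zz δ x y) (zz δ x y) + n * φ (zz δ x y) :=
    h5.add (continuous_const.mul h2)
  have h7 : Continuous fun y => (fderiv ℝ φ (zz δ x y) (zz δ x y) + n * φ (zz δ x y)) •
    fderiv ℝ δ x := h6.smul continuous_const
  exact (h1.sub h7).const_smul (((δ x)⁻¹) ^ (n + 1))

lemma continuous_FldD (hφ : Moll φ B) (x e : Eu n) : Continuous (FldD δ φ x e) := by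
  have h1 := (hφ.c1.continuous_fderiv one_ne_zero).comp (continuous_zz (δ := δ) x)
  have h2 := hφ.c1.continuous.comp (continuous_zz (δ := δ) x)
  have h3 := continuous_zz (δ := δ) x
  simp only [Function.comp_def] at h1 h2
  have h4 : Continuous (wdir δ x e) := by
    unfold wdir
    fun_prop
  have h5 : Continuous fun y => ContinuousLinearMap.smulRightL ℝ (Eu n) (Eu n)
      (fderiv ℝ φ (zz δ x y)) :=
    (ContinuousLinearMap.smulRightL ℝ (Eu n) (Eu n)).continuous.comp h1
  have h6 := h5.clm_apply h4
  have h7 : Continuous fun y => φ (zz δ x y) * fderiv ℝ δ x e := h2.mul continuous_const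
  have h8 : Continuous fun y => (φ (zz δ x y) * fderiv ℝ δ x e) •
    ContinuousLinearMap.id ℝ (Eu n) := h7.smul continuous_const
  exact (h8.sub h6).const_smul (((δ x)⁻¹) ^ (n + 1))

lemma contDiff_Fld (hφ : Moll φ B) (x e : Eu n) : ContDiff ℝ 1 (Fld δ φ x e) := by
  rw [contDiff_one_iff_hasFDerivAt]
  exact ⟨FldD δ φ x e, continuous_FldD hφ x e, hasFDerivAt_Fld hφ x e⟩

lemma tsupport_Fld (hδ : Scale Ω δ) (hφ : Moll φ B) {x : Eu n} (hx : x ∈ Ω) (e : Eu n) :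
    tsupport (Fld δ φ x e) ⊆ Metric.closedBall x (δ x) := by
  refine closure_minimal (fun y hy => ?_) Metric.isClosed_closedBall
  have h : vker δ φ x y ≠ 0 := by
    intro h
    apply hy
    simp [Fld, h]
  have := vker_supp hδ hφ hx h
  rw [Metric.mem_closedBall, dist_comm, dist_eq_norm]
  exact this.le

lemma hasCompactSupport_Fld (hδ : Scale Ω δ) (hφ : Moll φ B) {x : Eu n} (hx : x ∈ Ω) (e : Eu n) :
    HasCompactSupport (Fld δ φ x e) :=
  (isCompact_closedBall _ _).of_isClosed_subset (isClosed_tsupport _) (tsupport_Fld hδ hφ hx e)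

lemma integrable_smul_kDL (hδ : Scale Ω δ) (hφ : Moll φ B) (hu : IntegrableOn u Ω) (x : Eu n) :
    IntegrableOn (fun y => u y • kDL δ φ x y) Ω := by
  refine Integrable.mono' (hu.norm.mul_const (((δ x)⁻¹) ^ (n + 1) * (B * (3 / 2 + n / 2)))) ?_ ?_
  · exact hu.aestronglyMeasurable.smul (continuous_kDL hφ x).aestronglyMeasurable
  · refine Eventually.of_forall fun y => ?_
    rw [norm_smul]
    gcongr
    exact norm_kDL_le hδ hφ x y

lemma hasFDerivAt_Sm (hδ : Scale Ω δ) (hφ : Moll φ B) (hu : IntegrableOn u Ω) {x : Eu n}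
    (hx : x ∈ Ω) : HasFDerivAt (Sm Ω δ φ u) (∫ y in Ω, u y • kDL δ φ x y) x := by
  have h0 := hδ.pos x hx
  set C := (2 * (δ x)⁻¹) ^ (n + 1) * (B * (3 / 2 + n / 2)) with hC
  have hs : {z | δ x / 2 < δ z} ∈ 𝓝 x :=
    (isOpen_lt continuous_const hδ.c1.continuous).mem_nhds (by simp; linarith)
  unfold Sm
  refine hasFDerivAt_integral_of_dominated_of_fderiv_le
    (F := fun x y => vker δ φ x y * u y) (F' := fun x y => u y • kDL δ φ x y)
    (bound := fun y => ‖u y‖ * C) hs ?_ ?_ ?_ ?_ ?_ ?_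
  · exact Eventually.of_forall fun z =>
      (continuous_ker_right hφ z).aestronglyMeasurable.mul hu.aestronglyMeasurable
  · have := integrableOn_mul_test hu (continuous_ker_right (δ := δ) hφ x)
      (vker_hasCompactSupport hδ hφ hx)
    simpa only [mul_comm, IntegrableOn] using this
  · exact (integrable_smul_kDL hδ hφ hu x).aestronglyMeasurable
  · refine Eventually.of_forall fun y z hz => ?_
    rw [norm_smul]
    gcongr
    refine (norm_kDL_le hδ hφ z y).trans ?_
    have hz' : δ x / 2 < δ z := hz
    have h1 : (δ z)⁻¹ ≤ 2 * (δ x)⁻¹ := by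
      rw [show 2 * (δ x)⁻¹ = (δ x / 2)⁻¹ by field_simp]
      gcongr
    have := hφ.B_nonneg
    have h2 : 0 ≤ (δ z)⁻¹ := inv_nonneg.2 (hδ.nonneg z)
    rw [hC]
    gcongr
  · exact hu.norm.mul_const C
  · refine Eventually.of_forall fun y z hz => ?_
    have hz' : δ x / 2 < δ z := hz
    exact (hasFDerivAt_vker hδ hφ (hδ.mem_of_pos (by linarith)) y).mul_const (u y)

lemma fderiv_Sm_apply (hδ : Scale Ω δ) (hφ : Moll φ B) (hu : IntegrableOn u Ω) {x : Eu n}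
    (hx : x ∈ Ω) (e : Eu n) :
    fderiv ℝ (Sm Ω δ φ u) x e = - ∫ y in Ω, u y * divg (Fld δ φ x e) y := by
  rw [(hasFDerivAt_Sm hδ hφ hu hx).fderiv, ContinuousLinearMap.integral_apply
    (integrable_smul_kDL hδ hφ hu x), ← integral_neg]
  congr 1
  ext y
  rw [divg_Fld hφ]
  simp

lemma norm_fderiv_Sm_le (hδ : Scale Ω δ) (hφ : Moll φ B) (hu : IntegrableOn u Ω) {x : Eu n}
    (hx : x ∈ Ω) : ‖fderiv ℝ (Sm Ω δ φ u) x‖ ≤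
      ((δ x)⁻¹) ^ (n + 1) * (B * (3 / 2 + n / 2)) * ∫ y in Ω, ‖u y‖ := by
  rw [(hasFDerivAt_Sm hδ hφ hu hx).fderiv, mul_comm, ← integral_mul_const]
  refine norm_integral_le_of_norm_le (hu.norm.mul_const _) (Eventually.of_forall fun y => ?_)
  rw [norm_smul]
  gcongr
  exact norm_kDL_le hδ hφ x y

lemma locLip_Sm (hδ : Scale Ω δ) (hφ : Moll φ B) (hu : IntegrableOn u Ω) :
    LocLipOn Ω (Ω.indicator (Sm Ω δ φ u)) := by
  intro x hx
  have h0 := hδ.pos x hx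
  set C := (2 * (δ x)⁻¹) ^ (n + 1) * (B * (3 / 2 + n / 2)) * ∫ y in Ω, ‖u y‖ with hC
  have hintg : 0 ≤ ∫ y in Ω, ‖u y‖ := integral_nonneg fun y => norm_nonneg _
  have hB := hφ.B_nonneg
  have hC0 : 0 ≤ C := by rw [hC]; positivity
  have hsub := hδ.ball_subset hx
  refine ⟨C.toNNReal, Metric.closedBall x (δ x),
    mem_nhdsWithin_of_mem_nhds (Metric.closedBall_mem_nhds x h0), ?_⟩
  have : LipschitzOnWith C.toNNReal (Sm Ω δ φ u) (Metric.closedBall x (δ x)) := by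
    refine Convex.lipschitzOnWith_of_nnnorm_hasFDerivWithin_le (𝕜 := ℝ)
      (f' := fun z => fderiv ℝ (Sm Ω δ φ u) z) ?_ ?_ (convex_closedBall _ _)
    · intro z hz
      exact ((hasFDerivAt_Sm hδ hφ hu (hsub hz)).differentiableAt.hasFDerivAt).hasFDerivWithinAt
    · intro z hz
      rw [← NNReal.coe_le_coe]
      refine (norm_fderiv_Sm_le hδ hφ hu (hsub hz)).trans ?_
      rw [Real.coe_toNNReal C hC0]
      rw [Metric.mem_closedBall, dist_comm, dist_eq_norm] at hz
      have h1 : (δ z)⁻¹ ≤ 2 * (δ x)⁻¹ := by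
        rw [show 2 * (δ x)⁻¹ = (δ x / 2)⁻¹ by field_simp]
        have := hδ.half_le hz
        gcongr
      have h2 : 0 ≤ (δ z)⁻¹ := inv_nonneg.2 (hδ.nonneg z)
      rw [hC]
      gcongr
  intro a ha b hb
  rw [indicator_of_mem (hsub ha), indicator_of_mem (hsub hb)]
  exact this ha hb

lemma opNorm_le_of_forall {L : Eu n →L[ℝ] ℝ} {C : ℝ} (hC : 0 ≤ C)
    (h : ∀ e, e ≠ 0 → -(L e) ≤ C * ‖e‖) : ‖L‖ ≤ C := by
  refine L.opNorm_le_bound hC fun e => ?_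
  by_cases he : e = 0
  · simp [he]
  rw [Real.norm_eq_abs, abs_le]
  constructor
  · linarith [h e he]
  · have := h (-e) (neg_ne_zero.2 he)
    simpa using this

/-- Estimate (a). -/
lemma fderiv_Sm_le_tv (hδ : Scale Ω δ) (hφ : Moll φ B) (hu : IntegrableOn u Ω)
    (hT : totVarOpen Ω u < ⊤) {x : Eu n} (hx : x ∈ Ω) :
    ‖fderiv ℝ (Sm Ω δ φ u) x‖ ≤ 3 / 2 * ((B + 1) * ((δ x)⁻¹) ^ n) * (totVarOpen Ω u).toReal := by
  have h0 := hδ.pos x hx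
  have hB := hφ.B_nonneg
  refine opNorm_le_of_forall (by positivity) fun e he => ?_
  rw [fderiv_Sm_apply hδ hφ hu hx, neg_neg]
  have he' : 0 < ‖e‖ := norm_pos_iff.2 he
  have := le_totVarOpen_mul hT (contDiff_Fld hφ x e) (hasCompactSupport_Fld hδ hφ hx e)
    ((tsupport_Fld hδ hφ hx e).trans (hδ.ball_subset hx))
    (b := 3 / 2 * ‖e‖ * ((B + 1) * ((δ x)⁻¹) ^ n)) (by positivity) (fun y => by
      refine (norm_Fld_le hδ hφ hx e y).trans ?_
      gcongr
      refine (vker_le hδ hφ x y).trans ?_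
      gcongr
      linarith)
  refine this.trans (le_of_eq ?_)
  ring

/-- Estimate (c). -/
lemma fderiv_Sm_le_grad (hΩm : MeasurableSet Ω) (hδ : Scale Ω δ) (hφ : Moll φ B)
    (hu : IntegrableOn u Ω)
    {S : Set (Eu n)} (hSΩ : S ⊆ Ω) {g : Eu n → Eu n} (hg : IntegrableOn g S)
    (hw : IsWeakGrad S u g) {x : Eu n} (hx : x ∈ Ω) (hxS : Metric.closedBall x (δ x) ⊆ S) :
    ENNReal.ofReal ‖fderiv ℝ (Sm Ω δ φ u) x‖ ≤
      ENNReal.ofReal (3 / 2) * ∫⁻ y in S, ENNReal.ofReal (vker δ φ x y) * ENNReal.ofReal ‖g y‖ := by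
  have hts := fun e => (tsupport_Fld hδ hφ hx e).trans hxS
  have hi : IntegrableOn (fun y => ‖g y‖ * vker δ φ x y) S :=
    integrableOn_mul_test hg.norm (continuous_ker_right hφ x) (vker_hasCompactSupport hδ hφ hx)
  have hnn : ∀ y, 0 ≤ ‖g y‖ * vker δ φ x y := fun y =>
    mul_nonneg (norm_nonneg _) (vker_nonneg hδ hφ x y)
  have key : ‖fderiv ℝ (Sm Ω δ φ u) x‖ ≤ 3 / 2 * ∫ y in S, ‖g y‖ * vker δ φ x y := by
    refine opNorm_le_of_forall (mul_nonneg (by norm_num) (integral_nonneg hnn)) fun e he => ?_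
    rw [fderiv_Sm_apply hδ hφ hu hx, neg_neg,
      setIntegral_eq_of_support hΩm hSΩ (fun y hy => by
        rw [divg_eq_zero (fun h => hy (hts e h)), mul_zero]),
      weakGrad_div (hu.mono_set hSΩ) hg hw (contDiff_Fld hφ x e) (hasCompactSupport_Fld hδ hφ hx e)
        (hts e), ← integral_neg, mul_assoc, mul_comm _ ‖e‖, ← mul_assoc, ← integral_const_mul]
    refine (le_abs_self _).trans ?_
    refine norm_integral_le_of_norm_le (f := fun y => -inner ℝ (g y) (Fld δ φ x e y))
      (hi.const_mul _) (Eventually.of_forall fun y => ?_)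
    rw [norm_neg]
    refine (norm_inner_le_norm _ _).trans ?_
    calc ‖g y‖ * ‖Fld δ φ x e y‖ ≤ ‖g y‖ * (3 / 2 * ‖e‖ * vker δ φ x y) := by
          gcongr; exact norm_Fld_le hδ hφ hx e y
      _ = _ := by ring
  refine (ENNReal.ofReal_le_ofReal key).trans ?_
  rw [ENNReal.ofReal_mul (by norm_num), ofReal_integral_eq_lintegral_ofReal hi
    (Eventually.of_forall hnn)]
  gcongr with y
  rw [ENNReal.ofReal_mul (norm_nonneg _), mul_comm]

lemma measurable_Sm (hΩm : MeasurableSet Ω) (hδ : Scale Ω δ) (hφ : Moll φ B) (hum : Measurable u) :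
    Measurable (Ω.indicator (Sm Ω δ φ u)) := by
  refine Measurable.indicator ?_ hΩm
  refine StronglyMeasurable.measurable ?_
  unfold Sm
  exact StronglyMeasurable.integral_prod_right
    (f := fun x y => vker δ φ x y * u y)
    ((measurable_ker hδ hφ).mul (hum.comp measurable_snd)).stronglyMeasurable

lemma fderiv_ind_Sm (hΩ : IsOpen Ω) {x : Eu n} (hx : x ∈ Ω) :
    fderiv ℝ (Ω.indicator (Sm Ω δ φ u)) x = fderiv ℝ (Sm Ω δ φ u) x := by
  apply Filter.EventuallyEq.fderiv_eq
  filter_upwards [hΩ.mem_nhds hx] with y hy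
  rw [indicator_of_mem hy]

end

section
variable {n : ℕ} {Ω : Set (Eu n)} {δ φ : Eu n → ℝ} {B : ℝ} {u : Eu n → ℝ}

/-- The trace functional. -/
def trL (n : ℕ) : (Eu n →L[ℝ] Eu n) →L[ℝ] ℝ :=
  ∑ i, (EuclideanSpace.proj i : Eu n →L[ℝ] ℝ).comp
    (ContinuousLinearMap.apply ℝ (Eu n) (EuclideanSpace.single i (1 : ℝ)))

lemma trL_apply (D : Eu n →L[ℝ] Eu n) :
    trL n D = ∑ i, D (EuclideanSpace.single i 1) i := by
  simp [trL]

lemma divg_eq_trL (F : Eu n → Eu n) (x : Eu n) : divg F x = trL n (fderiv ℝ F x) := by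
  rw [trL_apply]; rfl

lemma measurable_zz (hδ : Scale Ω δ) : Measurable (fun q : Eu n × Eu n => zz δ q.1 q.2) := by
  unfold zz
  exact ((hδ.c1.continuous.measurable.comp measurable_fst).inv).smul
    (measurable_fst.sub measurable_snd)

lemma measurable_wdir (hδ : Scale Ω δ) {e : Eu n → Eu n} (he : Measurable e) :
    Measurable (fun q : Eu n × Eu n => wdir δ q.1 (e q.1) q.2) := by
  have h1 : Measurable fun x => fderiv ℝ δ x (e x) := by
    have hc := (hδ.c1.continuous_fderiv one_ne_zero).measurable
    have : Continuous fun q : (Eu n →L[ℝ] ℝ) × Eu n => q.1 q.2 := by fun_prop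
    exact this.measurable.comp (hc.prodMk he)
  unfold wdir
  exact (he.comp measurable_fst).sub ((h1.comp measurable_fst).smul (measurable_zz hδ))

lemma measurable_Fld (hδ : Scale Ω δ) (hφ : Moll φ B) {e : Eu n → Eu n} (he : Measurable e) :
    Measurable (fun q : Eu n × Eu n => Fld δ φ q.1 (e q.1) q.2) := by
  unfold Fld
  exact (measurable_ker hδ hφ).smul (measurable_wdir hδ he)

lemma measurable_FldD (hδ : Scale Ω δ) (hφ : Moll φ B) {e : Eu n → Eu n} (he : Measurable e) :
    Measurable (fun q : Eu n × Eu n => FldD δ φ q.1 (e q.1) q.2) := by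
  have h1 : Measurable fun x => fderiv ℝ δ x (e x) := by
    have hc := (hδ.c1.continuous_fderiv one_ne_zero).measurable
    have : Continuous fun q : (Eu n →L[ℝ] ℝ) × Eu n => q.1 q.2 := by fun_prop
    exact this.measurable.comp (hc.prodMk he)
  have h2 := (hφ.c1.continuous.measurable).comp (measurable_zz hδ)
  have h3 := ((hφ.c1.continuous_fderiv one_ne_zero).measurable).comp (measurable_zz hδ)
  have h4 : Continuous fun q : (Eu n →L[ℝ] ℝ) × Eu n =>
      ContinuousLinearMap.smulRightL ℝ (Eu n) (Eu n) q.1 q.2 := by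
    exact ((ContinuousLinearMap.smulRightL ℝ (Eu n) (Eu n)).continuous.comp
      continuous_fst).clm_apply continuous_snd
  have h5 := h4.measurable.comp (h3.prodMk (measurable_wdir hδ he))
  have h6 : Measurable fun q : Eu n × Eu n => ((δ q.1)⁻¹) ^ (n + 1) :=
    ((hδ.c1.continuous.measurable.comp measurable_fst).inv).pow_const _
  have h7 : Measurable fun q : Eu n × Eu n => (φ (zz δ q.1 q.2) * fderiv ℝ δ q.1 (e q.1)) •
      ContinuousLinearMap.id ℝ (Eu n) :=
    (h2.mul (h1.comp measurable_fst)).smul_const _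
  exact h6.smul (h7.sub h5)

/-- The averaged field. -/
def Psi (δ φ : Eu n → ℝ) (e : Eu n → Eu n) (A : Set (Eu n)) (y : Eu n) : Eu n :=
  ∫ x in A, Fld δ φ x (e x) y

lemma FldD_bound (hδ : Scale Ω δ) (hφ : Moll φ B) {e : Eu n → Eu n} (he1 : ∀ x, ‖e x‖ ≤ 1)
    {τ : ℝ} (hτ : 0 < τ) {x : Eu n} (hx : τ ≤ δ x) (y : Eu n) :
    ‖FldD δ φ x (e x) y‖ ≤ (τ⁻¹) ^ (n + 1) * (2 * B) := by
  refine (norm_FldD_le hδ hφ x (e x) y).trans ?_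
  have := hφ.B_nonneg
  have h0 : 0 < δ x := hτ.trans_le hx
  calc _ ≤ (τ⁻¹) ^ (n + 1) * (2 * B * 1) := by gcongr; exact he1 x
    _ = _ := by ring

lemma Psi_hasFDerivAt (hΩm : MeasurableSet Ω) (hv : volume Ω < ⊤)
    (hδ : Scale Ω δ) (hφ : Moll φ B) {e : Eu n → Eu n}
    (he : Measurable e) (he1 : ∀ x, ‖e x‖ ≤ 1) {τ : ℝ} (hτ : 0 < τ) (y : Eu n) :
    HasFDerivAt (Psi δ φ e {x | τ ≤ δ x}) (∫ x in {x | τ ≤ δ x}, FldD δ φ x (e x) y) y := by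
  have hAm : MeasurableSet {x | τ ≤ δ x} := measurableSet_le measurable_const hδ.c1.continuous.measurable
  have hAv : volume {x | τ ≤ δ x} < ⊤ :=
    (measure_mono fun x hx => hδ.mem_of_pos (hτ.trans_le hx)).trans_lt hv
  have : IsFiniteMeasure (volume.restrict {x | τ ≤ δ x}) := ⟨by simpa using hAv⟩
  have hB := hφ.B_nonneg
  have hmF : ∀ z, AEStronglyMeasurable (fun x => Fld δ φ x (e x) z) (volume.restrict {x | τ ≤ δ x}) :=
    fun z => ((measurable_Fld hδ hφ he).comp
      (measurable_id.prodMk measurable_const)).aestronglyMeasurable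
  unfold Psi
  refine hasFDerivAt_integral_of_dominated_of_fderiv_le
    (F := fun y x => Fld δ φ x (e x) y) (F' := fun y x => FldD δ φ x (e x) y)
    (bound := fun _ => (τ⁻¹) ^ (n + 1) * (2 * B)) (s := univ) univ_mem
    (Eventually.of_forall hmF) ?_ ?_ ?_ (integrable_const _) ?_
  · refine Integrable.mono' (integrable_const (3 / 2 * (B * (τ⁻¹) ^ n))) (hmF y) ?_
    refine (ae_restrict_iff' hAm).2 (Eventually.of_forall fun x hx => ?_)
    have hx' : τ ≤ δ x := hx
    have h0 : 0 < δ x := hτ.trans_le hx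
    refine (norm_Fld_le hδ hφ (hδ.mem_of_pos h0) _ _).trans ?_
    have h1 : vker δ φ x y ≤ B * (τ⁻¹) ^ n := (vker_le hδ hφ x y).trans (by gcongr)
    have h2 := he1 x
    calc _ ≤ 3 / 2 * 1 * (B * (τ⁻¹) ^ n) := by
          gcongr
          exact vker_nonneg hδ hφ x y
      _ = _ := by ring
  · exact ((measurable_FldD hδ hφ he).comp
      (measurable_id.prodMk measurable_const)).aestronglyMeasurable
  · exact (ae_restrict_iff' hAm).2 (Eventually.of_forall fun x hx z _ =>
      FldD_bound hδ hφ he1 hτ hx z)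
  · exact Eventually.of_forall fun x z _ => hasFDerivAt_Fld hφ x (e x) z

lemma Psi_contDiff (hΩm : MeasurableSet Ω) (hv : volume Ω < ⊤)
    (hδ : Scale Ω δ) (hφ : Moll φ B) {e : Eu n → Eu n}
    (he : Measurable e) (he1 : ∀ x, ‖e x‖ ≤ 1) {τ : ℝ} (hτ : 0 < τ) :
    ContDiff ℝ 1 (Psi δ φ e {x | τ ≤ δ x}) := by
  rw [contDiff_one_iff_hasFDerivAt]
  refine ⟨_, ?_, Psi_hasFDerivAt hΩm hv hδ hφ he he1 hτ⟩
  have hAm : MeasurableSet {x | τ ≤ δ x} := measurableSet_le measurable_const hδ.c1.continuous.measurable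
  have hAv : volume {x | τ ≤ δ x} < ⊤ :=
    (measure_mono fun x hx => hδ.mem_of_pos (hτ.trans_le hx)).trans_lt hv
  have : IsFiniteMeasure (volume.restrict {x | τ ≤ δ x}) := ⟨by simpa using hAv⟩
  refine continuous_of_dominated (bound := fun _ => (τ⁻¹) ^ (n + 1) * (2 * B)) ?_ ?_
    (integrable_const _) ?_
  · exact fun y => ((measurable_FldD hδ hφ he).comp
      (measurable_id.prodMk measurable_const)).aestronglyMeasurable
  · exact fun y => (ae_restrict_iff' hAm).2 (Eventually.of_forall fun x hx =>
      FldD_bound hδ hφ he1 hτ hx y)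
  · exact Eventually.of_forall fun x => continuous_FldD hφ x (e x)

lemma divg_Psi (hΩm : MeasurableSet Ω) (hv : volume Ω < ⊤)
    (hδ : Scale Ω δ) (hφ : Moll φ B) {e : Eu n → Eu n}
    (he : Measurable e) (he1 : ∀ x, ‖e x‖ ≤ 1) {τ : ℝ} (hτ : 0 < τ) (y : Eu n) :
    divg (Psi δ φ e {x | τ ≤ δ x}) y = ∫ x in {x | τ ≤ δ x}, divg (Fld δ φ x (e x)) y := by
  have hAm : MeasurableSet {x | τ ≤ δ x} := measurableSet_le measurable_const hδ.c1.continuous.measurable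
  have hAv : volume {x | τ ≤ δ x} < ⊤ :=
    (measure_mono fun x hx => hδ.mem_of_pos (hτ.trans_le hx)).trans_lt hv
  have : IsFiniteMeasure (volume.restrict {x | τ ≤ δ x}) := ⟨by simpa using hAv⟩
  rw [divg_eq_trL, (Psi_hasFDerivAt hΩm hv hδ hφ he he1 hτ y).fderiv]
  rw [← ContinuousLinearMap.integral_comp_comm]
  · congr 1
    ext x
    rw [divg_eq_trL, (hasFDerivAt_Fld hφ x (e x) y).fderiv]
  · refine Integrable.mono' (integrable_const ((τ⁻¹) ^ (n + 1) * (2 * B))) ?_ ?_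
    · exact ((measurable_FldD hδ hφ he).comp
        (measurable_id.prodMk measurable_const)).aestronglyMeasurable
    · exact (ae_restrict_iff' hAm).2 (Eventually.of_forall fun x hx =>
        FldD_bound hδ hφ he1 hτ hx y)

lemma Psi_support (hδ : Scale Ω δ) (hφ : Moll φ B) (e : Eu n → Eu n) {τ : ℝ} (hτ : 0 < τ) :
    tsupport (Psi δ φ e {x | τ ≤ δ x}) ⊆ {y | τ / 2 ≤ δ y} := by
  refine closure_minimal (fun y hy => ?_) (isClosed_le continuous_const hδ.c1.continuous)
  by_contra hlt
  apply hy
  have hlt' : δ y < τ / 2 := by simpa using hlt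
  have hAm : MeasurableSet {x | τ ≤ δ x} := measurableSet_le measurable_const hδ.c1.continuous.measurable
  refine setIntegral_eq_zero_of_forall_eq_zero fun x hx => ?_
  have hx' : τ ≤ δ x := hx
  by_contra hne
  have h : vker δ φ x y ≠ 0 := by
    intro h
    apply hne
    simp [Fld, h]
  have := hδ.half_le (vker_supp hδ hφ (hδ.mem_of_pos (hτ.trans_le hx')) h).le
  linarith

lemma Psi_norm_le (hΩm : MeasurableSet Ω) (hδ : Scale Ω δ) (hφ : Moll φ B) {e : Eu n → Eu n}
    (he1 : ∀ x, ‖e x‖ ≤ 1) {τ : ℝ} (hτ : 0 < τ) (y : Eu n) :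
    ‖Psi δ φ e {x | τ ≤ δ x} y‖ ≤ 3 / 2 * ((kerC n B).toReal + 1) := by
  have hAm : MeasurableSet {x | τ ≤ δ x} := measurableSet_le measurable_const hδ.c1.continuous.measurable
  have hsub : {x | τ ≤ δ x} ⊆ Ω := fun x hx => hδ.mem_of_pos (hτ.trans_le hx)
  have h1 : ∫⁻ x in {x | τ ≤ δ x}, ‖Fld δ φ x (e x) y‖ₑ ≤ ENNReal.ofReal (3 / 2) * kerC n B := by
    calc _ ≤ ∫⁻ x in {x | τ ≤ δ x}, ENNReal.ofReal (3 / 2) * ENNReal.ofReal (vker δ φ x y) := by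
          refine setLIntegral_mono' hAm fun x hx => ?_
          rw [← ENNReal.ofReal_mul (by norm_num), ← ofReal_norm]
          refine ENNReal.ofReal_le_ofReal ((norm_Fld_le hδ hφ (hsub hx) _ _).trans ?_)
          have h3 := vker_nonneg hδ hφ x y
          have h2 := he1 x
          nlinarith
      _ = ENNReal.ofReal (3 / 2) * ∫⁻ x in {x | τ ≤ δ x}, ENNReal.ofReal (vker δ φ x y) := by
          rw [lintegral_const_mul' _ _ ENNReal.ofReal_ne_top]
      _ ≤ _ := by
          gcongr
          exact (lintegral_mono_set hsub).trans (lintegral_ker_left hΩm hδ hφ y)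
  have h2 := (enorm_integral_le_lintegral_enorm (μ := volume.restrict {x | τ ≤ δ x})
    (fun x => Fld δ φ x (e x) y)).trans h1
  have hk : kerC n B ≠ ⊤ := (kerC_lt_top n B).ne
  have h3 := ENNReal.toReal_mono (ENNReal.mul_ne_top ENNReal.ofReal_ne_top hk) h2
  rw [toReal_enorm, ENNReal.toReal_mul, ENNReal.toReal_ofReal (by norm_num)] at h3
  unfold Psi
  linarith

/-- Estimate (b) on superlevel sets. -/
lemma Sm_grad_l1_aux (hΩ : IsOpen Ω) (hb : Bornology.IsBounded Ω) (hv : volume Ω < ⊤)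
    (hδ : Scale Ω δ) (hφ : Moll φ B)
    (hum : Measurable u) (hu : IntegrableOn u Ω) (hT : totVarOpen Ω u < ⊤) {τ : ℝ} (hτ : 0 < τ) :
    ∫⁻ x in {x | τ ≤ δ x}, ENNReal.ofReal ‖fderiv ℝ (Sm Ω δ φ u) x‖ ≤
      ENNReal.ofReal (3 / 2 * ((kerC n B).toReal + 1) * (totVarOpen Ω u).toReal) := by
  have hΩm := hΩ.measurableSet
  have hAm : MeasurableSet {x | τ ≤ δ x} := measurableSet_le measurable_const hδ.c1.continuous.measurable
  have hsub : {x | τ ≤ δ x} ⊆ Ω := fun x hx => hδ.mem_of_pos (hτ.trans_le hx)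
  have hAv : volume {x | τ ≤ δ x} < ⊤ := (measure_mono hsub).trans_lt hv
  have hfin : IsFiniteMeasure (volume.restrict {x | τ ≤ δ x}) := ⟨by simpa using hAv⟩
  have hB := hφ.B_nonneg
  set w := Sm Ω δ φ u with hw
  set G : Eu n → Eu n := fun x => gradient w x with hG
  have hGm : Measurable G := measurable_gradient w
  set e : Eu n → Eu n := fun x => (-(‖G x‖⁻¹)) • G x with he
  have hem : Measurable e := (hGm.norm.inv.neg).smul hGm
  have he1 : ∀ x, ‖e x‖ ≤ 1 := by
    intro x
    rw [he]
    simp only [norm_smul, norm_neg, norm_inv, norm_norm]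
    exact inv_mul_le_one
  have hDe : ∀ x, fderiv ℝ w x (e x) = - ‖fderiv ℝ w x‖ := by
    intro x
    have h1 : fderiv ℝ w x (G x) = ‖G x‖ ^ 2 := by
      have : fderiv ℝ w x = InnerProductSpace.toDual ℝ (Eu n) (G x) := by
        simp [hG, gradient]
      rw [this, InnerProductSpace.toDual_apply_apply, real_inner_self_eq_norm_sq]
    rw [he, map_smul, h1, ← norm_gradient_eq, smul_eq_mul]
    by_cases h0 : ‖G x‖ = 0
    · rw [h0]; simp
    · change _ = - ‖G x‖
      field_simp
  -- Fubini
  have hintg : Integrable (fun q : Eu n × Eu n => u q.2 * divg (Fld δ φ q.1 (e q.1)) q.2)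
      ((volume.restrict {x | τ ≤ δ x}).prod (volume.restrict Ω)) := by
    have h1 : Integrable (fun q : Eu n × Eu n => ((τ⁻¹) ^ (n + 1) * (B * (3 / 2 + n / 2))) * ‖u q.2‖)
      ((volume.restrict {x | τ ≤ δ x}).prod (volume.restrict Ω)) :=
      Integrable.mul_prod (f := fun _ : Eu n => (τ⁻¹) ^ (n + 1) * (B * (3 / 2 + n / 2)))
        (g := fun y => ‖u y‖) (integrable_const _) hu.norm
    refine Integrable.mono' h1 ?_ ?_
    · refine Measurable.aestronglyMeasurable ?_
      have : (fun q : Eu n × Eu n => divg (Fld δ φ q.1 (e q.1)) q.2) =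
          fun q => trL n (FldD δ φ q.1 (e q.1) q.2) := by
        ext q
        rw [divg_eq_trL, (hasFDerivAt_Fld hφ q.1 (e q.1) q.2).fderiv]
      exact (hum.comp measurable_snd).mul
        (this ▸ (trL n).continuous.measurable.comp (measurable_FldD hδ hφ hem))
    · rw [Measure.prod_restrict]
      refine (ae_restrict_iff' (hAm.prod hΩm)).2 (Eventually.of_forall fun q hq => ?_)
      have hq1 : τ ≤ δ q.1 := hq.1
      have h0 : 0 < δ q.1 := hτ.trans_le hq1
      rw [norm_mul, mul_comm, divg_Fld hφ, norm_neg]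
      gcongr
      calc ‖kDL δ φ q.1 q.2 (e q.1)‖ ≤ ‖kDL δ φ q.1 q.2‖ * ‖e q.1‖ :=
            ContinuousLinearMap.le_opNorm _ _
        _ ≤ ‖kDL δ φ q.1 q.2‖ * 1 := by gcongr; exact he1 _
        _ ≤ _ := by
            rw [mul_one]
            refine (norm_kDL_le hδ hφ _ _).trans ?_
            gcongr
  have hswap := integral_integral_swap (f := fun x y => u y * divg (Fld δ φ x (e x)) y) hintg
  have hleft : ∫ x in {x | τ ≤ δ x}, ‖fderiv ℝ w x‖ =
      ∫ x in {x | τ ≤ δ x}, ∫ y in Ω, u y * divg (Fld δ φ x (e x)) y := by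
    refine setIntegral_congr_fun hAm fun x hx => ?_
    have := fderiv_Sm_apply hδ hφ hu (hsub hx) (e x)
    rw [← hw, hDe] at this
    linarith
  have hright : ∫ y in Ω, ∫ x in {x | τ ≤ δ x}, u y * divg (Fld δ φ x (e x)) y =
      ∫ y in Ω, u y * divg (Psi δ φ e {x | τ ≤ δ x}) y := by
    congr 1
    ext y
    rw [divg_Psi hΩm hv hδ hφ hem he1 hτ, integral_const_mul]
  have hts := Psi_support hδ hφ e hτ
  have htsΩ : {y | τ / 2 ≤ δ y} ⊆ Ω := fun x (hx : τ / 2 ≤ δ x) => hδ.mem_of_pos (by linarith)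
  have hcomp : HasCompactSupport (Psi δ φ e {x | τ ≤ δ x}) :=
    Metric.isCompact_of_isClosed_isBounded (isClosed_tsupport _)
      (hb.subset (hts.trans htsΩ))
  have hfinal := le_totVarOpen_mul hT (Psi_contDiff hΩm hv hδ hφ hem he1 hτ) hcomp
    (hts.trans htsΩ) (b := 3 / 2 * ((kerC n B).toReal + 1)) (by positivity)
    (Psi_norm_le hΩm hδ hφ he1 hτ)
  rw [← hright, ← hswap, ← hleft] at hfinal
  rw [← ofReal_integral_eq_lintegral_ofReal]
  · exact ENNReal.ofReal_le_ofReal hfinal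
  · refine Integrable.mono' (integrable_const
      ((τ⁻¹) ^ (n + 1) * (B * (3 / 2 + n / 2)) * ∫ y in Ω, ‖u y‖)) ?_ ?_
    · exact (measurable_fderiv ℝ w).norm.aestronglyMeasurable
    · refine (ae_restrict_iff' hAm).2 (Eventually.of_forall fun x hx => ?_)
      rw [norm_norm]
      have hx' : τ ≤ δ x := hx
      have h0 : 0 < δ x := hτ.trans_le hx'
      refine (norm_fderiv_Sm_le hδ hφ hu (hsub hx)).trans ?_
      have hintg : 0 ≤ ∫ y in Ω, ‖u y‖ := integral_nonneg fun y => norm_nonneg _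
      gcongr
  · exact Eventually.of_forall fun x => norm_nonneg _

/-- Estimate (b). -/
lemma Sm_grad_l1 (hΩ : IsOpen Ω) (hb : Bornology.IsBounded Ω) (hv : volume Ω < ⊤)
    (hδ : Scale Ω δ) (hφ : Moll φ B)
    (hum : Measurable u) (hu : IntegrableOn u Ω) (hT : totVarOpen Ω u < ⊤) :
    ∫⁻ x in Ω, ENNReal.ofReal ‖fderiv ℝ (Sm Ω δ φ u) x‖ ≤
      ENNReal.ofReal (3 / 2 * ((kerC n B).toReal + 1) * (totVarOpen Ω u).toReal) := by
  have hU : Ω = ⋃ k : ℕ, {x | 1 / ((k : ℝ) + 1) ≤ δ x} := by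
    ext x
    simp only [mem_iUnion, mem_setOf_eq]
    constructor
    · intro hx
      obtain ⟨k, hk⟩ := exists_nat_one_div_lt (hδ.pos x hx)
      exact ⟨k, hk.le⟩
    · rintro ⟨k, hk⟩
      exact hδ.mem_of_pos (lt_of_lt_of_le (by positivity) hk)
  have hmono : Monotone fun k : ℕ => {x | 1 / ((k : ℝ) + 1) ≤ δ x} := by
    intro a b hab x hx
    have hx' : 1 / ((a : ℝ) + 1) ≤ δ x := hx
    refine le_trans ?_ hx'
    gcongr
  have := setLIntegral_iUnion_of_directed (μ := volume)
    (fun x => ENNReal.ofReal ‖fderiv ℝ (Sm Ω δ φ u) x‖) hmono.directed_le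
  rw [← hU] at this
  rw [this]
  exact iSup_le fun k => Sm_grad_l1_aux hΩ hb hv hδ hφ hum hu hT (by positivity)

end

section
variable {n : ℕ} {Ω : Set (Eu n)} {δ φ : Eu n → ℝ} {B : ℝ} {p : Eu n → ℝ} {c M : ℝ}

lemma logHolder_le (hc : 0 < c) (hlog : LogHolderOn c Ω p) {x y : Eu n} (hx : x ∈ Ω) (hy : y ∈ Ω)
    {d : ℝ} (hd : 0 < d) (hxy : ‖x - y‖ ≤ d) :
    |p x - p y| ≤ c / Real.log (Real.exp 1 + 1 / d) := by
  have he : 1 < Real.exp 1 + 1 / d := by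
    have : (2:ℝ) ≤ Real.exp 1 := by have := Real.add_one_le_exp (1:ℝ); linarith
    have : 0 < 1 / d := by positivity
    linarith
  have hL : 0 < Real.log (Real.exp 1 + 1 / d) := Real.log_pos he
  by_cases h : x = y
  · subst h; rw [sub_self, abs_zero]; exact div_nonneg hc.le hL.le
  refine (hlog x hx y hy).trans ?_
  have h0 : 0 < dist x y := dist_pos.2 h
  have h1 : dist x y ≤ d := by rwa [dist_eq_norm]
  gcongr

lemma rpow_bound (hc : 0 < c) {t D d q : ℝ} (n : ℕ) (ht : 1 ≤ t) (hD : 1 ≤ D) (hd : 0 < d)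
    (htD : t ≤ D * (d⁻¹) ^ n) (hq : q ≤ c / Real.log (Real.exp 1 + 1 / d)) :
    t ^ q ≤ Real.exp (c * (Real.log D + n)) := by
  set L := Real.log (Real.exp 1 + 1 / d) with hL
  have hd' : 0 < 1 / d := by positivity
  have hL1 : 1 ≤ L := by
    rw [hL, Real.le_log_iff_exp_le (by positivity)]
    linarith
  have hlt : 0 ≤ Real.log t := Real.log_nonneg ht
  have hlD : 0 ≤ Real.log D := Real.log_nonneg hD
  have h1 : Real.log t ≤ Real.log D + n * L := by
    calc Real.log t ≤ Real.log (D * (d⁻¹) ^ n) := Real.log_le_log (by linarith) htD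
      _ = Real.log D + n * Real.log (1 / d) := by
          rw [Real.log_mul (by positivity) (by positivity), Real.log_pow, one_div]
      _ ≤ _ := by
          gcongr
          rw [hL]
          exact Real.log_le_log hd' (by linarith [Real.exp_pos 1])
  rw [Real.rpow_def_of_pos (by linarith)]
  apply Real.exp_le_exp.2
  calc Real.log t * q ≤ Real.log t * (c / L) := by gcongr
    _ ≤ (Real.log D + n * L) * (c / L) := by gcongr
    _ = c * (Real.log D / L + n) := by field_simp
    _ ≤ c * (Real.log D + n) := by
        gcongr
        exact div_le_self hlD hL1

/-- The constant in the Jensen type inequality. -/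
def KJ (n : ℕ) (B c M M0 : ℝ) : ℝ := 2 ^ M * Real.exp (c * (Real.log (1 + B * M0) + n))

/-- Jensen type inequality, pointwise part. -/
lemma jensen_pointwise {t f px py K : ℝ} (ht : 1 < t) (hf : 0 ≤ f) (hpy : 1 ≤ py) (hpM : py ≤ M)
    (hK : t ^ (px - py) ≤ K) :
    t ^ (px - 1) * f ≤ t ^ px / 2 + 2 ^ M * K * f ^ py := by
  have ht0 : 0 < t := by linarith
  have hK0 : 0 ≤ K := (Real.rpow_nonneg ht0.le _).trans hK
  have hmul : t ^ (px - 1) * t = t ^ px := by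
    rw [← Real.rpow_add_one ht0.ne']; congr 1; ring
  rcases le_or_gt f (t / 2) with h | h
  · have h1 : t ^ (px - 1) * f ≤ t ^ (px - 1) * (t / 2) := by gcongr
    have h2 : 0 ≤ 2 ^ M * K * f ^ py := by positivity
    linarith
  · have hf0 : 0 < f := by linarith
    have h1 : f = f ^ py * f ^ (1 - py) := by
      rw [← Real.rpow_add hf0]; simp
    have h2 : f ^ (1 - py) ≤ (t / 2) ^ (1 - py) :=
      Real.rpow_le_rpow_of_nonpos (by linarith) h.le (by linarith)
    have h3 : t ^ (px - 1) * (t / 2) ^ (1 - py) = t ^ (px - py) * 2 ^ (py - 1) := by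
      rw [Real.div_rpow ht0.le (by norm_num), div_eq_mul_inv, ← mul_assoc, ← Real.rpow_add ht0,
        ← Real.rpow_neg (by norm_num)]
      congr 2 <;> ring
    have h4 : (2:ℝ) ^ (py - 1) ≤ 2 ^ M :=
      Real.rpow_le_rpow_of_exponent_le (by norm_num) (by linarith)
    have h5 : 0 ≤ t ^ px / 2 := by positivity
    calc t ^ (px - 1) * f = t ^ (px - 1) * (f ^ py * f ^ (1 - py)) := by rw [← h1]
      _ ≤ t ^ (px - 1) * (f ^ py * (t / 2) ^ (1 - py)) := by gcongr
      _ = (t ^ (px - 1) * (t / 2) ^ (1 - py)) * f ^ py := by ring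
      _ = (t ^ (px - py) * 2 ^ (py - 1)) * f ^ py := by rw [h3]
      _ ≤ (K * 2 ^ M) * f ^ py := by gcongr
      _ ≤ _ := by linarith

lemma ker_lint_le (hδ : Scale Ω δ) (hφ : Moll φ B) {f : Eu n → ℝ} {M0 : ℝ}
    (hM0 : 0 ≤ M0) (hfi : ∫⁻ y in Ω, ENNReal.ofReal (f y) ≤ ENNReal.ofReal M0) (x : Eu n) :
    ∫⁻ y in Ω, ENNReal.ofReal (vker δ φ x y) * ENNReal.ofReal (f y) ≤
      ENNReal.ofReal (B * ((δ x)⁻¹) ^ n * M0) := by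
  have hB := hφ.B_nonneg
  have hs : 0 ≤ (δ x)⁻¹ := inv_nonneg.2 (hδ.nonneg x)
  calc _ ≤ ∫⁻ y in Ω, ENNReal.ofReal (B * ((δ x)⁻¹) ^ n) * ENNReal.ofReal (f y) := by
        gcongr with y
        exact vker_le hδ hφ x y
    _ = ENNReal.ofReal (B * ((δ x)⁻¹) ^ n) * ∫⁻ y in Ω, ENNReal.ofReal (f y) := by
        rw [lintegral_const_mul' _ _ ENNReal.ofReal_ne_top]
    _ ≤ ENNReal.ofReal (B * ((δ x)⁻¹) ^ n) * ENNReal.ofReal M0 := by gcongr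
    _ = _ := by rw [← ENNReal.ofReal_mul (by positivity)]

/-- Jensen type inequality for log-Hölder exponents. -/
lemma jensen_log (hΩm : MeasurableSet Ω) (hδ : Scale Ω δ) (hφ : Moll φ B) (hpm : Measurable p)
    (hp1 : ∀ x ∈ Ω, 1 ≤ p x) (hM : ∀ x ∈ Ω, p x ≤ M) (hc : 0 < c) (hlog : LogHolderOn c Ω p)
    {f : Eu n → ℝ} (hf : Measurable f) (hf0 : ∀ y, 0 ≤ f y) {M0 : ℝ} (hM0 : 0 ≤ M0)
    (hfi : ∫⁻ y in Ω, ENNReal.ofReal (f y) ≤ ENNReal.ofReal M0) {x : Eu n} (hx : x ∈ Ω) :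
    ENNReal.ofReal
      ((∫⁻ y in Ω, ENNReal.ofReal (vker δ φ x y) * ENNReal.ofReal (f y)).toReal ^ p x) ≤
    (∫⁻ y in Ω, ENNReal.ofReal (vker δ φ x y) * ENNReal.ofReal (f y)) +
      ENNReal.ofReal (2 * KJ n B c M M0) *
        ∫⁻ y in Ω, ENNReal.ofReal (vker δ φ x y) * ENNReal.ofReal (f y ^ p y) := by
  have hB := hφ.B_nonneg
  have h0 := hδ.pos x hx
  have hle := ker_lint_le hδ hφ hM0 hfi x
  set F := ∫⁻ y in Ω, ENNReal.ofReal (vker δ φ x y) * ENNReal.ofReal (f y) with hF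
  set H := ∫⁻ y in Ω, ENNReal.ofReal (vker δ φ x y) * ENNReal.ofReal (f y ^ p y) with hH
  have hFt : F ≠ ⊤ := (hle.trans_lt ENNReal.ofReal_lt_top).ne
  set t := F.toReal with ht
  have htF : ENNReal.ofReal t = F := ENNReal.ofReal_toReal hFt
  have hp := hp1 x hx
  rcases le_or_gt t 1 with h | h
  · refine le_trans ?_ le_self_add
    rw [← htF]
    refine ENNReal.ofReal_le_ofReal ?_
    have := Real.rpow_le_rpow_of_exponent_ge_of_imp (x := t) ENNReal.toReal_nonneg h hp
      (fun _ h => by linarith)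
    simpa using this
  refine le_trans ?_ le_add_self
  have htD : t ≤ (1 + B * M0) * ((δ x)⁻¹) ^ n := by
    have h1 : t ≤ B * ((δ x)⁻¹) ^ n * M0 := ENNReal.toReal_le_of_le_ofReal (by positivity) hle
    have h2 : 0 ≤ ((δ x)⁻¹) ^ n := by positivity
    nlinarith
  set K := Real.exp (c * (Real.log (1 + B * M0) + n)) with hK
  have hKJ : KJ n B c M M0 = 2 ^ M * K := rfl
  have key : ENNReal.ofReal (t ^ p x) ≤ ENNReal.ofReal (t ^ p x / 2) +
      ENNReal.ofReal (2 ^ M * K) * H := by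
    have e1 : ENNReal.ofReal (t ^ p x) = ENNReal.ofReal (t ^ (p x - 1)) * F := by
      rw [← htF, ← ENNReal.ofReal_mul (by positivity), ← Real.rpow_add_one (by linarith)]
      congr 2; ring
    calc ENNReal.ofReal (t ^ p x) = ENNReal.ofReal (t ^ (p x - 1)) * F := e1
      _ = ∫⁻ y in Ω, ENNReal.ofReal (t ^ (p x - 1)) *
            (ENNReal.ofReal (vker δ φ x y) * ENNReal.ofReal (f y)) := by
          rw [lintegral_const_mul' _ _ ENNReal.ofReal_ne_top]
      _ ≤ ∫⁻ y in Ω, (ENNReal.ofReal (t ^ p x / 2) * ENNReal.ofReal (vker δ φ x y) +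
            ENNReal.ofReal (2 ^ M * K) *
              (ENNReal.ofReal (vker δ φ x y) * ENNReal.ofReal (f y ^ p y))) := by
          refine setLIntegral_mono' hΩm fun y hy => ?_
          by_cases hk : vker δ φ x y = 0
          · simp [hk]
          have hxy := (vker_supp hδ hφ hx hk).le
          have hq := logHolder_le hc hlog hx hy h0 hxy
          have hb := rpow_bound hc n h.le (by nlinarith [mul_nonneg hB hM0]) h0 htD
            ((le_abs_self _).trans hq)
          have hj := jensen_pointwise h (hf0 y) (hp1 y hy) (hM y hy) hb
          have hkn := vker_nonneg hδ hφ x y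
          have hfp : 0 ≤ f y ^ p y := Real.rpow_nonneg (hf0 y) _
          rw [← ENNReal.ofReal_mul hkn, ← ENNReal.ofReal_mul hkn,
            ← ENNReal.ofReal_mul (by positivity), ← ENNReal.ofReal_mul (by positivity),
            ← ENNReal.ofReal_mul (by positivity), ← ENNReal.ofReal_add (by positivity)
              (by positivity)]
          refine ENNReal.ofReal_le_ofReal ?_
          nlinarith
      _ = ENNReal.ofReal (t ^ p x / 2) * (∫⁻ y in Ω, ENNReal.ofReal (vker δ φ x y)) +
            ENNReal.ofReal (2 ^ M * K) * H := by
          rw [lintegral_add_left, lintegral_const_mul' _ _ ENNReal.ofReal_ne_top,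
            lintegral_const_mul' _ _ ENNReal.ofReal_ne_top]
          exact ((continuous_ker_right hφ x).measurable.ennreal_ofReal).const_mul _
      _ ≤ ENNReal.ofReal (t ^ p x / 2) * 1 + ENNReal.ofReal (2 ^ M * K) * H := by
          gcongr
          rw [← lintegral_ker hδ hφ hx]
          exact setLIntegral_le_lintegral _ _
      _ = _ := by rw [mul_one]
  have h2 : ENNReal.ofReal (t ^ p x) = ENNReal.ofReal (t ^ p x / 2) + ENNReal.ofReal (t ^ p x / 2) := by
    rw [← ENNReal.ofReal_add (by positivity) (by positivity)]; congr 1; ring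
  have h3 : ENNReal.ofReal (t ^ p x / 2) ≤ ENNReal.ofReal (2 ^ M * K) * H := by
    rw [h2] at key
    exact (ENNReal.add_le_add_iff_left ENNReal.ofReal_ne_top).1 key
  rw [h2, hKJ, ENNReal.ofReal_mul (by norm_num)]
  calc _ ≤ ENNReal.ofReal (2 ^ M * K) * H + ENNReal.ofReal (2 ^ M * K) * H := add_le_add h3 h3
    _ = _ := by rw [← two_mul, ← mul_assoc]; simp

lemma tonelli_ker (hΩm : MeasurableSet Ω) (hδ : Scale Ω δ) (hφ : Moll φ B) {h : Eu n → ℝ≥0∞}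
    (hh : Measurable h) :
    ∫⁻ x in Ω, ∫⁻ y in Ω, ENNReal.ofReal (vker δ φ x y) * h y ≤ kerC n B * ∫⁻ y in Ω, h y := by
  have hm : Measurable (fun q : Eu n × Eu n => ENNReal.ofReal (vker δ φ q.1 q.2) * h q.2) :=
    (measurable_ker hδ hφ).ennreal_ofReal.mul (hh.comp measurable_snd)
  rw [lintegral_lintegral_swap (f := fun x y => ENNReal.ofReal (vker δ φ x y) * h y)
    hm.aemeasurable, ← lintegral_const_mul _ hh]
  refine lintegral_mono fun y => ?_
  rw [lintegral_mul_const]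
  · gcongr
    exact lintegral_ker_left hΩm hδ hφ y
  · exact ((measurable_ker hδ hφ).comp (measurable_id.prodMk measurable_const)).ennreal_ofReal

lemma measurable_kerint (hδ : Scale Ω δ) (hφ : Moll φ B) {h : Eu n → ℝ≥0∞}
    (hh : Measurable h) :
    Measurable fun x => ∫⁻ y in Ω, ENNReal.ofReal (vker δ φ x y) * h y :=
  Measurable.lintegral_prod_right
    (f := fun x y => ENNReal.ofReal (vker δ φ x y) * h y)
    ((measurable_ker hδ hφ).ennreal_ofReal.mul (hh.comp measurable_snd))

end

section
variable {n : ℕ} {Ω : Set (Eu n)} {δ φ : Eu n → ℝ} {B : ℝ} {p : Eu n → ℝ} {c M : ℝ} {u : Eu n → ℝ}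

lemma setLIntegral_eq_of_zero {S T : Set (Eu n)} (hS : MeasurableSet S) (hT : MeasurableSet T)
    (hST : S ⊆ T) {f : Eu n → ℝ≥0∞} (h : ∀ x ∈ T, x ∉ S → f x = 0) :
    ∫⁻ x in T, f x = ∫⁻ x in S, f x := by
  rw [← lintegral_indicator hT, ← lintegral_indicator hS]
  congr 1
  ext x
  by_cases h1 : x ∈ S
  · rw [indicator_of_mem h1, indicator_of_mem (hST h1)]
  · by_cases h2 : x ∈ T
    · rw [indicator_of_mem h2, indicator_of_notMem h1, h x h2 h1]
    · rw [indicator_of_notMem h2, indicator_of_notMem h1]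

lemma grad_pointwise (hΩ : IsOpen Ω)
    (hpm : Measurable p) (hp1 : ∀ x ∈ Ω, 1 ≤ p x) (hM : ∀ x ∈ Ω, p x ≤ M) (hc : 0 < c)
    (hlog : LogHolderOn c Ω p) (hφ : Moll φ B) (hu : IntegrableOn u Ω)
    (hT : totVarOpen Ω u < ⊤) {g : Eu n → Eu n} (hgm : Measurable g)
    (hw : IsWeakGrad (Ω \ {x | p x = 1}) u g) (hgi : IntegrableOn g (Ω \ {x | p x = 1}))
    {M0 : ℝ} (hM0 : 0 ≤ M0) (hgM0 : ∫⁻ y in Ω, ENNReal.ofReal ‖g y‖ ≤ ENNReal.ofReal M0)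
    (hδ : Scale Ω δ) {x : Eu n} (hx : x ∈ Ω) :
    ENNReal.ofReal (‖fderiv ℝ (Sm Ω δ φ u) x‖ ^ p x) ≤
      1 + ENNReal.ofReal (Real.exp (c * (Real.log
          (1 + 3 / 2 * (B + 1) * (totVarOpen Ω u).toReal) + n))) *
        ENNReal.ofReal ‖fderiv ℝ (Sm Ω δ φ u) x‖ +
      ENNReal.ofReal (max 1 (3 / 2) ^ M) *
        ((∫⁻ y in Ω, ENNReal.ofReal (vker δ φ x y) * ENNReal.ofReal ‖g y‖) +
        ENNReal.ofReal (2 * KJ n B c M M0) *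
          ∫⁻ y in Ω, ENNReal.ofReal (vker δ φ x y) * ENNReal.ofReal (‖g y‖ ^ p y)) := by
  have hΩm := hΩ.measurableSet
  have h0 := hδ.pos x hx
  have hB := hφ.B_nonneg
  set t := ‖fderiv ℝ (Sm Ω δ φ u) x‖ with ht
  have ht0 : 0 ≤ t := norm_nonneg _
  have hp := hp1 x hx
  by_cases hY : ∃ y ∈ Metric.closedBall x (δ x), p y = 1
  · obtain ⟨y, hy, hpy⟩ := hY
    have hyΩ := hδ.ball_subset hx hy
    refine le_trans ?_ le_self_add
    rcases le_or_gt t 1 with h | h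
    · refine le_trans ?_ le_self_add
      rw [← ENNReal.ofReal_one]
      exact ENNReal.ofReal_le_ofReal (Real.rpow_le_one ht0 h (by linarith))
    · refine le_trans ?_ le_add_self
      rw [← ENNReal.ofReal_mul (Real.exp_pos _).le]
      refine ENNReal.ofReal_le_ofReal ?_
      rw [Metric.mem_closedBall, dist_comm, dist_eq_norm] at hy
      have hq := (le_abs_self _).trans (logHolder_le hc hlog hx hyΩ h0 hy)
      rw [hpy] at hq
      have ha := fderiv_Sm_le_tv hδ hφ hu hT hx
      rw [← ht] at ha
      have hTn : 0 ≤ (totVarOpen Ω u).toReal := ENNReal.toReal_nonneg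
      have hs : 0 ≤ ((δ x)⁻¹) ^ n := by positivity
      have hb := rpow_bound hc n (D := 1 + 3 / 2 * (B + 1) * (totVarOpen Ω u).toReal) h.le
        (by have : 0 ≤ 3 / 2 * (B + 1) * (totVarOpen Ω u).toReal := by positivity
            linarith) h0 (by nlinarith) hq
      calc t ^ p x = t ^ (p x - 1) * t := by
            rw [← Real.rpow_add_one (by linarith)]; congr 1; ring
        _ ≤ _ := by gcongr
  · push Not at hY
    refine le_trans ?_ le_add_self
    have hsub : Metric.closedBall x (δ x) ⊆ Ω \ {x | p x = 1} :=
      fun y hy => ⟨hδ.ball_subset hx hy, hY y hy⟩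
    have h1 := fderiv_Sm_le_grad hΩm hδ hφ hu (diff_subset) hgi hw hx hsub
    have hJ := jensen_log hΩm hδ hφ hpm hp1 hM hc hlog hgm.norm (fun y => norm_nonneg _) hM0
      hgM0 hx
    have hle := ker_lint_le hδ hφ hM0 hgM0 x
    have h2 : ENNReal.ofReal t ≤ ENNReal.ofReal (3 / 2) *
        ∫⁻ y in Ω, ENNReal.ofReal (vker δ φ x y) * ENNReal.ofReal ‖g y‖ := by
      refine h1.trans ?_
      gcongr
      exact diff_subset
    set F := ∫⁻ y in Ω, ENNReal.ofReal (vker δ φ x y) * ENNReal.ofReal ‖g y‖ with hF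
    have hFt : F ≠ ⊤ := (hle.trans_lt ENNReal.ofReal_lt_top).ne
    rw [← ENNReal.ofReal_toReal hFt, ← ENNReal.ofReal_mul (by norm_num),
      ENNReal.ofReal_le_ofReal_iff (by positivity)] at h2
    have h3 : t ^ p x ≤ max 1 (3 / 2) ^ M * F.toReal ^ p x :=
      (Real.rpow_le_rpow ht0 h2 (by linarith)).trans
        (mul_rpow_le_max (by norm_num) ENNReal.toReal_nonneg hp (hM x hx))
    refine (ENNReal.ofReal_le_ofReal h3).trans ?_
    rw [ENNReal.ofReal_mul (by positivity)]
    gcongr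

/-- Uniform bound on the gradient modular of the mollifications. -/
lemma grad_bound (hΩ : IsOpen Ω) (hb : Bornology.IsBounded Ω) (hv : volume Ω < ⊤)
    (hpm : Measurable p) (hp1 : ∀ x ∈ Ω, 1 ≤ p x) (hM : ∀ x ∈ Ω, p x ≤ M) (hc : 0 < c)
    (hlog : LogHolderOn c Ω p) (hφ : Moll φ B) (hum : Measurable u) (hu : IntegrableOn u Ω)
    (hT : totVarOpen Ω u < ⊤) {g : Eu n → Eu n} (hgm : Measurable g)
    (hg0 : ∀ x ∉ Ω \ {x | p x = 1}, g x = 0)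
    (hw : IsWeakGrad (Ω \ {x | p x = 1}) u g) (hgi : IntegrableOn g (Ω \ {x | p x = 1}))
    (hgp : ∫⁻ x in Ω \ {x | p x = 1}, ENNReal.ofReal (‖g x‖ ^ p x) < ⊤) :
    ∃ C : ℝ≥0∞, C < ⊤ ∧ ∀ δ, Scale Ω δ →
      gradModular p Ω (Ω.indicator (Sm Ω δ φ u)) ≤ C := by
  have hΩm := hΩ.measurableSet
  have hSm : MeasurableSet (Ω \ {x | p x = 1}) := hΩm.diff (hpm (measurableSet_singleton 1))
  have e1 : ∫⁻ y in Ω, ENNReal.ofReal ‖g y‖ = ∫⁻ y in Ω \ {x | p x = 1}, ENNReal.ofReal ‖g y‖ := by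
    refine setLIntegral_eq_of_zero hSm hΩm diff_subset fun x hx hx2 => ?_
    rw [hg0 x hx2]; simp
  have e2 : ∫⁻ y in Ω, ENNReal.ofReal (‖g y‖ ^ p y) =
      ∫⁻ y in Ω \ {x | p x = 1}, ENNReal.ofReal (‖g y‖ ^ p y) := by
    refine setLIntegral_eq_of_zero hSm hΩm diff_subset fun x hx hx2 => ?_
    have := hp1 x hx
    rw [hg0 x hx2, norm_zero, Real.zero_rpow (by linarith)]; simp
  have hfin : ∫⁻ y in Ω, ENNReal.ofReal ‖g y‖ < ⊤ := by
    rw [e1]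
    have := hgi.2
    simpa only [HasFiniteIntegral, ofReal_norm] using this
  set M0 := (∫⁻ y in Ω, ENNReal.ofReal ‖g y‖).toReal with hM0
  have hgM0 : ∫⁻ y in Ω, ENNReal.ofReal ‖g y‖ ≤ ENNReal.ofReal M0 := by
    rw [hM0, ENNReal.ofReal_toReal hfin.ne]
  set K1 := ENNReal.ofReal (Real.exp (c * (Real.log
          (1 + 3 / 2 * (B + 1) * (totVarOpen Ω u).toReal) + n))) with hK1
  set K2 := ENNReal.ofReal (max 1 (3 / 2) ^ M) with hK2
  set K3 := ENNReal.ofReal (2 * KJ n B c M M0) with hK3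
  refine ⟨volume Ω + K1 * ENNReal.ofReal (3 / 2 * ((kerC n B).toReal + 1) * (totVarOpen Ω u).toReal)
    + K2 * (kerC n B * (∫⁻ y in Ω, ENNReal.ofReal ‖g y‖) +
      K3 * (kerC n B * ∫⁻ y in Ω, ENNReal.ofReal (‖g y‖ ^ p y))), ?_, ?_⟩
  · have hk := kerC_lt_top n B
    rw [← e2] at hgp
    have a1 : K1 * ENNReal.ofReal (3 / 2 * ((kerC n B).toReal + 1) * (totVarOpen Ω u).toReal) < ⊤ :=
      ENNReal.mul_lt_top ENNReal.ofReal_lt_top ENNReal.ofReal_lt_top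
    have a2 := ENNReal.mul_lt_top hk hfin
    have a3 := ENNReal.mul_lt_top (ENNReal.ofReal_lt_top : K3 < ⊤) (ENNReal.mul_lt_top hk hgp)
    exact ENNReal.add_lt_top.2 ⟨ENNReal.add_lt_top.2 ⟨hv, a1⟩,
      ENNReal.mul_lt_top ENNReal.ofReal_lt_top (ENNReal.add_lt_top.2 ⟨a2, a3⟩)⟩
  · intro δ hδ
    have hm1 : Measurable fun y => ENNReal.ofReal ‖g y‖ := hgm.norm.ennreal_ofReal
    have hm2 : Measurable fun y => ENNReal.ofReal (‖g y‖ ^ p y) :=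
      (hgm.norm.pow hpm).ennreal_ofReal
    have hm3 : Measurable fun x => ENNReal.ofReal ‖fderiv ℝ (Sm Ω δ φ u) x‖ :=
      (measurable_fderiv ℝ _).norm.ennreal_ofReal
    have hk1 := measurable_kerint (Ω := Ω) hδ hφ hm1
    have hk2 := measurable_kerint (Ω := Ω) hδ hφ hm2
    unfold gradModular
    calc _ ≤ ∫⁻ x in Ω, (1 + K1 * ENNReal.ofReal ‖fderiv ℝ (Sm Ω δ φ u) x‖ +
        K2 * ((∫⁻ y in Ω, ENNReal.ofReal (vker δ φ x y) * ENNReal.ofReal ‖g y‖) +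
        K3 * ∫⁻ y in Ω, ENNReal.ofReal (vker δ φ x y) * ENNReal.ofReal (‖g y‖ ^ p y))) := by
          refine setLIntegral_mono' hΩm fun x hx => ?_
          rw [fderiv_ind_Sm hΩ hx]
          exact grad_pointwise hΩ hpm hp1 hM hc hlog hφ hu hT hgm hw hgi ENNReal.toReal_nonneg
            hgM0 hδ hx
      _ = volume Ω + K1 * (∫⁻ x in Ω, ENNReal.ofReal ‖fderiv ℝ (Sm Ω δ φ u) x‖) +
        K2 * ((∫⁻ x in Ω, ∫⁻ y in Ω, ENNReal.ofReal (vker δ φ x y) * ENNReal.ofReal ‖g y‖) +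
        K3 * ∫⁻ x in Ω, ∫⁻ y in Ω,
          ENNReal.ofReal (vker δ φ x y) * ENNReal.ofReal (‖g y‖ ^ p y)) := by
          rw [lintegral_add_left (by fun_prop), lintegral_add_left measurable_const,
            lintegral_const_mul _ hm3, lintegral_const_mul' K2 _ ENNReal.ofReal_ne_top,
            lintegral_add_left hk1, lintegral_const_mul _ hk2]
          simp
      _ ≤ _ := by
          gcongr
          · exact Sm_grad_l1 hΩ hb hv hδ hφ hum hu hT
          · exact tonelli_ker hΩm hδ hφ hm1
          · exact tonelli_ker hΩm hδ hφ hm2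

end

/-! ### Convergence -/
section
variable {n : ℕ} {Ω : Set (Eu n)} {δ φ : Eu n → ℝ} {B : ℝ} {p : Eu n → ℝ} {c M : ℝ}

lemma Sm_modular (hΩm : MeasurableSet Ω) (hδ : Scale Ω δ) (hφ : Moll φ B) (hpm : Measurable p)
    (hp1 : ∀ x ∈ Ω, 1 ≤ p x) (hM : ∀ x ∈ Ω, p x ≤ M) (hc : 0 < c) (hlog : LogHolderOn c Ω p)
    {w : Eu n → ℝ} (hw : Measurable w) {M0 : ℝ} (hM0 : 0 ≤ M0)
    (hfi : ∫⁻ y in Ω, ENNReal.ofReal |w y| ≤ ENNReal.ofReal M0) :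
    vModular p Ω (Sm Ω δ φ w) ≤ kerC n B * (∫⁻ y in Ω, ENNReal.ofReal |w y|) +
      ENNReal.ofReal (2 * KJ n B c M M0) * (kerC n B * vModular p Ω w) := by
  have hwa : Measurable fun y => |w y| := hw.norm
  have hm1 : Measurable fun y => ENNReal.ofReal |w y| := hwa.ennreal_ofReal
  have hm2 : Measurable fun y => ENNReal.ofReal (|w y| ^ p y) := (hwa.pow hpm).ennreal_ofReal
  have hk1 := measurable_kerint (Ω := Ω) hδ hφ hm1
  have hk2 := measurable_kerint (Ω := Ω) hδ hφ hm2
  have hpt : ∀ x ∈ Ω, ENNReal.ofReal (|Sm Ω δ φ w x| ^ p x) ≤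
      (∫⁻ y in Ω, ENNReal.ofReal (vker δ φ x y) * ENNReal.ofReal |w y|) +
      ENNReal.ofReal (2 * KJ n B c M M0) *
        ∫⁻ y in Ω, ENNReal.ofReal (vker δ φ x y) * ENNReal.ofReal (|w y| ^ p y) := by
    intro x hx
    refine le_trans ?_ (jensen_log hΩm hδ hφ hpm hp1 hM hc hlog hwa (fun y => abs_nonneg _) hM0
      hfi hx)
    have hF := (ker_lint_le hδ hφ hM0 hfi x).trans_lt ENNReal.ofReal_lt_top
    have h1 : ‖Sm Ω δ φ w x‖ₑ ≤
        ∫⁻ y in Ω, ENNReal.ofReal (vker δ φ x y) * ENNReal.ofReal |w y| := by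
      refine (enorm_integral_le_lintegral_enorm _).trans (le_of_eq ?_)
      refine lintegral_congr fun y => ?_
      rw [← ENNReal.ofReal_mul (vker_nonneg hδ hφ x y), ← ofReal_norm, norm_mul,
        Real.norm_of_nonneg (vker_nonneg hδ hφ x y), Real.norm_eq_abs]
    have h2 : |Sm Ω δ φ w x| ≤
        (∫⁻ y in Ω, ENNReal.ofReal (vker δ φ x y) * ENNReal.ofReal |w y|).toReal := by
      rw [← Real.norm_eq_abs, ← toReal_enorm]
      exact ENNReal.toReal_mono hF.ne h1
    have := hp1 x hx
    gcongr
  calc _ ≤ ∫⁻ x in Ω, ((∫⁻ y in Ω, ENNReal.ofReal (vker δ φ x y) * ENNReal.ofReal |w y|) +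
      ENNReal.ofReal (2 * KJ n B c M M0) *
        ∫⁻ y in Ω, ENNReal.ofReal (vker δ φ x y) * ENNReal.ofReal (|w y| ^ p y)) :=
        setLIntegral_mono' hΩm hpt
    _ = (∫⁻ x in Ω, ∫⁻ y in Ω, ENNReal.ofReal (vker δ φ x y) * ENNReal.ofReal |w y|) +
      ENNReal.ofReal (2 * KJ n B c M M0) * ∫⁻ x in Ω,
        ∫⁻ y in Ω, ENNReal.ofReal (vker δ φ x y) * ENNReal.ofReal (|w y| ^ p y) := by
        rw [lintegral_add_left hk1, lintegral_const_mul _ hk2]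
    _ ≤ _ := by
        gcongr
        · exact tonelli_ker hΩm hδ hφ hm1
        · exact tonelli_ker hΩm hδ hφ hm2

lemma vModular_add_le (hΩm : MeasurableSet Ω) (hpm : Measurable p)
    (hp1 : ∀ x ∈ Ω, 1 ≤ p x) (hM : ∀ x ∈ Ω, p x ≤ M) {w a b : Eu n → ℝ} (hb : Measurable b)
    (h : ∀ x ∈ Ω, |w x| ≤ |a x| + |b x|) :
    vModular p Ω w ≤ ENNReal.ofReal (2 ^ M) * (vModular p Ω a + vModular p Ω b) := by
  have hba : Measurable fun y => |b y| := hb.norm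
  unfold vModular
  rw [← lintegral_add_right _ (hba.pow hpm).ennreal_ofReal,
    ← lintegral_const_mul' _ _ ENNReal.ofReal_ne_top]
  refine setLIntegral_mono' hΩm fun x hx => ?_
  rw [← ENNReal.ofReal_add (by positivity) (by positivity), ← ENNReal.ofReal_mul (by positivity)]
  refine ENNReal.ofReal_le_ofReal ?_
  have := hp1 x hx
  exact (Real.rpow_le_rpow (abs_nonneg _) (h x hx) (by linarith)).trans
    (add_rpow_le_two (abs_nonneg _) (abs_nonneg _) this (hM x hx))

/-- Truncation. -/
def trn (k t : ℝ) : ℝ := max (-k) (min t k)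

lemma trn_sub_le (k a b : ℝ) : |trn k a - trn k b| ≤ |a - b| := by
  unfold trn
  refine (abs_max_sub_max_le_max _ _ _ _).trans ?_
  rw [sub_self, abs_zero, max_eq_right (abs_nonneg _)]
  refine (abs_min_sub_min_le_max _ _ _ _).trans ?_
  rw [sub_self, abs_zero, max_eq_left (abs_nonneg _)]

lemma trn_abs {k : ℝ} (hk : 0 ≤ k) (a : ℝ) : |trn k a| ≤ k := by
  unfold trn
  rw [abs_le]
  exact ⟨le_max_left _ _, max_le (by linarith) (min_le_right _ _)⟩

lemma trn_of_le {k a : ℝ} (h : |a| ≤ k) : trn k a = a := by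
  unfold trn
  rw [abs_le] at h
  rw [min_eq_left h.2, max_eq_right h.1]

lemma trn_zero {k : ℝ} (hk : 0 ≤ k) : trn k 0 = 0 := trn_of_le (by simpa)

lemma sub_trn_abs {k : ℝ} (hk : 0 ≤ k) (a : ℝ) : |a - trn k a| ≤ |a| := by
  unfold trn
  rcases le_total a k with h | h
  · rw [min_eq_left h]
    rcases le_total (-k) a with h2 | h2
    · rw [max_eq_right h2]; simp
    · rw [max_eq_left h2, abs_of_nonpos (by linarith), abs_of_nonpos (by linarith)]; linarith
  · rw [min_eq_right h, max_eq_right (by linarith), abs_of_nonneg (by linarith),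
      abs_of_nonneg (by linarith)]; linarith

lemma continuous_trn (k : ℝ) : Continuous (trn k) := by unfold trn; fun_prop

lemma exists_trunc (hΩm : MeasurableSet Ω) (hpm : Measurable p)
    (hp1 : ∀ x ∈ Ω, 1 ≤ p x) {u : Eu n → ℝ} (hum : Measurable u)
    (hu : ∫⁻ x in Ω, ENNReal.ofReal |u x| < ⊤) (hup : vModular p Ω u < ⊤) {ε : ℝ≥0∞} (hε : 0 < ε) :
    ∃ k : ℕ, ∫⁻ x in Ω, ENNReal.ofReal |u x - trn k (u x)| ≤ ε ∧
      vModular p Ω (fun x => u x - trn k (u x)) ≤ ε := by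
  have hmt : ∀ k : ℕ, Measurable fun x => |u x - trn k (u x)| := fun k =>
    (hum.sub ((continuous_trn k).measurable.comp hum)).norm
  have hev : ∀ x, ∀ᶠ k : ℕ in atTop, trn k (u x) = u x := fun x => by
    obtain ⟨N, hN⟩ := exists_nat_ge |u x|
    filter_upwards [eventually_ge_atTop N] with k hk
    exact trn_of_le (hN.trans (by exact_mod_cast hk))
  have h1 : Tendsto (fun k : ℕ => ∫⁻ x in Ω, ENNReal.ofReal |u x - trn k (u x)|) atTop
      (𝓝 (∫⁻ x in Ω, 0)) := by
    refine tendsto_lintegral_of_dominated_convergence (fun x => ENNReal.ofReal |u x|)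
      (fun k => (hmt k).ennreal_ofReal) (fun k => ae_of_all _ fun x => ?_) hu.ne
      (ae_of_all _ fun x => ?_)
    · exact ENNReal.ofReal_le_ofReal (sub_trn_abs (by positivity) _)
    · refine tendsto_const_nhds.congr' ?_
      filter_upwards [hev x] with k hk
      rw [hk]; simp
  have h2 : Tendsto (fun k : ℕ => vModular p Ω (fun x => u x - trn k (u x))) atTop
      (𝓝 (∫⁻ x in Ω, 0)) := by
    refine tendsto_lintegral_of_dominated_convergence (fun x => ENNReal.ofReal (|u x| ^ p x))
      (fun k => ((hmt k).pow hpm).ennreal_ofReal)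
      (fun k => (ae_restrict_mem hΩm).mono fun x hx => ?_) hup.ne
      ((ae_restrict_mem hΩm).mono fun x hx => ?_)
    · have := hp1 x hx
      exact ENNReal.ofReal_le_ofReal
        (Real.rpow_le_rpow (abs_nonneg _) (sub_trn_abs (by positivity) _) (by linarith))
    · refine tendsto_const_nhds.congr' ?_
      have := hp1 x hx
      filter_upwards [hev x] with k hk
      rw [hk, sub_self, abs_zero, Real.zero_rpow (by linarith)]; simp
  rw [lintegral_zero] at h1 h2
  obtain ⟨k, hk1, hk2⟩ := ((h1.eventually_le_const hε).and (h2.eventually_le_const hε)).exists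
  exact ⟨k, hk1, hk2⟩

lemma exists_approx (hΩm : MeasurableSet Ω) (hpm : Measurable p)
    (hp1 : ∀ x ∈ Ω, 1 ≤ p x) (hM : ∀ x ∈ Ω, p x ≤ M) {u : Eu n → ℝ} (hum : Measurable u)
    (hu : ∫⁻ x in Ω, ENNReal.ofReal |u x| < ⊤) (hup : vModular p Ω u < ⊤) {η : ℝ≥0∞} (hη : η ≠ 0) :
    ∃ h : Eu n → ℝ, Continuous h ∧ HasCompactSupport h ∧
      ∫⁻ x in Ω, ENNReal.ofReal |u x - h x| ≤ η ∧ vModular p Ω (fun x => u x - h x) ≤ η := by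
  set A := ENNReal.ofReal (2 ^ M) with hA
  have hAt : A ≠ ⊤ := ENNReal.ofReal_ne_top
  obtain ⟨e1, he1, he1'⟩ := ENNReal.exists_nnreal_pos_mul_lt (a := 2 * (A + 1)) (b := η)
    (ENNReal.mul_ne_top (by simp) (by simp [hAt])) hη
  obtain ⟨k, hk1, hk2⟩ := exists_trunc hΩm hpm hp1 hum hu hup (ε := e1) (by exact_mod_cast he1)
  have hk0 : (0:ℝ) ≤ k := by positivity
  set C2 := ENNReal.ofReal ((1 + 2 * k) ^ M) with hC2
  have hCt : C2 ≠ ⊤ := ENNReal.ofReal_ne_top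
  obtain ⟨e2, he2, he2'⟩ := ENNReal.exists_nnreal_pos_mul_lt (a := C2 + 1) (b := e1)
    (by simp [hCt]) (by exact_mod_cast he1.ne')
  set w : Eu n → ℝ := Ω.indicator fun x => trn k (u x) with hw
  have htm : Measurable fun x => trn k (u x) := (continuous_trn k).measurable.comp hum
  have hwi : Integrable w := by
    rw [hw, integrable_indicator_iff hΩm]
    have hui : IntegrableOn u Ω := ⟨hum.aestronglyMeasurable, by
      rw [hasFiniteIntegral_iff_norm]; simpa only [Real.norm_eq_abs] using hu⟩
    refine Integrable.mono hui htm.aestronglyMeasurable (ae_of_all _ fun x => ?_)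
    have := trn_sub_le k (u x) 0
    rw [trn_zero hk0] at this
    simpa using this
  obtain ⟨h0, hcs, hle, hcont, _⟩ := hwi.exists_hasCompactSupport_lintegral_sub_le
    (ε := e2) (by exact_mod_cast he2.ne')
  have hle' : ∫⁻ x in Ω, ENNReal.ofReal |trn k (u x) - h0 x| ≤ e2 := by
    refine le_trans ?_ ((setLIntegral_le_lintegral Ω _).trans hle)
    refine setLIntegral_mono' hΩm fun x hx => ?_
    rw [hw, indicator_of_mem hx, ← ofReal_norm, Real.norm_eq_abs]
  have hpt1 : ∀ x, |trn k (u x) - trn k (h0 x)| ≤ |trn k (u x) - h0 x| := fun x => by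
    have := trn_sub_le k (trn k (u x)) (h0 x)
    rwa [trn_of_le (trn_abs hk0 (u x))] at this
  have hb1 : ∫⁻ x in Ω, ENNReal.ofReal |trn k (u x) - trn k (h0 x)| ≤ e2 :=
    (lintegral_mono fun x => ENNReal.ofReal_le_ofReal (hpt1 x)).trans hle'
  have hb2 : vModular p Ω (fun x => trn k (u x) - trn k (h0 x)) ≤ C2 * e2 := by
    refine le_trans ?_ (mul_le_mul_right hb1 C2)
    rw [← lintegral_const_mul' _ _ hCt]
    refine setLIntegral_mono' hΩm fun x hx => ?_
    rw [hC2, ← ENNReal.ofReal_mul (by positivity)]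
    refine ENNReal.ofReal_le_ofReal ?_
    set s := |trn k (u x) - trn k (h0 x)| with hs
    have hs0 : 0 ≤ s := abs_nonneg _
    have hs1 : s ≤ 2 * k := by
      rw [hs]
      refine (abs_sub _ _).trans ?_
      have := trn_abs hk0 (u x)
      have := trn_abs hk0 (h0 x)
      linarith
    have hp := hp1 x hx
    rcases hs0.eq_or_lt with h | h
    · rw [← h, Real.zero_rpow (by linarith)]; simp
    · calc s ^ p x = s ^ (p x - 1) * s := by
            rw [← Real.rpow_add_one h.ne']; congr 1; ring
        _ ≤ (1 + 2 * k) ^ (p x - 1) * s := by gcongr <;> linarith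
        _ ≤ (1 + 2 * k) ^ M * s := by
            gcongr
            · linarith
            · have := hM x hx; linarith
  have hC2e : C2 * e2 ≤ e1 := by
    refine le_trans ?_ he2'.le
    rw [mul_comm]; gcongr; exact le_self_add
  have he21 : (e2 : ℝ≥0∞) ≤ e1 := by
    refine le_trans ?_ he2'.le
    conv_lhs => rw [← mul_one (e2 : ℝ≥0∞)]
    gcongr; exact le_add_self
  have hcth : Continuous fun x => trn k (h0 x) := (continuous_trn k).comp hcont
  have hdm : Measurable fun x => trn k (u x) - trn k (h0 x) := htm.sub hcth.measurable
  have htri : ∀ x, |u x - trn k (h0 x)| ≤ |u x - trn k (u x)| + |trn k (u x) - trn k (h0 x)| :=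
    fun x => abs_sub_le _ _ _
  refine ⟨fun x => trn k (h0 x), hcth, hcs.comp_left (trn_zero hk0), ?_, ?_⟩
  · calc _ ≤ ∫⁻ x in Ω, (ENNReal.ofReal |u x - trn k (u x)| +
          ENNReal.ofReal |trn k (u x) - trn k (h0 x)|) := by
          refine lintegral_mono fun x => ?_
          rw [← ENNReal.ofReal_add (abs_nonneg _) (abs_nonneg _)]
          exact ENNReal.ofReal_le_ofReal (htri x)
      _ = (∫⁻ x in Ω, ENNReal.ofReal |u x - trn k (u x)|) +
          ∫⁻ x in Ω, ENNReal.ofReal |trn k (u x) - trn k (h0 x)| := by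
          rw [lintegral_add_right]
          exact Measurable.ennreal_ofReal hdm.norm
      _ ≤ e1 + e1 := add_le_add hk1 (hb1.trans he21)
      _ = e1 * (2 * 1) := by ring
      _ ≤ e1 * (2 * (A + 1)) := by gcongr; exact le_add_self
      _ ≤ η := he1'.le
  · calc _ ≤ A * (vModular p Ω (fun x => u x - trn k (u x)) +
          vModular p Ω (fun x => trn k (u x) - trn k (h0 x))) :=
          vModular_add_le hΩm hpm hp1 hM hdm fun x _ => htri x
      _ ≤ A * (e1 + e1) := by gcongr; exact hb2.trans hC2e
      _ = e1 * (2 * A) := by ring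
      _ ≤ e1 * (2 * (A + 1)) := by gcongr; exact le_self_add
      _ ≤ η := he1'.le

lemma Sm_sub_le (hΩm : MeasurableSet Ω) (hδ : Scale Ω δ) (hφ : Moll φ B) {h : Eu n → ℝ}
    (hi : Integrable h) {d ε : ℝ} (hd : ∀ x y, ‖x - y‖ < d → |h y - h x| ≤ ε) (hδd : ∀ x, δ x ≤ d)
    {x : Eu n} (hx : x ∈ Ω) : |Sm Ω δ φ h x - h x| ≤ ε := by
  have hker : ∫ y in Ω, vker δ φ x y = 1 := by
    rw [← integral_ker hδ hφ hx]
    refine setIntegral_eq_integral_of_forall_compl_eq_zero fun y hy => ?_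
    by_contra hne
    refine hy (hδ.ball_subset hx ?_)
    rw [Metric.mem_closedBall, dist_comm, dist_eq_norm]
    exact (vker_supp hδ hφ hx hne).le
  have hkc := continuous_ker_right (δ := δ) hφ x
  have hks := vker_hasCompactSupport hδ hφ hx
  have hki : IntegrableOn (fun y => vker δ φ x y) Ω :=
    (hkc.integrable_of_hasCompactSupport hks).integrableOn
  have h1 : IntegrableOn (fun y => vker δ φ x y * h y) Ω := by
    have := integrableOn_mul_test (S := Ω) hi.integrableOn hkc hks
    simpa only [mul_comm] using this
  have e : Sm Ω δ φ h x - h x = ∫ y in Ω, vker δ φ x y * (h y - h x) := by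
    simp only [mul_sub]
    rw [integral_sub h1 (hki.mul_const _), integral_mul_const, hker, one_mul]; rfl
  rw [e, ← Real.norm_eq_abs]
  calc _ ≤ ∫ y in Ω, vker δ φ x y * ε := by
        refine norm_integral_le_of_norm_le (hki.mul_const _) (ae_of_all _ fun y => ?_)
        rw [norm_mul, Real.norm_of_nonneg (vker_nonneg hδ hφ x y), Real.norm_eq_abs]
        by_cases hk : vker δ φ x y = 0
        · simp [hk]
        · have := hd x y ((vker_supp hδ hφ hx hk).trans_le (hδd x))
          have := vker_nonneg hδ hφ x y
          gcongr
    _ = ε := by rw [integral_mul_const, hker, one_mul]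

end

section
variable {n : ℕ} {Ω : Set (Eu n)} {φ : Eu n → ℝ} {B : ℝ} {p : Eu n → ℝ} {c M : ℝ}

lemma integrableOn_ker_mul {δ : Eu n → ℝ} (hδ : Scale Ω δ) (hφ : Moll φ B) {h : Eu n → ℝ}
    (hi : IntegrableOn h Ω) {x : Eu n} (hx : x ∈ Ω) :
    IntegrableOn (fun y => vker δ φ x y * h y) Ω := by
  have := integrableOn_mul_test (S := Ω) hi (continuous_ker_right (δ := δ) hφ x)
    (vker_hasCompactSupport hδ hφ hx)
  simpa only [mul_comm] using this

lemma Sm_tendsto (hΩm : MeasurableSet Ω) (hv : volume Ω < ⊤) (hφ : Moll φ B) (hpm : Measurable p)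
    (hp1 : ∀ x ∈ Ω, 1 ≤ p x) (hM : ∀ x ∈ Ω, p x ≤ M) (hc : 0 < c) (hlog : LogHolderOn c Ω p)
    {u : Eu n → ℝ} (hum : Measurable u) (hui : IntegrableOn u Ω) (hup : vModular p Ω u < ⊤)
    {δ : ℕ → Eu n → ℝ} (hδ : ∀ j, Scale Ω (δ j)) (hδ2 : ∀ j x, δ j x ≤ 1 / ((j : ℝ) + 1)) :
    Tendsto (fun j => vModular p Ω fun x => Ω.indicator (Sm Ω (δ j) φ u) x - u x) atTop (𝓝 0) := by
  rw [ENNReal.tendsto_atTop_zero]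
  intro η hη
  set A := ENNReal.ofReal (2 ^ M) with hA
  set K := ENNReal.ofReal (2 * KJ n B c M 1) with hK
  set D := A * (kerC n B + K * kerC n B + A * (volume Ω + 1)) with hD
  have hk := (kerC_lt_top n B).ne
  have hDt : D ≠ ⊤ := by
    have hAt : A ≠ ⊤ := ENNReal.ofReal_ne_top
    have hKt : K ≠ ⊤ := ENNReal.ofReal_ne_top
    have h1 : A * (volume Ω + 1) ≠ ⊤ := ENNReal.mul_ne_top hAt (by simp [hv.ne])
    have h2 : K * kerC n B ≠ ⊤ := ENNReal.mul_ne_top hKt hk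
    exact ENNReal.mul_ne_top hAt (ENNReal.add_ne_top.2 ⟨ENNReal.add_ne_top.2 ⟨hk, h2⟩, h1⟩)
  obtain ⟨e0, he0, he0'⟩ := ENNReal.exists_nnreal_pos_mul_lt hDt hη.ne'
  set e := min e0 1 with he
  have hepos : 0 < e := lt_min he0 one_pos
  have he1 : (e : ℝ≥0∞) ≤ 1 := by exact_mod_cast min_le_right _ _
  have heD : (e : ℝ≥0∞) * D ≤ η := by
    refine le_trans ?_ he0'.le
    gcongr
    exact min_le_left _ _
  have hul : ∫⁻ x in Ω, ENNReal.ofReal |u x| < ⊤ := by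
    have := hui.2
    rw [hasFiniteIntegral_iff_norm] at this
    simpa only [Real.norm_eq_abs] using this
  obtain ⟨h, hhc, hhs, ha1, ha2⟩ := exists_approx hΩm hpm hp1 hM hum hul hup
    (η := e) (by exact_mod_cast hepos.ne')
  have hhi : Integrable h := hhc.integrable_of_hasCompactSupport hhs
  have huc := hhs.uniformContinuous_of_continuous hhc
  rw [Metric.uniformContinuous_iff] at huc
  obtain ⟨d, hd0, hd⟩ := huc e (by exact_mod_cast hepos)
  obtain ⟨N, hN⟩ := exists_nat_one_div_lt hd0
  refine ⟨N, fun j hj => ?_⟩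
  have hjd : ∀ x, δ j x ≤ d := fun x => by
    refine (hδ2 j x).trans (le_trans ?_ hN.le)
    have : (N : ℝ) ≤ j := by exact_mod_cast hj
    gcongr
  have hwm : Measurable fun x => u x - h x := hum.sub hhc.measurable
  have hsup : ∀ x ∈ Ω, |Sm Ω (δ j) φ h x - h x| ≤ e := fun x hx =>
    Sm_sub_le hΩm (hδ j) hφ hhi (d := d) (fun x y hxy => by
      have := hd (a := y) (b := x) (by rwa [dist_comm, dist_eq_norm])
      rw [Real.dist_eq] at this
      exact this.le) hjd hx
  have hlin : ∀ x ∈ Ω, Sm Ω (δ j) φ u x =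
      Sm Ω (δ j) φ (fun x => u x - h x) x + Sm Ω (δ j) φ h x := fun x hx => by
    unfold Sm
    rw [← integral_add (integrableOn_ker_mul (h := fun x => u x - h x) (hδ j) hφ
      (hui.sub hhi.integrableOn) hx) (integrableOn_ker_mul (hδ j) hφ hhi.integrableOn hx)]
    congr 1; ext y; ring
  have hSw : vModular p Ω (Sm Ω (δ j) φ (fun x => u x - h x)) ≤
      kerC n B * e + K * (kerC n B * e) := by
    refine (Sm_modular hΩm (hδ j) hφ hpm hp1 hM hc hlog hwm zero_le_one
      (by rw [ENNReal.ofReal_one]; exact ha1.trans he1)).trans ?_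
    gcongr
  have hSh : vModular p Ω (fun x => Ω.indicator (Sm Ω (δ j) φ h) x - h x) ≤ e * volume Ω := by
    rw [← setLIntegral_const]
    refine setLIntegral_mono' hΩm fun x hx => ?_
    beta_reduce
    rw [indicator_of_mem hx, ← ENNReal.ofReal_coe_nnreal]
    refine ENNReal.ofReal_le_ofReal ?_
    have hp := hp1 x hx
    have h1 : ((e : ℝ)) ≤ 1 := by exact_mod_cast min_le_right _ _
    have h0 : (0 : ℝ) < e := by exact_mod_cast hepos
    calc _ ≤ (e : ℝ) ^ p x := Real.rpow_le_rpow (abs_nonneg _) (hsup x hx) (by linarith)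
      _ ≤ (e : ℝ) ^ (1 : ℝ) := Real.rpow_le_rpow_of_exponent_ge h0 h1 hp
      _ = e := Real.rpow_one _
  have hbm : Measurable fun x => Ω.indicator (Sm Ω (δ j) φ h) x - u x :=
    (measurable_Sm hΩm (hδ j) hφ hhc.measurable).sub hum
  have hb : vModular p Ω (fun x => Ω.indicator (Sm Ω (δ j) φ h) x - u x) ≤
      A * (e * volume Ω + e) := by
    refine (vModular_add_le hΩm hpm hp1 hM (a := fun x => Ω.indicator (Sm Ω (δ j) φ h) x - h x)
      hwm fun x hx => ?_).trans ?_
    · rw [abs_sub_comm (u x)]; exact abs_sub_le _ _ _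
    · gcongr
  calc _ ≤ A * (vModular p Ω (Sm Ω (δ j) φ (fun x => u x - h x)) +
      vModular p Ω (fun x => Ω.indicator (Sm Ω (δ j) φ h) x - u x)) := by
        refine vModular_add_le hΩm hpm hp1 hM hbm fun x hx => ?_
        rw [indicator_of_mem hx, indicator_of_mem hx, hlin x hx, add_sub_assoc]
        exact abs_add_le _ _
    _ ≤ A * ((kerC n B * e + K * (kerC n B * e)) + A * (e * volume Ω + e)) := by gcongr
    _ = e * D := by rw [hD]; ring
    _ ≤ η := heD

lemma rev_main (hΩ : IsOpen Ω) (hb : Bornology.IsBounded Ω) (hpm : Measurable p)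
    (hp1 : ∀ x ∈ Ω, 1 ≤ p x) (hM : ∀ x ∈ Ω, p x ≤ M) (hc : 0 < c) (hlog : LogHolderOn c Ω p)
    (hpc : ContinuousOn p Ω) {u : Eu n → ℝ} (h : MemBVp p Ω u) : MemBVt p Ω u := by
  have hv : volume Ω < ⊤ := hb.measure_lt_top
  have hΩm := hΩ.measurableSet
  have hum := h.1.1
  have hup := MemLpVar.modular_lt_top hΩm hp1 hM h.1
  obtain ⟨hui, hT, g, hgm, hg0, hw, hgi, hgp⟩ := rev_data hΩ hv hp1 hM hpc h
  obtain ⟨φ, B, hφ⟩ := exists_moll n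
  obtain ⟨C, hC, hCb⟩ := grad_bound hΩ hb hv hpm hp1 hM hc hlog hφ hum hui hT hgm hg0 hw hgi hgp
  have hex : ∀ j : ℕ, ∃ δ : Eu n → ℝ, Scale Ω δ ∧ ∀ x, δ x ≤ 1 / ((j : ℝ) + 1) := fun j =>
    exists_scale hΩ hb (by positivity)
  choose δ hδ hδ2 using hex
  have hul : ∫⁻ x in Ω, ENNReal.ofReal |u x| < ⊤ := by
    have := hui.2
    rw [hasFiniteIntegral_iff_norm] at this
    simpa only [Real.norm_eq_abs] using this
  refine ⟨h.1, ?_⟩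
  unfold bvModular
  refine lt_of_le_of_lt (b := liminf (fun j => gradModular p Ω (Ω.indicator (Sm Ω (δ j) φ u))) atTop)
    (iInf₂_le_of_le (fun j => Ω.indicator (Sm Ω (δ j) φ u))
      ⟨fun j => ⟨locLip_Sm (hδ j) hφ hui, ?_⟩, ?_⟩ le_rfl) ?_
  · refine memLpVar_of_modular (measurable_Sm hΩm (hδ j) hφ hum) ?_
    have e : vModular p Ω (Ω.indicator (Sm Ω (δ j) φ u)) = vModular p Ω (Sm Ω (δ j) φ u) := by
      refine setLIntegral_congr_fun hΩm fun x hx => ?_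
      simp only [indicator_of_mem hx]
    rw [e]
    refine (Sm_modular hΩm (hδ j) hφ hpm hp1 hM hc hlog hum ENNReal.toReal_nonneg
      (ENNReal.ofReal_toReal hul.ne).ge).trans_lt ?_
    have hk := kerC_lt_top n B
    exact ENNReal.add_lt_top.2 ⟨ENNReal.mul_lt_top hk hul,
      ENNReal.mul_lt_top ENNReal.ofReal_lt_top (ENNReal.mul_lt_top hk hup)⟩
  · exact lpTendsto_of_modular hΩm hp1 hM
      (Sm_tendsto hΩm hv hφ hpm hp1 hM hc hlog hum hui hup hδ hδ2)
  · refine lt_of_le_of_lt ?_ hC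
    refine (liminf_le_liminf (Eventually.of_forall fun j => hCb (δ j) (hδ j))).trans ?_
    simp

end

/-- for bounded open `Ω` and locally log-Hölder continuous `p`
with `p⁺ < ∞`, the relaxation-defined space `B̃V^{p(·)}(Ω)` coincides with the
Harjulehto–Hästö–Latvala space `BV^{p(·)}(Ω)`. -/
theorem memBVt_iff_memBVp
    {n : ℕ} (p : Eu n → ℝ) (Ω : Set (Eu n)) (hΩ : IsOpen Ω)
    (hpm : Measurable p) (hp1 : ∀ x ∈ Ω, 1 ≤ p x) (hpb : ∃ M : ℝ, ∀ x ∈ Ω, p x ≤ M)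
    (hΩb : Bornology.IsBounded Ω)
    (hlog : ∃ c : ℝ, 0 < c ∧ LogHolderOn c Ω p) :
    ∀ u : Eu n → ℝ, MemBVt p Ω u ↔ MemBVp p Ω u := by
  obtain ⟨M, hM⟩ := hpb
  obtain ⟨c, hc, hl⟩ := hlog
  have hpc : ContinuousOn p Ω := LogHolderOn.continuousOn hc hl
  exact fun u => ⟨fun h => fwd_main hΩ hpm hΩb.measure_lt_top hp1 hM hpc h,
    fun h => rev_main hΩ hΩb hpm hp1 hM hc hl hpc h⟩
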